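/- Let K be a totally real number field, Q a positive definite quadratic form in n ≥ 5 variables with coefficients in 𝓞_K, and d a positive integer. Then, inside a fixed algebraic closure of K, there exist only finitely many totally real fields L containing K with [L : K] = 2d+1 such that Q(𝓞_L) ∩ 𝓞_K ≠ Q(𝓞_K) while Q(𝓞_{L'}) ∩ 𝓞_K = Q(𝓞_K) for every intermediate field K ⊆ L' ⊊ L with L' a proper subfield of L. -/

import Mathlib

open scoped Matrix

section QuadraticForms

variable {A B ι : Type*} [CommRing A] [CommRing B] [Fintype ι]

/-- The value at `x` of the quadratic form with coefficient matrix `C`. -/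
def qf (C : Matrix ι ι A) (x : ι → A) : A := x ⬝ᵥ C *ᵥ x

lemma qf_add (C : Matrix ι ι A) (x y : ι → A) :
    qf C (x + y) = qf C x + qf C y + x ⬝ᵥ (C + Cᵀ) *ᵥ y := by
  have h : x ⬝ᵥ Cᵀ *ᵥ y = y ⬝ᵥ C *ᵥ x := by
    rw [Matrix.mulVec_transpose, dotProduct_comm, Matrix.dotProduct_mulVec]
  simp only [qf, Matrix.mulVec_add, Matrix.add_mulVec, add_dotProduct, dotProduct_add, h]
  ring

lemma qf_smul (C : Matrix ι ι A) (a : A) (x : ι → A) : qf C (a • x) = a ^ 2 * qf C x := by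
  simp only [qf, Matrix.mulVec_smul, smul_dotProduct, dotProduct_smul, smul_eq_mul]
  ring

@[simp] lemma qf_zero (C : Matrix ι ι A) : qf C 0 = 0 := by simp [qf]

lemma map_qf (f : A →+* B) (C : Matrix ι ι A) (x : ι → A) :
    f (qf C x) = qf (C.map f) (fun i => f (x i)) := by
  simp [qf, dotProduct, Matrix.mulVec, map_sum]

lemma polar_self (C : Matrix ι ι A) (x : ι → A) :
    x ⬝ᵥ (C + Cᵀ) *ᵥ x = 2 * qf C x := by
  have h := qf_add C x x
  have h2 : qf C (x + x) = 4 * qf C x := by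
    rw [show x + x = (2 : A) • x by rw [two_smul], qf_smul]; ring
  linear_combination h2 - h

lemma polar_comm (C : Matrix ι ι A) (x y : ι → A) :
    x ⬝ᵥ (C + Cᵀ) *ᵥ y = y ⬝ᵥ (C + Cᵀ) *ᵥ x := by
  have h1 := qf_add C x y
  have h2 := qf_add C y x
  rw [add_comm y x] at h2
  linear_combination h2 - h1

lemma qf_add_single [DecidableEq ι] (C : Matrix ι ι A) (x : ι → A) (j : ι) (t : A) :
    qf C (x + Pi.single j t) = qf C x + t * ((C + Cᵀ) *ᵥ x) j + t ^ 2 * C j j := by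
  rw [qf_add, polar_comm]
  simp [qf, Matrix.mulVec_single]
  ring

lemma qf_sub_mem (C : Matrix ι ι A) {I : Ideal A} {x y : ι → A} (h : ∀ i, x i - y i ∈ I) :
    qf C x - qf C y ∈ I := by
  rw [← Ideal.Quotient.eq, map_qf, map_qf]
  congr 1
  ext i
  exact Ideal.Quotient.eq.2 (h i)

lemma mulVec_sub_mem (S : Matrix ι ι A) {I : Ideal A} {x y : ι → A} (h : ∀ i, x i - y i ∈ I)
    (j : ι) : (S *ᵥ x) j - (S *ᵥ y) j ∈ I := by
  rw [← Pi.sub_apply, ← Matrix.mulVec_sub]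
  exact I.sum_mem fun i _ => I.mul_mem_left _ (h i)

lemma exists_matrix_of_isHomogeneous (Q : MvPolynomial ι A) (hQ : Q.IsHomogeneous 2) :
    ∃ C : Matrix ι ι A, ∀ {B : Type _} [CommRing B] (f : A →+* B) (x : ι → B),
      MvPolynomial.eval₂ f x Q = qf (C.map f) x := by
  classical
  have key : ∀ s : ι →₀ ℕ, s.degree = 2 → ∃ p : ι × ι, ∀ {B : Type _} [CommRing B] (x : ι → B),
      (s.prod fun i k => x i ^ k) = x p.1 * x p.2 := by
    intro s hs
    have hne : s ≠ 0 := by rintro rfl; simp at hs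
    obtain ⟨i, hi⟩ := Finsupp.ne_iff.1 hne
    have h1 : Finsupp.single i 1 ≤ s := by
      rw [Finsupp.single_le_iff]; simp at hi; lia
    obtain ⟨t, rfl⟩ := exists_add_of_le h1
    rw [map_add, Finsupp.degree_single] at hs
    have hne : t ≠ 0 := by rintro rfl; simp at hs
    obtain ⟨j, hj⟩ := Finsupp.ne_iff.1 hne
    have h1 : Finsupp.single j 1 ≤ t := by
      rw [Finsupp.single_le_iff]; simp at hj; lia
    obtain ⟨u, rfl⟩ := exists_add_of_le h1
    rw [map_add, Finsupp.degree_single] at hs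
    have hu : u = 0 := by
      rw [← Finsupp.degree_eq_zero_iff]; lia
    subst hu
    refine ⟨(i, j), fun x => ?_⟩
    rw [Finsupp.prod_add_index' (by simp) (by intros; exact pow_add _ _ _),
      Finsupp.prod_add_index' (by simp) (by intros; exact pow_add _ _ _)]
    simp
  have hdeg : ∀ s ∈ Q.support, s.degree = 2 := by
    intro s hs
    have := hQ (MvPolynomial.mem_support_iff.1 hs)
    rw [Finsupp.degree_eq_weight_one (R := ℕ)]
    exact this
  rcases isEmpty_or_nonempty ι with hι | hι
  · refine ⟨0, fun {B} _ f x => ?_⟩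
    have : Q = 0 := by
      ext s
      by_contra hs
      simpa [Subsingleton.elim s 0] using hdeg s (MvPolynomial.mem_support_iff.2 hs)
    simp [this, qf]
  choose! p hp using key
  refine ⟨fun i j => ∑ s ∈ Q.support, if p s = (i, j) then Q.coeff s else 0, fun {B} _ f x => ?_⟩
  have : ∀ s ∈ Q.support, f (Q.coeff s) * (s.prod fun i k => x i ^ k) =
      ∑ i, ∑ j, x i * (f (if p s = (i, j) then Q.coeff s else 0) * x j) := by
    intro s hs
    rw [hp s (hdeg s hs), ← Fintype.sum_prod_type', Finset.sum_eq_single (p s)]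
    · simp; ring
    · intro q _ hq; simp [Ne.symm hq]
    · simp
  rw [MvPolynomial.eval₂_eq]
  simp only [Finsupp.prod] at this
  rw [show (∑ d ∈ Q.support, f (Q.coeff d) * ∏ i ∈ d.support, x i ^ d i) = _ from
    Finset.sum_congr rfl this]
  rw [Finset.sum_comm]
  refine Finset.sum_congr rfl fun i _ => ?_
  rw [Finset.sum_comm]
  simp only [Matrix.mulVec, dotProduct, Finset.mul_sum]
  refine Finset.sum_congr rfl fun j _ => ?_
  change _ = x i * (f (∑ s ∈ Q.support, _) * x j)
  rw [map_sum, Finset.sum_mul, Finset.mul_sum]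

end QuadraticForms

section LocalSpringer

open Polynomial

lemma exists_odd_irreducible_factor {k : Type*} [Field k] :
    ∀ (d : ℕ) (f : k[X]), f.natDegree = d → Odd d →
      ∃ (φ ψ : k[X]) (μ : ℕ), Irreducible φ ∧ φ.Monic ∧ Odd (μ * φ.natDegree) ∧
        f = φ ^ μ * ψ ∧ IsCoprime φ ψ := by
  intro d
  induction d using Nat.strong_induction_on with
  | _ d ih =>
    intro f hd hodd
    have hpos : 0 < f.natDegree := by rw [hd]; exact hodd.pos
    have hf0 : f ≠ 0 := by rintro rfl; simp at hpos
    obtain ⟨φ, hm, hirr, hdvd⟩ := exists_monic_irreducible_factor f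
      (not_isUnit_of_natDegree_pos f hpos)
    have hfin : FiniteMultiplicity φ f := FiniteMultiplicity.of_not_isUnit hirr.not_isUnit hf0
    obtain ⟨ψ, hψ, hn⟩ := hfin.exists_eq_pow_mul_and_not_dvd
    set μ := multiplicity φ f with hμ
    have hψ0 : ψ ≠ 0 := by rintro rfl; simp at hn
    have hcop : IsCoprime φ ψ := (hirr.coprime_iff_not_dvd).2 hn
    have hdeg : d = μ * φ.natDegree + ψ.natDegree := by
      rw [← hd, hψ, natDegree_mul (pow_ne_zero _ hirr.ne_zero) hψ0, natDegree_pow]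
    rcases Nat.even_or_odd (μ * φ.natDegree) with he | ho
    · have hψodd : Odd ψ.natDegree := by
        rcases Nat.even_or_odd ψ.natDegree with h | h
        · rw [hdeg] at hodd
          exact absurd (he.add h) (Nat.not_even_iff_odd.2 hodd)
        · exact h
      have hμpos : 0 < μ := by
        rw [hμ]
        exact multiplicity_pos_of_dvd hdvd
      have hlt : ψ.natDegree < d := by
        have := Nat.mul_pos hμpos hirr.natDegree_pos
        lia
      obtain ⟨φ', ψ', μ', hirr', hm', hodd', hψ', hcop'⟩ := ih _ hlt ψ rfl hψodd
      refine ⟨φ', φ ^ μ * ψ', μ', hirr', hm', hodd', by rw [hψ, hψ']; ring, ?_⟩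
      refine IsCoprime.mul_right (IsCoprime.pow_right ?_) hcop'
      have hμ' : μ' ≠ 0 := by rintro rfl; simp at hodd'
      exact (hcop.of_isCoprime_of_dvd_right ((dvd_pow_self φ' hμ').mul_right ψ' |>.trans
        hψ'.symm.dvd)).symm
    · exact ⟨φ, ψ, μ, hirr, hm, ho, hψ, hcop⟩

lemma exists_monic_irreducible_quadratic (k : Type*) [Field k] [Finite k] :
    ∃ q : k[X], q.Monic ∧ Irreducible q ∧ q.natDegree = 2 := by
  have hns : ¬ Function.Surjective (fun x : k => x ^ 2 - x) := by
    intro h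
    have := Finite.injective_iff_surjective.2 h
    exact zero_ne_one (this (by simp) : (0 : k) = 1)
  simp only [Function.Surjective, not_forall, not_exists] at hns
  obtain ⟨c, hc⟩ := hns
  have hq : (X ^ 2 - X - C c : k[X]).natDegree = 2 := by compute_degree!
  have hm : (X ^ 2 - X - C c : k[X]).Monic := by monicity!
  refine ⟨_, hm, ?_, hq⟩
  rw [hm.irreducible_iff_roots_eq_zero_of_degree_le_three (by lia) (by lia)]
  rw [Multiset.eq_zero_iff_forall_notMem]
  intro x hx
  have := (mem_roots'.1 hx).2
  simp only [IsRoot.def, eval_sub, eval_pow, eval_X, eval_C] at this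
  exact hc x (sub_eq_zero.1 this)

variable {A k : Type*} [CommRing A] [Field k] {π : A →+* k} {ϖ : A}

lemma C_dvd_of_map_eq_zero (hker : ∀ x, π x = 0 → ϖ ∣ x) {f : A[X]} (hf : f.map π = 0) :
    C ϖ ∣ f := by
  rw [C_dvd_iff_dvd_coeff]
  intro i
  apply hker
  rw [← coeff_map, hf, coeff_zero]

lemma isCoprime_of_map (hπ : Function.Surjective π) (hker : ∀ x, π x = 0 → ϖ ∣ x)
    (hnil : IsNilpotent ϖ) {f g : A[X]} (h : IsCoprime (f.map π) (g.map π)) : IsCoprime f g := by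
  obtain ⟨u, v, huv⟩ := h
  obtain ⟨u, rfl⟩ := map_surjective π hπ u
  obtain ⟨v, rfl⟩ := map_surjective π hπ v
  have : (u * f + v * g - 1).map π = 0 := by
    simp [huv]
  obtain ⟨e, he⟩ := C_dvd_of_map_eq_zero hker this
  have hu : IsUnit (u * f + v * g) := by
    have hn : IsNilpotent (C ϖ * e) := (Commute.all _ _).isNilpotent_mul_right (hnil.map C)
    rw [show u * f + v * g = 1 + C ϖ * e by rw [← he]; ring]
    exact hn.isUnit_one_add
  obtain ⟨w, hw⟩ := hu.exists_left_inv
  exact ⟨w * u, w * v, by rw [← hw]; ring⟩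

lemma exists_monic_factor_of_map (hπ : Function.Surjective π) (hker : ∀ x, π x = 0 ↔ ϖ ∣ x)
    (hnil : IsNilpotent ϖ) {g : A[X]} {φ ψ : k[X]} (hφ : φ.Monic) (hg : g.map π = φ * ψ)
    (hcop : IsCoprime φ ψ) :
    ∃ G : A[X], G.Monic ∧ G.map π = φ ∧ G ∣ g := by
  have hϖ : π ϖ = 0 := (hker ϖ).2 dvd_rfl
  have key : ∀ j : ℕ, ∃ G H : A[X], G.Monic ∧ G.map π = φ ∧ H.map π = ψ ∧
      C (ϖ ^ (j + 1)) ∣ g - G * H := by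
    intro j
    induction j with
    | zero =>
      obtain ⟨G, hG, -, hGm⟩ := lifts_and_natDegree_eq_and_monic
        ((map_surjective π hπ φ).imp fun _ h => h : φ ∈ lifts π) hφ
      obtain ⟨H, hH⟩ := map_surjective π hπ ψ
      refine ⟨G, H, hGm, hG, hH, ?_⟩
      rw [zero_add, pow_one]
      refine C_dvd_of_map_eq_zero (fun x hx => (hker x).1 hx) ?_
      simp [hg, hG, hH]
    | succ j ih =>
      obtain ⟨G, H, hGm, hG, hH, E, hE⟩ := ih
      obtain ⟨u, v, huv⟩ := isCoprime_of_map hπ (fun x hx => (hker x).1 hx) hnil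
        (f := G) (g := H) (by rwa [hG, hH])
      have hz : (C (ϖ ^ (j + 1)) : A[X]).map π = 0 := by simp [hϖ]
      have hdiv := modByMonic_add_div (v * E) G
      set δ := (v * E) %ₘ G with hδ
      set s := (v * E) /ₘ G
      refine ⟨G + C (ϖ ^ (j + 1)) * δ, H + C (ϖ ^ (j + 1)) * (u * E + H * s), ?_, ?_, ?_, ?_⟩
      · nontriviality A
        refine hGm.add_of_left ?_
        refine lt_of_le_of_lt ?_ (degree_modByMonic_lt (v * E) hGm)
        rw [← smul_eq_C_mul]
        exact degree_smul_le _ _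
      · rw [Polynomial.map_add, Polynomial.map_mul, hz, zero_mul, add_zero, hG]
      · rw [Polynomial.map_add, Polynomial.map_mul, hz, zero_mul, add_zero, hH]
      · have : g - (G + C (ϖ ^ (j + 1)) * δ) * (H + C (ϖ ^ (j + 1)) * (u * E + H * s)) =
            C (ϖ ^ (j + 1 + 1)) * (C (ϖ ^ j) * (- (δ * (u * E + H * s)))) := by
          have h1 : (C (ϖ ^ (j + 1 + 1)) : A[X]) * C (ϖ ^ j) =
              C (ϖ ^ (j + 1)) * C (ϖ ^ (j + 1)) := by
            rw [← C_mul, ← C_mul]; congr 1; ring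
          rw [← mul_assoc, h1]
          linear_combination hE - C (ϖ ^ (j + 1)) * H * hdiv - C (ϖ ^ (j + 1)) * E * huv
        exact ⟨_, this⟩
  obtain ⟨N, hN⟩ := hnil
  obtain ⟨G, H, hGm, hG, -, hE⟩ := key N
  rw [pow_succ, hN, zero_mul, C_0, zero_dvd_iff, sub_eq_zero] at hE
  exact ⟨G, hGm, hG, Dvd.intro H hE.symm⟩

lemma exists_content (hker : ∀ x, π x = 0 → ϖ ∣ x) (hnil : IsNilpotent ϖ) {g : A[X]}
    (hg : g ≠ 0) : ∃ (c : ℕ) (g₀ : A[X]), g = C (ϖ ^ c) * g₀ ∧ g₀.map π ≠ 0 ∧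
      g₀.natDegree ≤ g.natDegree := by
  classical
  have hex : ∃ c : ℕ, ¬ C (ϖ ^ c) ∣ g := by
    obtain ⟨N, hN⟩ := hnil
    exact ⟨N, by rw [hN, C_0, zero_dvd_iff]; exact hg⟩
  have hpos : Nat.find hex ≠ 0 := by
    intro h
    have := Nat.find_spec hex
    rw [h] at this
    simp at this
  obtain ⟨c, hc⟩ := Nat.exists_eq_succ_of_ne_zero hpos
  have h1 : C (ϖ ^ c) ∣ g := by
    by_contra h
    exact Nat.find_min hex (m := c) (by lia) h
  have h2 : ¬ C (ϖ ^ (c + 1)) ∣ g := by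
    have := Nat.find_spec hex
    rwa [hc] at this
  obtain ⟨g₁, h1⟩ := h1
  have hnt : Nontrivial A := ⟨g.leadingCoeff, 0, by simpa using hg⟩
  have hX : (X ^ (g.natDegree + 1) : A[X]).Monic := monic_X_pow _
  have hred : g = C (ϖ ^ c) * (g₁ %ₘ X ^ (g.natDegree + 1)) := by
    rw [← smul_eq_C_mul, ← smul_modByMonic, smul_eq_C_mul, ← h1, eq_comm,
      modByMonic_eq_self_iff hX, degree_X_pow]
    exact lt_of_le_of_lt degree_le_natDegree (by exact_mod_cast Nat.lt_succ_self _)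
  refine ⟨c, _, hred, fun h => h2 ?_, ?_⟩
  · obtain ⟨e, he⟩ := C_dvd_of_map_eq_zero hker h
    refine ⟨e, ?_⟩
    conv_lhs => rw [hred, he]
    rw [pow_succ, C_mul, mul_assoc]
  · have := natDegree_modByMonic_lt g₁ hX (by
      intro h
      have := congrArg natDegree h
      simp at this)
    rw [natDegree_X_pow] at this
    lia

variable {ι : Type*} [Fintype ι]

lemma exists_smaller_monic (hπ : Function.Surjective π) (hker : ∀ x, π x = 0 ↔ ϖ ∣ x)
    (hnil : IsNilpotent ϖ) (M : Matrix ι ι A) (a : A) {g h : A[X]} (Y : ι → A[X]) {φ ψ : k[X]}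
    {μ : ℕ} (hφ : φ.Monic) (hg : g.map π = φ ^ μ * ψ) (hcop : IsCoprime φ ψ)
    (hh : IsCoprime φ (h.map π)) {r : A[X]}
    (hdvd : g ∣ r) (hr : r = qf (M.map C) Y - C a * h ^ 2) :
    ∃ (G : A[X]) (Z : ι → A[X]), G.Monic ∧ G.natDegree = μ * φ.natDegree ∧
      G ∣ qf (M.map C) Z - C a := by
  obtain ⟨G, hGm, hG, hGd⟩ := exists_monic_factor_of_map hπ hker hnil (hφ.pow μ) hg
    (hcop.pow_left)
  have hnt : Nontrivial A := π.domain_nontrivial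
  have hGh : IsCoprime G h := isCoprime_of_map hπ (fun x hx => (hker x).1 hx) hnil
    (by rw [hG]; exact hh.pow_left)
  obtain ⟨u, v, huv⟩ := hGh
  refine ⟨G, v • Y, hGm, ?_, ?_⟩
  · rw [← hGm.natDegree_map π, hG, natDegree_pow]
  · obtain ⟨s, hs⟩ := hGd.trans hdvd
    rw [qf_smul]
    refine ⟨v ^ 2 * s - C a * u * (1 + v * h), ?_⟩
    linear_combination v ^ 2 * hs - v ^ 2 * hr + C a * (1 + v * h) * huv

lemma reflect_qf (M : Matrix ι ι A) (Y : ι → A[X]) {m : ℕ} (hY : ∀ i, (Y i).natDegree ≤ m) :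
    reflect (m + m) (qf (M.map C) Y) = qf (M.map C) (fun i => reflect m (Y i)) := by
  simp only [qf, dotProduct, Matrix.mulVec, Matrix.map_apply, Finset.mul_sum]
  have hadd : ∀ (s : Finset ι) (f : ι → A[X]),
      reflect (m + m) (∑ i ∈ s, f i) = ∑ i ∈ s, reflect (m + m) (f i) := fun s f => by
    classical
    induction s using Finset.induction_on with
    | empty => simp
    | insert i s hi ih => rw [Finset.sum_insert hi, Finset.sum_insert hi, reflect_add, ih]
  rw [hadd]
  refine Finset.sum_congr rfl fun i _ => ?_
  rw [hadd]
  refine Finset.sum_congr rfl fun j _ => ?_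
  rw [mul_left_comm, reflect_C_mul, reflect_mul _ _ (hY i) (hY j)]
  ring

lemma natDegree_qf_le (M : Matrix ι ι A) (Y : ι → A[X]) {m : ℕ}
    (hY : ∀ i, (Y i).natDegree ≤ m) : (qf (M.map C) Y).natDegree ≤ m + m := by
  simp only [qf, dotProduct, Matrix.mulVec, Matrix.map_apply, Finset.mul_sum]
  refine natDegree_sum_le_of_forall_le _ _ fun i _ => natDegree_sum_le_of_forall_le _ _
    fun j _ => ?_
  rw [mul_left_comm]
  exact (natDegree_C_mul_le _ _).trans (natDegree_mul_le.trans (add_le_add (hY i) (hY j)))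

theorem exists_qf_eq_of_odd_monic_dvd [Finite k] (hπ : Function.Surjective π)
    (hker : ∀ x, π x = 0 ↔ ϖ ∣ x) (hnil : IsNilpotent ϖ) (M : Matrix ι ι A) (a : A) :
    ∀ m : ℕ, Odd m → ∀ (G : A[X]) (Z : ι → A[X]), G.Monic → G.natDegree = m →
      G ∣ qf (M.map C) Z - C a → ∃ y : ι → A, qf M y = a := by
  have hnt : Nontrivial A := π.domain_nontrivial
  obtain ⟨q', hq'm, hq'irr, hq'deg⟩ := exists_monic_irreducible_quadratic k
  obtain ⟨q, hq, hqdeg, hqm⟩ := lifts_and_natDegree_eq_and_monic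
    ((map_surjective π hπ q').imp fun _ h => h : q' ∈ lifts π) hq'm
  have hunit : ∀ x : A, π x ≠ 0 → IsUnit x := by
    intro x hx
    obtain ⟨y, hy⟩ := hπ (π x)⁻¹
    obtain ⟨e, he⟩ := (hker (x * y - 1)).1 (by simp [hy, hx])
    have : IsUnit (x * y) := by
      rw [show x * y = 1 + ϖ * e by rw [← he]; ring]
      exact ((Commute.all _ _).isNilpotent_mul_right hnil).isUnit_one_add
    exact isUnit_of_mul_isUnit_left this
  intro m
  induction m using Nat.strong_induction_on with
  | _ m ih =>
    intro hodd G Z hGm hGdeg hdvd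
    obtain ⟨l, hl⟩ := hodd
    set h : A[X] := q ^ l with hh
    have hhdeg : h.natDegree = m - 1 := by
      rw [hh, hqm.natDegree_pow, hqdeg, hq'deg]; lia
    have hhm : h.Monic := hqm.pow l
    have hG1 : G ≠ 1 := by rintro rfl; simp at hGdeg; lia
    set Y : ι → A[X] := fun i => (h * Z i) %ₘ G with hY
    have hYdeg : ∀ i, (Y i).natDegree ≤ m - 1 := fun i => by
      have := natDegree_modByMonic_lt (h * Z i) hGm hG1
      simp only [hY]; lia
    have hdvd' : G ∣ qf (M.map C) Y - C a * h ^ 2 := by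
      have h1 : G ∣ qf (M.map C) Y - qf (M.map C) (h • Z) := by
        rw [← Ideal.mem_span_singleton]
        refine qf_sub_mem _ fun i => Ideal.mem_span_singleton.2 ?_
        refine ⟨-((h * Z i) /ₘ G), ?_⟩
        simp only [hY, Pi.smul_apply, smul_eq_mul]
        linear_combination modByMonic_add_div (h * Z i) G
      rw [qf_smul] at h1
      have h2 := (hdvd.mul_left (h ^ 2)).add h1
      rwa [show h ^ 2 * (qf (M.map C) Z - C a) + (qf (M.map C) Y - h ^ 2 * qf (M.map C) Z) =
        qf (M.map C) Y - C a * h ^ 2 by ring] at h2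
    obtain ⟨g, hg⟩ := hdvd'
    by_cases hg0 : g = 0
    · rw [hg0, mul_zero] at hg
      have h0 : π ((h).eval 0) ≠ 0 := by
        rw [← coeff_zero_eq_eval_zero, ← coeff_map, hh, Polynomial.map_pow, hq,
          coeff_zero_eq_eval_zero, eval_pow]
        refine pow_ne_zero _ fun h0 => ?_
        have := hq'irr.natDegree_pos
        have hdvdX : X ∣ q' := by rw [X_dvd_iff, coeff_zero_eq_eval_zero, h0]
        have := irreducible_X.associated_of_dvd hq'irr hdvdX
        have := natDegree_eq_of_degree_eq (degree_eq_degree_of_associated this)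
        rw [natDegree_X, hq'deg] at this
        lia
      obtain ⟨u, hu⟩ := (hunit _ h0).exists_left_inv
      refine ⟨u • fun i => (Y i).eval 0, ?_⟩
      have h3 : qf M (fun i => (Y i).eval 0) = a * (h.eval 0) ^ 2 := by
        have := congrArg (evalRingHom (0 : A)) (sub_eq_zero.1 hg)
        rw [map_qf] at this
        simpa [Matrix.map_map, Function.comp_def] using this
      rw [qf_smul, h3]
      linear_combination a * (u * eval 0 h + 1) * hu
    · have hFdeg : (G * g).natDegree ≤ (m - 1) + (m - 1) := by
        rw [← hg]
        refine (natDegree_sub_le _ _).trans (max_le (natDegree_qf_le M Y hYdeg) ?_)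
        refine (natDegree_C_mul_le _ _).trans (natDegree_pow_le.trans ?_)
        rw [hhdeg]; lia
      have hgdeg : m + g.natDegree ≤ (m - 1) + (m - 1) := by
        rwa [hGm.natDegree_mul' hg0, hGdeg] at hFdeg
      obtain ⟨c, g₀, hgc, hg₀, hg₀deg⟩ := exists_content (fun x hx => (hker x).1 hx) hnil hg0
      have hcopq : ∀ φ : k[X], Irreducible φ → Odd φ.natDegree → IsCoprime φ q' := by
        intro φ hφ hφo
        refine hφ.coprime_iff_not_dvd.2 fun hd => ?_
        have := natDegree_eq_of_degree_eq
          (degree_eq_degree_of_associated (hφ.associated_of_dvd hq'irr hd))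
        rw [this, hq'deg] at hφo
        exact absurd hφo (by decide)
      rcases Nat.even_or_odd (g₀.map π).natDegree with hev | hod
      · have hle : (g₀.map π).natDegree ≤ m - 2 :=
          natDegree_map_le.trans (hg₀deg.trans (by lia))
        have hlt : (g₀.map π).natDegree < m - 2 := by
          obtain ⟨e, he⟩ := hev
          lia
        set d := (g₀.map π).natDegree with hd
        have hrefl : (reflect (m - 2) g₀).map π = X ^ (m - 2 - d) * (reflect d (g₀.map π)) := by
          rw [← reflect_map]
          conv_lhs => rw [← mul_one (g₀.map π), show m - 2 = d + (m - 2 - d) by lia]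
          rw [reflect_mul _ _ le_rfl (by simp), reflect_one, mul_comm]
        obtain ⟨G', Z', hG'm, hG'd, hG'⟩ := exists_smaller_monic hπ hker hnil M a
          (g := reflect (m - 2) g₀) (h := reflect (m - 1) h)
          (fun i => reflect (m - 1) (Y i)) (φ := X) (μ := m - 2 - d) monic_X hrefl
          (by
            refine irreducible_X.coprime_iff_not_dvd.2 fun hx => ?_
            rw [X_dvd_iff, coeff_reflect, revAt_le (Nat.zero_le _), Nat.sub_zero] at hx
            exact hg₀ (leadingCoeff_eq_zero.1 hx))
          (by
            refine irreducible_X.coprime_iff_not_dvd.2 fun hx => ?_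
            rw [X_dvd_iff, coeff_map, coeff_reflect, revAt_le (Nat.zero_le _), Nat.sub_zero,
              ← hhdeg, hhm.coeff_natDegree, map_one] at hx
            exact one_ne_zero hx)
          (r := reflect ((m - 1) + (m - 1)) (G * g))
          (by
            rw [hgc, show (m - 1) + (m - 1) = m + (m - 2) by lia,
              show G * (C (ϖ ^ c) * g₀) = C (ϖ ^ c) * (G * g₀) by ring, reflect_C_mul,
              reflect_mul _ _ hGdeg.le (hg₀deg.trans (by lia))]
            exact Dvd.intro_left (C (ϖ ^ c) * reflect m G) (by ring))
          (by
            rw [← hg, sub_eq_add_neg, reflect_add, reflect_qf M Y hYdeg, sub_eq_add_neg,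
              show -(C a * h ^ 2) = C (-a) * (h * h) by rw [C_neg]; ring, reflect_C_mul,
              reflect_mul _ _ hhdeg.le hhdeg.le, C_neg]
            ring)
        refine ih _ ?_ ?_ G' Z' hG'm rfl hG'
        · rw [hG'd, natDegree_X]; lia
        · rw [hG'd, natDegree_X, mul_one]
          obtain ⟨e, he⟩ := hev
          exact ⟨l - 1 - e, by lia⟩
      · obtain ⟨φ, ψ, μ, hφi, hφm, hφo, hφψ, hcop⟩ :=
          exists_odd_irreducible_factor _ _ rfl hod
        obtain ⟨G', Z', hG'm, hG'd, hG'⟩ := exists_smaller_monic hπ hker hnil M a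
          (g := g₀) (h := h) Y hφm hφψ hcop
          (by
            rw [hh, Polynomial.map_pow, hq]
            exact (hcopq φ hφi (Nat.odd_mul.1 hφo).2).pow_right)
          (r := G * g) (by rw [hgc]; exact Dvd.intro_left (G * C (ϖ ^ c)) (by ring)) hg.symm
        refine ih _ ?_ ?_ G' Z' hG'm rfl hG'
        · have h1 : μ * φ.natDegree ≤ (g₀.map π).natDegree := by
            rw [← natDegree_pow]
            exact natDegree_le_of_dvd (Dvd.intro _ hφψ.symm) hg₀
          have h2 : (g₀.map π).natDegree ≤ g₀.natDegree := natDegree_map_le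
          lia
        · rwa [hG'd]

end LocalSpringer

section OddDegree

open Polynomial NumberField

section Residue

variable {R S : Type*} [CommRing R] [CommRing S] [Algebra R S]

lemma pow_le_sup_pow [IsDedekindDomain S] {I P : Ideal S} [P.IsPrime] (hP : P ≠ ⊥) {e : ℕ}
    (h : ¬ I ≤ P ^ (e + 1)) (n : ℕ) : P ^ e ≤ I ⊔ P ^ n := by
  have h1 : I ⊔ P ^ n ∣ P ^ n := Ideal.dvd_iff_le.2 le_sup_right
  obtain ⟨i, -, hi⟩ := (dvd_prime_pow (Ideal.prime_of_isPrime hP inferInstance) n).1 h1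
  rw [associated_iff_eq] at hi
  rw [hi]
  refine Ideal.pow_le_pow_right ?_
  by_contra! hlt
  exact h ((le_sup_left.trans hi.le).trans (Ideal.pow_le_pow_right hlt))

/-- Some element generates the residue field extension and satisfies a lift of its minimal
polynomial to first order only. -/
lemma exists_residue_generator [IsDedekindDomain S] {p : Ideal R} [p.IsMaximal] [Finite (R ⧸ p)]
    {P : Ideal S} [P.IsMaximal] [P.LiesOver p] [Finite (S ⧸ P)] (hP : P ≠ ⊥) :
    ∃ (θ : S) (φ : R[X]), φ.Monic ∧ φ.natDegree = Module.finrank (R ⧸ p) (S ⧸ P) ∧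
      aeval θ φ ∈ P ∧ aeval θ φ ∉ P ^ 2 ∧
      ∀ s : S, ∃ g : R[X], g.degree < φ.natDegree ∧ s - aeval θ g ∈ P := by
  let := Ideal.Quotient.field p
  let := Ideal.Quotient.field P
  have : Module.Finite (R ⧸ p) (S ⧸ P) := Module.Finite.of_finite
  obtain ⟨α, hα⟩ := Field.exists_primitive_element (R ⧸ p) (S ⧸ P)
  have hint : IsIntegral (R ⧸ p) α := Algebra.IsIntegral.isIntegral α
  have hdeg : (minpoly (R ⧸ p) α).natDegree = Module.finrank (R ⧸ p) (S ⧸ P) :=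
    Field.primitive_element_iff_minpoly_natDegree_eq _ _ |>.1 hα
  have hsep : (minpoly (R ⧸ p) α).Separable := Algebra.IsSeparable.isSeparable (R ⧸ p) α
  have hmk : Function.Surjective (Ideal.Quotient.mk p) := Ideal.Quotient.mk_surjective
  obtain ⟨φ, hφ, hφd, hφm⟩ := lifts_and_natDegree_eq_and_monic
    ((map_surjective _ hmk (minpoly (R ⧸ p) α)).imp fun _ h => h :
      minpoly (R ⧸ p) α ∈ lifts (Ideal.Quotient.mk p)) (minpoly.monic hint)
  have hev : ∀ (θ : S) (g : R[X]), Ideal.Quotient.mk P θ = α →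
      Ideal.Quotient.mk P (aeval θ g) = aeval α (g.map (Ideal.Quotient.mk p)) := by
    intro θ g hθ
    have hc : (algebraMap (R ⧸ p) (S ⧸ P)).comp (Ideal.Quotient.mk p) =
        (Ideal.Quotient.mk P).comp (algebraMap R S) := by
      ext r
      simp
    rw [aeval_def, aeval_def, eval₂_map, hom_eval₂, hθ, hc]
  obtain ⟨θ₀, hθ₀⟩ := Ideal.Quotient.mk_surjective α
  have hmem : ∀ θ : S, Ideal.Quotient.mk P θ = α → aeval θ φ ∈ P := by
    intro θ hθ
    rw [← Ideal.Quotient.eq_zero_iff_mem, hev θ φ hθ, hφ, minpoly.aeval]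
  have hex : ∃ θ : S, Ideal.Quotient.mk P θ = α ∧ aeval θ φ ∉ P ^ 2 := by
    by_cases h2 : aeval θ₀ φ ∈ P ^ 2
    · obtain ⟨ϖ, hϖ, hϖ2⟩ : ∃ ϖ ∈ P, ϖ ∉ P ^ 2 :=
        SetLike.exists_of_lt (Ideal.pow_right_strictAnti P hP
          (Ideal.IsMaximal.ne_top inferInstance) one_lt_two |>.trans_eq (pow_one P))
      refine ⟨θ₀ + ϖ, by simp [hθ₀, Ideal.Quotient.eq_zero_iff_mem.2 hϖ], fun h => ?_⟩
      obtain ⟨c, hc⟩ := (φ.map (algebraMap R S)).binomExpansion θ₀ ϖ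
      rw [eval_map_algebraMap, eval_map_algebraMap, derivative_map, eval_map_algebraMap] at hc
      have h3 : aeval θ₀ (derivative φ) * ϖ ∈ P ^ 2 := by
        have h4 : aeval θ₀ (derivative φ) * ϖ =
            aeval (θ₀ + ϖ) φ - aeval θ₀ φ - c * ϖ ^ 2 := by rw [hc]; ring
        rw [h4]
        exact sub_mem (sub_mem h h2) (Ideal.mul_mem_left _ _ (Ideal.pow_mem_pow hϖ 2))
      have h5 : aeval θ₀ (derivative φ) ∉ P := by
        rw [← Ideal.Quotient.eq_zero_iff_mem, hev _ _ hθ₀, ← derivative_map, hφ]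
        exact hsep.aeval_derivative_ne_zero (minpoly.aeval _ _)
      obtain ⟨y, hy⟩ :=
        Ideal.Quotient.mk_surjective (Ideal.Quotient.mk P (aeval θ₀ (derivative φ)))⁻¹
      have h6 : aeval θ₀ (derivative φ) * y - 1 ∈ P := by
        rw [← Ideal.Quotient.eq_zero_iff_mem, map_sub, map_mul, hy, mul_inv_cancel₀, map_one,
          sub_self]
        rwa [Ne, Ideal.Quotient.eq_zero_iff_mem]
      refine hϖ2 ?_
      have h7 : ϖ = y * (aeval θ₀ (derivative φ) * ϖ) -
        (aeval θ₀ (derivative φ) * y - 1) * ϖ := by ring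
      rw [h7]
      refine sub_mem (Ideal.mul_mem_left _ _ h3) ?_
      rw [pow_two]
      exact Ideal.mul_mem_mul h6 hϖ
    · exact ⟨θ₀, hθ₀, h2⟩
  obtain ⟨θ, hθ, hθ2⟩ := hex
  refine ⟨θ, φ, hφm, hφd.trans hdeg, hmem θ hθ, hθ2, fun s => ?_⟩
  have hs : (Ideal.Quotient.mk P s) ∈ Algebra.adjoin (R ⧸ p) {α} := by
    have := congrArg IntermediateField.toSubalgebra hα
    rw [IntermediateField.adjoin_simple_toSubalgebra_of_isAlgebraic hint.isAlgebraic] at this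
    rw [this]
    trivial
  rw [Algebra.adjoin_singleton_eq_range_aeval] at hs
  obtain ⟨g₀, hg₀⟩ := hs
  obtain ⟨g, hg⟩ := map_surjective _ hmk g₀
  have hR : Nontrivial R := (Ideal.Quotient.mk p).domain_nontrivial
  refine ⟨g %ₘ φ, (degree_modByMonic_lt g hφm).trans_le degree_le_natDegree, ?_⟩
  have h1 : s - aeval θ (g %ₘ φ) = (s - aeval θ g) + aeval θ φ * aeval θ (g /ₘ φ) := by
    conv_rhs => rw [← modByMonic_add_div g φ]
    rw [map_add, map_mul]
    have : (g %ₘ φ + φ * (g /ₘ φ)) /ₘ φ = g /ₘ φ := by rw [modByMonic_add_div]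
    rw [this]
    ring
  rw [h1]
  refine add_mem ?_ (Ideal.mul_mem_right _ _ (hmem θ hθ))
  rw [← Ideal.Quotient.eq_zero_iff_mem, map_sub, hev θ g hθ, hg, ← hg₀]
  exact sub_self _

lemma exists_sub_aeval_mem_pow [IsDedekindDomain S] [Nontrivial R] {P : Ideal S} [P.IsMaximal]
    (hP : P ≠ ⊥) {θ : S} {φ : R[X]} (hφ : φ.Monic) (h1 : aeval θ φ ∈ P) (h2 : aeval θ φ ∉ P ^ 2)
    (hres : ∀ s : S, ∃ g : R[X], g.degree < φ.natDegree ∧ s - aeval θ g ∈ P) (r : ℕ) (s : S) :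
    ∃ g : R[X], g.degree < (φ.natDegree * r : ℕ) ∧ s - aeval θ g ∈ P ^ r := by
  have hspan : ∀ r : ℕ, P ^ r ≤ Ideal.span {aeval θ φ ^ r} ⊔ P ^ (r + 1) := by
    intro r
    induction r with
    | zero => simp
    | succ r ih =>
      have hb : P ≤ Ideal.span {aeval θ φ} ⊔ P ^ 2 := by
        have := pow_le_sup_pow (e := 1) hP
          (I := Ideal.span {aeval θ φ}) (by rwa [Ideal.span_singleton_le_iff_mem]) 2
        rwa [pow_one] at this
      calc P ^ (r + 1) = P ^ r * P := pow_succ _ _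
        _ ≤ (Ideal.span {aeval θ φ ^ r} ⊔ P ^ (r + 1)) * (Ideal.span {aeval θ φ} ⊔ P ^ 2) :=
          Ideal.mul_mono ih hb
        _ ≤ _ := by
          rw [Ideal.sup_mul, Ideal.mul_sup, Ideal.mul_sup, Ideal.span_singleton_mul_span_singleton,
            ← pow_succ, ← pow_add]
          refine sup_le (sup_le le_sup_left (le_sup_of_le_right ?_))
            (sup_le (le_sup_of_le_right ?_) (le_sup_of_le_right (Ideal.pow_le_pow_right (by lia))))
          · rw [show r + 1 + 1 = r + 2 by lia, pow_add]
            refine Ideal.mul_mono_left ?_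
            rw [Ideal.span_singleton_le_iff_mem]
            exact Ideal.pow_mem_pow h1 r
          · rw [pow_succ P (r + 1)]
            refine Ideal.mul_mono_right ?_
            rwa [Ideal.span_singleton_le_iff_mem]
  induction r with
  | zero => exact ⟨0, by simp, by simp⟩
  | succ r ih =>
    obtain ⟨g, hg, hgs⟩ := ih
    obtain ⟨t, ht, u, hu, htu⟩ := Submodule.mem_sup.1 (hspan r hgs)
    obtain ⟨t, rfl⟩ := Ideal.mem_span_singleton'.1 ht
    obtain ⟨h, hh, hht⟩ := hres t
    refine ⟨g + φ ^ r * h, ?_, ?_⟩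
    · refine (degree_add_le _ _).trans_lt (max_lt (hg.trans_le ?_) ?_)
      · exact_mod_cast Nat.mul_le_mul_left _ (by lia)
      · rw [mul_comm, (hφ.pow r).degree_mul, degree_eq_natDegree (hφ.pow r).ne_zero,
          hφ.natDegree_pow, mul_add, mul_one, mul_comm r, add_comm (φ.natDegree * r), Nat.cast_add]
        exact WithBot.add_lt_add_right (WithBot.natCast_ne_bot _) hh
    · have : s - aeval θ (g + φ ^ r * h) = (t - aeval θ h) * aeval θ φ ^ r + u := by
        simp only [map_add, map_mul, map_pow]
        linear_combination -htu
      rw [this]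
      refine add_mem ?_ hu
      rw [pow_succ']
      exact Ideal.mul_mem_mul hht (Ideal.pow_mem_pow h1 r)

lemma sup_pow_smul_top_eq_top {M : Type*} [AddCommGroup M] [Module R M] {N : Submodule R M}
    {I : Ideal R} (h : N ⊔ I • ⊤ = ⊤) (k : ℕ) : N ⊔ I ^ k • ⊤ = ⊤ := by
  induction k with
  | zero => rw [pow_zero, Ideal.one_eq_top, Submodule.top_smul, sup_top_eq]
  | succ j ih =>
    refine eq_top_iff.2 (ih.ge.trans (sup_le le_sup_left ?_))
    calc I ^ j • ⊤ = I ^ j • (N ⊔ I • ⊤) := by rw [h]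
      _ = I ^ j • N ⊔ I ^ (j + 1) • ⊤ := by
        rw [Submodule.smul_sup, ← Submodule.mul_smul, ← pow_succ]
      _ ≤ N ⊔ I ^ (j + 1) • ⊤ := sup_le_sup_right Submodule.smul_le_right _

/-- A local extension of finite residue degree is monogenic modulo powers of the prime. -/
lemma exists_generator_mod_pow [IsDedekindDomain S] {p : Ideal R} [p.IsMaximal] [Finite (R ⧸ p)]
    {P : Ideal S} [P.IsMaximal] [P.LiesOver p] [Finite (S ⧸ P)] (hP : P ≠ ⊥) {e : ℕ}
    (hle : p.map (algebraMap R S) ≤ P ^ e) (hnle : ¬ p.map (algebraMap R S) ≤ P ^ (e + 1))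
    (k : ℕ) : ∃ θ : S, ∀ s : S, ∃ g : R[X],
      g.degree < (Module.finrank (R ⧸ p) (S ⧸ P) * e : ℕ) ∧ s - aeval θ g ∈ P ^ (e * k) := by
  have hR : Nontrivial R := (Ideal.Quotient.mk p).domain_nontrivial
  obtain ⟨θ, φ, hφ, hφd, h1, h2, hres⟩ := exists_residue_generator (p := p) hP
  refine ⟨θ, ?_⟩
  set m := Module.finrank (R ⧸ p) (S ⧸ P) * e
  set N : Submodule R S := (degreeLT R m).map (aeval θ).toLinearMap ⊔
    (P ^ (e * k)).restrictScalars R with hN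
  have step : N ⊔ p • ⊤ = ⊤ := by
    rw [eq_top_iff]
    intro s _
    obtain ⟨g, hg, hgs⟩ := exists_sub_aeval_mem_pow hP hφ h1 h2 hres e s
    rw [hφd] at hg
    obtain ⟨t, ht, u, hu, htu⟩ := Submodule.mem_sup.1 (pow_le_sup_pow hP hnle (e * k) hgs)
    rw [show s = aeval θ g + u + t by linear_combination -htu]
    refine Submodule.add_mem_sup (Submodule.add_mem_sup ?_ hu) ?_
    · exact Submodule.mem_map_of_mem (f := (aeval θ).toLinearMap) (mem_degreeLT.2 hg)
    · rwa [Ideal.smul_top_eq_map]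
  intro s
  have hs : s ∈ N ⊔ p ^ k • ⊤ := by rw [sup_pow_smul_top_eq_top step]; trivial
  rw [sup_eq_left.2] at hs
  · obtain ⟨t, ht, u, hu, rfl⟩ := Submodule.mem_sup.1 hs
    obtain ⟨g, hg, rfl⟩ := ht
    exact ⟨g, mem_degreeLT.1 hg, by simpa using hu⟩
  · rw [Ideal.smul_top_eq_map, Ideal.map_pow]
    refine le_sup_of_le_right ?_
    rw [Submodule.restrictScalars_le, pow_mul]
    exact Ideal.pow_right_mono hle k

end Residue

variable {ι : Type*} [Fintype ι]

lemma exists_qf_sub_mem_of_prime_over {R S : Type*} [CommRing R] [IsDedekindDomain R] [CommRing S]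
    [IsDedekindDomain S] [Module.Free ℤ R] [Module.Free ℤ S] [Module.Finite ℤ R]
    [Module.Finite ℤ S] [Algebra R S] {p : Ideal R} [p.IsMaximal] (hp : p ≠ ⊥)
    {P : Ideal S} [P.IsMaximal] [P.LiesOver p] (hP : P ≠ ⊥) [Finite (R ⧸ p)] [Finite (S ⧸ P)]
    {e : ℕ} (hle : p.map (algebraMap R S) ≤ P ^ e) (hnle : ¬ p.map (algebraMap R S) ≤ P ^ (e + 1))
    (hodd : Odd (e * Module.finrank (R ⧸ p) (S ⧸ P))) (M : Matrix ι ι R) (a : R) (x : ι → S)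
    (hx : qf (M.map (algebraMap R S)) x = algebraMap R S a) {k : ℕ} (hk : k ≠ 0) :
    ∃ y : ι → R, qf M y - a ∈ p ^ k := by
  obtain ⟨θ, hθ⟩ := exists_generator_mod_pow (p := p) hP hle hnle k
  set m := Module.finrank (R ⧸ p) (S ⧸ P) * e with hm
  let A := R ⧸ p ^ k
  let B := S ⧸ P ^ (e * k)
  have hcomap : p ^ k ≤ (P ^ (e * k)).comap (algebraMap R S) := by
    rw [← Ideal.map_le_iff_le_comap, Ideal.map_pow, pow_mul]
    exact Ideal.pow_right_mono hle k
  let f : A →+* B := Ideal.quotientMap _ (algebraMap R S) hcomap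
  let ev : A[X] →+* B := eval₂RingHom f (Ideal.Quotient.mk _ θ)
  have hfc : f.comp (Ideal.Quotient.mk (p ^ k)) =
      (Ideal.Quotient.mk (P ^ (e * k))).comp (algebraMap R S) := by
    ext r
    rfl
  have hev : ∀ g : R[X], ev (g.map (Ideal.Quotient.mk _)) = Ideal.Quotient.mk _ (aeval θ g) := by
    intro g
    simp only [ev, coe_eval₂RingHom]
    rw [eval₂_map, aeval_def, hom_eval₂, hfc]
  have hA : Nontrivial A := Ideal.Quotient.nontrivial_iff.2 (by
    intro h
    exact Ideal.IsMaximal.ne_top ‹p.IsMaximal› (top_le_iff.1 (h ▸ Ideal.pow_le_self hk)))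
  have hlift : ∀ b : B, ∃ g : A[X], g.degree < (m : ℕ) ∧ ev g = b := by
    intro b
    obtain ⟨s, rfl⟩ := Ideal.Quotient.mk_surjective b
    obtain ⟨g, hg, hgs⟩ := hθ s
    refine ⟨g.map (Ideal.Quotient.mk _), (degree_map_le).trans_lt hg, ?_⟩
    rw [hev]
    exact (Ideal.Quotient.eq.2 hgs).symm
  have hfinA : Finite A := Ideal.finiteQuotientOfFreeOfNeBot _ (pow_ne_zero _ hp)
  have hfinB : Finite B := Ideal.finiteQuotientOfFreeOfNeBot _ (pow_ne_zero _ hP)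
  have hcard : Nat.card (degreeLT A m) = Nat.card B := by
    rw [Nat.card_congr (degreeLTEquiv A m).toEquiv, Nat.card_fun, Nat.card_fin]
    have h1 : Nat.card A = Nat.card (R ⧸ p) ^ k := by
      have := map_pow Ideal.absNorm p k
      rwa [Ideal.absNorm_apply, Ideal.absNorm_apply] at this
    have h2 : Nat.card B = Nat.card (S ⧸ P) ^ (e * k) := by
      have := map_pow Ideal.absNorm P (e * k)
      rwa [Ideal.absNorm_apply, Ideal.absNorm_apply] at this
    let := Ideal.Quotient.field p
    have : Module.Finite (R ⧸ p) (S ⧸ P) := Module.Finite.of_finite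
    rw [h1, h2, Module.natCard_eq_pow_finrank (K := R ⧸ p) (V := S ⧸ P), ← pow_mul, ← pow_mul, hm]
    congr 1
    ring
  have hfinD : Finite (degreeLT A m) := Finite.of_equiv _ (degreeLTEquiv A m).symm.toEquiv
  have hinj : ∀ g : A[X], g.degree < (m : ℕ) → ev g = 0 → g = 0 := by
    have hbij : Function.Bijective (fun g : degreeLT A m => ev g) := by
      rw [Nat.bijective_iff_surjective_and_card]
      refine ⟨fun b => ?_, hcard⟩
      obtain ⟨g, hg, hgb⟩ := hlift b
      exact ⟨⟨g, mem_degreeLT.2 hg⟩, hgb⟩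
    intro g hg h0
    have := hbij.1 (a₁ := ⟨g, mem_degreeLT.2 hg⟩) (a₂ := 0) (by simpa using h0)
    exact congrArg Subtype.val this
  obtain ⟨F, hF, hFe⟩ := hlift (Ideal.Quotient.mk _ θ ^ m)
  have hF' : F.degree < (X ^ m : A[X]).degree := by rwa [degree_X_pow]
  have hGm : (X ^ m - F).Monic := (monic_X_pow m).sub_of_left hF'
  have hGd : (X ^ m - F).natDegree = m :=
    natDegree_eq_of_degree_eq_some ((degree_sub_eq_left_of_degree_lt hF').trans (degree_X_pow m))
  choose Z hZd hZ using fun i => hlift (Ideal.Quotient.mk _ (x i))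
  have hG0 : ev (X ^ m - F) = 0 := by
    rw [map_sub, hFe, map_pow]
    simp [ev]
  let := Ideal.Quotient.field p
  obtain ⟨ϖ, hϖ⟩ := IsDedekindDomain.exists_sup_span_eq (Ideal.pow_le_self hk) (pow_ne_zero k hp)
  have hϖp : ϖ ∈ p := hϖ ▸ Ideal.mem_sup_right (Ideal.mem_span_singleton_self ϖ)
  obtain ⟨y, hy⟩ := exists_qf_eq_of_odd_monic_dvd (A := A) (k := R ⧸ p)
    (π := Ideal.Quotient.factor (Ideal.pow_le_self hk)) (ϖ := Ideal.Quotient.mk _ ϖ)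
    (Ideal.Quotient.factor_surjective _)
    (by
      intro z
      obtain ⟨z, rfl⟩ := Ideal.Quotient.mk_surjective z
      rw [Ideal.Quotient.factor_mk, Ideal.Quotient.eq_zero_iff_mem]
      constructor
      · intro hz
        rw [← hϖ] at hz
        obtain ⟨s, hs, t, ht, rfl⟩ := Submodule.mem_sup.1 hz
        obtain ⟨c, rfl⟩ := Ideal.mem_span_singleton'.1 ht
        exact ⟨Ideal.Quotient.mk _ c, by
          rw [map_add, Ideal.Quotient.eq_zero_iff_mem.2 hs, zero_add, map_mul, mul_comm]⟩
      · rintro ⟨c, hc⟩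
        obtain ⟨c, rfl⟩ := Ideal.Quotient.mk_surjective c
        rw [← map_mul, Ideal.Quotient.eq] at hc
        have := add_mem (Ideal.pow_le_self hk hc) (Ideal.mul_mem_right c _ hϖp)
        rwa [sub_add_cancel] at this)
    ⟨k, by rw [← map_pow, Ideal.Quotient.eq_zero_iff_mem]; exact Ideal.pow_mem_pow hϖp k⟩
    (M.map (Ideal.Quotient.mk _)) (Ideal.Quotient.mk _ a) m (by rwa [hm, mul_comm])
    (X ^ m - F) Z hGm hGd (by
      rw [← modByMonic_eq_zero_iff_dvd hGm]
      refine hinj _ ((degree_modByMonic_lt _ hGm).trans_le (degree_le_natDegree.trans_eq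
        (by rw [hGd]))) ?_
      rw [modByMonic_eq_sub_mul_div, map_sub, map_mul, hG0, zero_mul, sub_zero, map_sub, map_qf,
        sub_eq_zero]
      have h1 := congrArg (Ideal.Quotient.mk (P ^ (e * k))) hx
      rw [map_qf] at h1
      simp only [hZ]
      convert h1 using 2
      · ext i j
        simp only [ev, Matrix.map_apply, coe_eval₂RingHom, eval₂_C]
        rfl
      · simp only [ev, coe_eval₂RingHom, eval₂_C]
        rfl)
  choose w hw using fun i => Ideal.Quotient.mk_surjective (y i)
  refine ⟨w, ?_⟩
  rw [← Ideal.Quotient.eq, map_qf]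
  simpa only [hw] using hy

theorem exists_qf_sub_mem_of_odd_finrank {K L : Type*} [Field K] [NumberField K] [Field L]
    [NumberField L] [Algebra K L] (hodd : Odd (Module.finrank K L)) (M : Matrix ι ι (𝓞 K))
    (a : 𝓞 K) (x : ι → 𝓞 L) (hx : qf (M.map (algebraMap (𝓞 K) (𝓞 L))) x = algebraMap _ _ a)
    (p : Ideal (𝓞 K)) [p.IsMaximal] (hp : p ≠ ⊥) (k : ℕ) : ∃ y : ι → 𝓞 K, qf M y - a ∈ p ^ k := by
  rcases eq_or_ne k 0 with rfl | hk
  · exact ⟨0, by simp⟩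
  have hsum := Ideal.sum_ramification_inertia (𝓞 L) K L hp
  rw [← hsum, Finset.odd_sum_iff_odd_card_odd] at hodd
  obtain ⟨P, hPmem⟩ := Finset.card_pos.1 hodd.pos
  rw [Finset.mem_filter, IsDedekindDomain.mem_primesOverFinset_iff hp] at hPmem
  obtain ⟨⟨hPp, hPl⟩, hef⟩ := hPmem
  have hP0 : P ≠ ⊥ := Ideal.ne_bot_of_liesOver_of_ne_bot hp P
  have hPm : P.IsMaximal := hPp.isMaximal hP0
  have hfin : FiniteMultiplicity P (p.map (algebraMap (𝓞 K) (𝓞 L))) := by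
    refine FiniteMultiplicity.of_prime_left (Ideal.prime_of_isPrime hP0 hPp) ?_
    exact Ideal.map_ne_bot_of_ne_bot hp
  have h1 := Ideal.dvd_iff_le.1 (pow_multiplicity_dvd P (p.map (algebraMap (𝓞 K) (𝓞 L))))
  have h2 := fun h => hfin.not_pow_dvd_of_multiplicity_lt (Nat.lt_succ_self _)
    (Ideal.dvd_iff_le.2 h)
  rw [Ideal.inertiaDeg'_algebraMap, Ideal.ramificationIdx'_spec h1 h2] at hef
  have : Finite (𝓞 K ⧸ p) := Ideal.finiteQuotientOfFreeOfNeBot _ hp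
  have : Finite (𝓞 L ⧸ P) := Ideal.finiteQuotientOfFreeOfNeBot _ hP0
  exact exists_qf_sub_mem_of_prime_over hp hP0 h1 h2 hef M a x hx hk

end OddDegree

section Isotropy

variable {ι : Type*} [Fintype ι]

/-- A quadratic form in three variables over a finite field has a nontrivial zero. -/
lemma exists_ne_zero_qf_eq_zero {k : Type*} [Field k] [Finite k] (M : Matrix ι ι k)
    (h : 2 < Fintype.card ι) : ∃ x : ι → k, x ≠ 0 ∧ qf M x = 0 := by
  classical
  have := Fintype.ofFinite k
  let f : MvPolynomial ι k := ∑ i, ∑ j, MvPolynomial.C (M i j) * MvPolynomial.X i * MvPolynomial.X j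
  have hf : ∀ x, MvPolynomial.eval x f = qf M x := by
    intro x
    simp only [f, map_sum, map_mul, MvPolynomial.eval_C, MvPolynomial.eval_X, qf, dotProduct,
      Matrix.mulVec, Finset.mul_sum]
    refine Finset.sum_congr rfl fun i _ => Finset.sum_congr rfl fun j _ => by ring
  have hdeg : f.totalDegree ≤ 2 := by
    refine MvPolynomial.totalDegree_finsetSum_le fun i _ =>
      MvPolynomial.totalDegree_finsetSum_le fun j _ => ?_
    refine (MvPolynomial.totalDegree_mul _ _).trans ?_
    refine (add_le_add (MvPolynomial.totalDegree_mul _ _) le_rfl).trans ?_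
    simp [MvPolynomial.totalDegree_X]
  obtain ⟨p, hp⟩ := CharP.exists k
  have hpp : Fact p.Prime := ⟨CharP.char_is_prime k p⟩
  have hdvd := char_dvd_card_solutions p (hdeg.trans_lt h)
  have h0 : MvPolynomial.eval 0 f = 0 := by rw [hf, qf_zero]
  have hlt : 1 < Fintype.card {x : ι → k // MvPolynomial.eval x f = 0} :=
    lt_of_lt_of_le hpp.out.one_lt (Nat.le_of_dvd (Fintype.card_pos_iff.2 ⟨⟨0, h0⟩⟩) hdvd)
  obtain ⟨x, hx⟩ := Fintype.exists_ne_of_one_lt_card hlt ⟨0, h0⟩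
  exact ⟨x, fun h => hx (Subtype.ext h), by rw [← hf]; exact x.2⟩

lemma qf_mulVec {A κ : Type*} [CommRing A] [Fintype κ] (M : Matrix ι ι A) (B : Matrix ι κ A)
    (c : κ → A) : qf (Bᵀ * M * B) c = qf M (B *ᵥ c) := by
  rw [qf, qf, ← Matrix.mulVec_mulVec, ← Matrix.mulVec_mulVec, Matrix.dotProduct_mulVec,
    Matrix.vecMul_transpose]

/-- If the zero locus of a quadratic form over a finite field is a subspace, then the form is
nondegenerate on a space of dimension at most two. -/
lemma finrank_le_of_coe_eq_zeros {k : Type*} [Field k] [Finite k] (M : Matrix ι ι k)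
    (U : Submodule k (ι → k)) (hU : ∀ x, x ∈ U ↔ qf M x = 0) :
    Fintype.card ι ≤ Module.finrank k U + 2 := by
  obtain ⟨W, hW⟩ := Submodule.exists_isCompl U
  have hdim := Submodule.finrank_add_eq_of_isCompl hW
  rw [Module.finrank_fintype_fun_eq_card] at hdim
  by_contra! hlt
  obtain ⟨f, hf⟩ := exists_linearIndependent_of_le_finrank (R := k) (M := W) (n := 3) (by lia)
  let B : Matrix ι (Fin 3) k := Matrix.of fun i j => (f j : ι → k) i
  have hB : ∀ c, B *ᵥ c = ((∑ j, c j • f j : W) : ι → k) := by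
    intro c
    ext i
    simp [B, Matrix.mulVec, dotProduct, mul_comm]
  obtain ⟨c, hc, hc0⟩ := exists_ne_zero_qf_eq_zero (Bᵀ * M * B) (by simp)
  rw [qf_mulVec, hB, ← hU] at hc0
  have h0 := Submodule.disjoint_def.1 hW.disjoint _ hc0 (Subtype.coe_prop _)
  exact hc (funext (Fintype.linearIndependent_iff.1 hf c (Subtype.ext h0)))

lemma polar_single {A : Type*} [CommRing A] [DecidableEq ι] (M : Matrix ι ι A) (i j : ι) :
    qf M (Pi.single i 1 + Pi.single j 1) - qf M (Pi.single i 1) - qf M (Pi.single j 1) =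
      (M + Mᵀ) i j := by
  rw [qf_add]
  simp [Matrix.mulVec_single]
  ring

lemma qf_single {A : Type*} [CommRing A] [DecidableEq ι] (M : Matrix ι ι A) (i : ι) :
    qf M (Pi.single i 1) = M i i := by
  simp [qf, Matrix.mulVec_single]

lemma qf_eq_zero_of_alternating {A : Type*} [CommRing A] {M : Matrix ι ι A}
    (hd : ∀ i, M i i = 0) (ha : M + Mᵀ = 0) (c : ι → A) : qf M c = 0 := by
  classical
  simp only [qf, dotProduct, Matrix.mulVec, Finset.mul_sum]
  rw [← Finset.sum_product']
  refine Finset.sum_involution (fun p _ => (p.2, p.1)) ?_ ?_ ?_ ?_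
  · rintro ⟨i, j⟩ -
    have := congrFun (congrFun ha i) j
    simp only [Matrix.add_apply, Matrix.transpose_apply, Matrix.zero_apply] at this
    linear_combination c i * c j * this
  · rintro ⟨i, j⟩ - h h'
    obtain rfl : j = i := congrArg Prod.fst h'
    exact h (by simp [hd])
  · simp
  · simp

/-- A quadratic form all of whose values are divisible by `b` is `b` times a quadratic form. -/
lemma exists_qf_eq_mul {A : Type*} [CommRing A] {M : Matrix ι ι A} {b : A}
    (h : ∀ c, b ∣ qf M c) : ∃ N : Matrix ι ι A, ∀ c, qf M c = b * qf N c := by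
  classical
  have := (Fintype.equivFin ι).injective
  let := LinearOrder.lift' (Fintype.equivFin ι) this
  choose d hd using fun i => h (Pi.single i 1)
  have hoff : ∀ i j, b ∣ (M + Mᵀ) i j := fun i j => by
    rw [← polar_single]
    exact dvd_sub (dvd_sub (h _) (h _)) (h _)
  choose e he using hoff
  let N : Matrix ι ι A := Matrix.of fun i j => if i = j then d i else if i < j then e i j else 0
  refine ⟨N, fun c => ?_⟩
  have h0 : qf (M - b • N) c = 0 := by
    refine qf_eq_zero_of_alternating (fun i => ?_) ?_ c
    · simp [N, ← hd, qf_single]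
    · ext i j
      have hij := he i j
      have hji := he j i
      simp only [Matrix.add_apply, Matrix.transpose_apply] at hij hji
      simp only [N, Matrix.add_apply, Matrix.transpose_apply, Matrix.sub_apply, Matrix.smul_apply,
        Matrix.of_apply, smul_eq_mul, Matrix.zero_apply]
      rcases lt_trichotomy i j with hlt | rfl | hlt
      · rw [if_neg hlt.ne, if_pos hlt, if_neg hlt.ne', if_neg hlt.asymm]
        linear_combination hij
      · simp [← hd, qf_single]
      · rw [if_neg hlt.ne', if_pos hlt, if_neg hlt.ne, if_neg hlt.asymm]
        linear_combination hji
  have h1 : qf (M - b • N) c = qf M c - b * qf N c := by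
    simp [qf, Matrix.sub_mulVec, Matrix.smul_mulVec]
  rw [← sub_eq_zero, ← h1, h0]

variable {R : Type*} [CommRing R] [IsDomain R] [IsDiscreteValuationRing R]

lemma exists_dvd_qf_sub_of_hensel [DecidableEq ι] {ϖ : R} (hϖ : Irreducible ϖ) (M : Matrix ι ι R)
    (a : R) {c : ℕ} {x : ι → R} {j : ι} (hx : ϖ ^ (2 * c + 1) ∣ qf M x - a)
    (hj : ¬ ϖ ^ (c + 1) ∣ ((M + Mᵀ) *ᵥ x) j) (k : ℕ) :
    ∃ t : R, ϖ ^ k ∣ qf M (x + Pi.single j (ϖ ^ (c + 1) * t)) - a := by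
  obtain ⟨i, u, hi⟩ := IsDiscreteValuationRing.eq_unit_mul_pow_irreducible
    (x := ((M + Mᵀ) *ᵥ x) j) (by rintro h; exact hj (h ▸ dvd_zero _)) hϖ
  have hic : i ≤ c := by
    by_contra! h
    exact hj (hi ▸ (pow_dvd_pow ϖ h).mul_left _)
  have key : ∀ r : ℕ, ∃ t : R, ϖ ^ (2 * c + 1 + r) ∣
      qf M (x + Pi.single j (ϖ ^ (c + 1) * t)) - a := by
    intro r
    induction r with
    | zero => exact ⟨0, by simpa using hx⟩
    | succ r ih =>
      obtain ⟨t, e, he⟩ := ih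
      rw [qf_add_single, hi] at he
      refine ⟨t - ϖ ^ (c - i + r) * ↑u⁻¹ * e, ?_⟩
      rw [qf_add_single, hi]
      have h1 : ϖ ^ (c + 1) * (ϖ ^ (c - i + r) * ↑u⁻¹ * e) * (↑u * ϖ ^ i) =
          ϖ ^ (2 * c + 1 + r) * e := by
        have : ϖ ^ (2 * c + 1 + r) = ϖ ^ (c + 1) * ϖ ^ (c - i + r) * ϖ ^ i := by
          rw [← pow_add, ← pow_add]; congr 1; lia
        rw [this]
        linear_combination ϖ ^ (c + 1) * ϖ ^ (c - i + r) * ϖ ^ i * e * u.inv_mul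
      set d := ϖ ^ (c - i + r) * ↑u⁻¹ * e with hd
      have h2 : qf M x + ϖ ^ (c + 1) * (t - d) * (↑u * ϖ ^ i) +
          (ϖ ^ (c + 1) * (t - d)) ^ 2 * M j j - a =
          ϖ ^ (2 * (c + 1)) * (d * (d - 2 * t) * M j j) := by
        linear_combination he - h1
      rw [h2, hd]
      have h3 : ϖ ^ (2 * c + 1 + (r + 1)) * ϖ ^ (c - i) = ϖ ^ (2 * (c + 1)) * ϖ ^ (c - i + r) := by
        rw [← pow_add, ← pow_add]; congr 1; lia
      refine ⟨ϖ ^ (c - i) * (↑u⁻¹ * e * (d - 2 * t) * M j j), ?_⟩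
      linear_combination -(↑u⁻¹ * e * (d - 2 * t) * M j j) * h3
  obtain ⟨t, ht⟩ := key k
  exact ⟨t, (pow_dvd_pow ϖ (by lia)).trans ht⟩

open IsLocalRing

/-- Either the reduction of the form has a nonsingular zero, or a suitable zero lifts to second
order. -/
lemma exists_zero_dichotomy [Finite (ResidueField R)] {ϖ : R} (hϖ : Irreducible ϖ)
    (M : Matrix ι ι R) (hι : 5 ≤ Fintype.card ι) :
    ∃ x : ι → R, (∃ i, IsUnit (x i)) ∧ ((ϖ ∣ qf M x ∧ ∃ j, ¬ ϖ ∣ ((M + Mᵀ) *ᵥ x) j) ∨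
      (ϖ ^ 2 ∣ qf M x ∧ ∀ j, ϖ ∣ ((M + Mᵀ) *ᵥ x) j)) := by
  have hres : ∀ r : R, residue R r = 0 ↔ ϖ ∣ r := fun r => by
    rw [residue_eq_zero_iff, hϖ.maximalIdeal_eq, Ideal.mem_span_singleton]
  have hunit : ∀ r : R, residue R r ≠ 0 → IsUnit r := fun r hr => by
    by_contra h
    exact hr (residue_eq_zero_iff _ |>.2 ((mem_maximalIdeal _).2 h))
  set k := ResidueField R
  set Mk := M.map (residue R)
  have hS : ∀ x : ι → R, ∀ j, residue R (((M + Mᵀ) *ᵥ x) j) =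
      ((Mk + Mkᵀ) *ᵥ fun i => residue R (x i)) j := by
    intro x j
    simp [Mk, Matrix.mulVec, dotProduct, map_sum]
  by_cases hsing : ∃ x : ι → k, qf Mk x = 0 ∧ (Mk + Mkᵀ) *ᵥ x ≠ 0
  · obtain ⟨x, hx, hSx⟩ := hsing
    choose y hy using fun i => residue_surjective (x i)
    obtain rfl : (fun i => residue R (y i)) = x := funext hy
    obtain ⟨j, hj⟩ := Function.ne_iff.1 hSx
    have hx0 : (fun i => residue R (y i)) ≠ 0 := by
      intro h
      rw [h, Matrix.mulVec_zero] at hSx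
      exact hSx rfl
    obtain ⟨i, hi⟩ := Function.ne_iff.1 hx0
    refine ⟨y, ⟨i, hunit _ hi⟩, Or.inl ⟨?_, j, ?_⟩⟩
    · rw [← hres, map_qf]
      exact hx
    · rw [← hres, hS]
      exact hj
  · push Not at hsing
    let U : Submodule k (ι → k) :=
      { carrier := {x | qf Mk x = 0}
        zero_mem' := qf_zero _
        add_mem' := by
          intro x y hx hy
          simp only [Set.mem_ofPred_eq] at *
          rw [qf_add, hx, hy, hsing y hy]
          simp
        smul_mem' := by
          intro c x hx
          simp only [Set.mem_ofPred_eq] at *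
          rw [qf_smul, hx, mul_zero] }
    have hU := finrank_le_of_coe_eq_zeros Mk U (fun x => Iff.rfl)
    obtain ⟨f, hf⟩ := exists_linearIndependent_of_le_finrank (R := k) (M := U)
      (Nat.le_of_add_le_add_right (a := 3) (b := 2) (hι.trans hU))
    choose g hg using fun j i => residue_surjective ((f j : ι → k) i)
    let B : Matrix ι (Fin 3) R := Matrix.of fun i j => g j i
    have hBr : ∀ c : Fin 3 → R, (fun i => residue R ((B *ᵥ c) i)) =
        ((∑ j, residue R (c j) • f j : U) : ι → k) := by
      intro c
      ext i
      simp [B, Matrix.mulVec, dotProduct, mul_comm, hg]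
    have hdvd : ∀ c : Fin 3 → R, ϖ ∣ qf M (B *ᵥ c) := by
      intro c
      rw [← hres, map_qf, hBr]
      exact (∑ j, residue R (c j) • f j : U).2
    have hdvdS : ∀ c : Fin 3 → R, ∀ j, ϖ ∣ ((M + Mᵀ) *ᵥ (B *ᵥ c)) j := by
      intro c j
      rw [← hres, hS, hBr]
      exact congrFun (hsing _ (∑ j, residue R (c j) • f j : U).2) j
    have hquad : ∃ N : Matrix (Fin 3) (Fin 3) R, ∀ c, qf M (B *ᵥ c) = ϖ * qf N c := by
      simp only [← qf_mulVec] at hdvd ⊢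
      exact exists_qf_eq_mul hdvd
    obtain ⟨N, hN⟩ := hquad
    obtain ⟨c, hc, hc0⟩ := exists_ne_zero_qf_eq_zero (N.map (residue R)) (by simp)
    choose d hd using fun i => residue_surjective (c i)
    obtain rfl : (fun i => residue R (d i)) = c := funext hd
    have hx0 : (fun i => residue R ((B *ᵥ d) i)) ≠ 0 := by
      rw [hBr]
      intro h
      exact hc (funext (Fintype.linearIndependent_iff.1 hf _ (Subtype.ext h)))
    obtain ⟨i, hi⟩ := Function.ne_iff.1 hx0
    refine ⟨B *ᵥ d, ⟨i, hunit _ hi⟩, Or.inr ⟨?_, hdvdS d⟩⟩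
    rw [hN, pow_two]
    refine mul_dvd_mul_left _ ?_
    rwa [← hres, map_qf]

/-- A nondegenerate quadratic form in at least five variables over a discrete valuation ring with
finite residue field is isotropic modulo every power of the uniformizer. -/
lemma exists_primitive_dvd_qf [Finite (ResidueField R)] {ϖ : R} (hϖ : Irreducible ϖ)
    (hι : 5 ≤ Fintype.card ι) [DecidableEq ι] (k : ℕ) :
    ∀ (v : ℕ) (M : Matrix ι ι R) (u : Rˣ), (M + Mᵀ).det = u * ϖ ^ v →
      ∃ z : ι → R, (∃ i, IsUnit (z i)) ∧ ϖ ^ k ∣ qf M z := by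
  have hnu : ∀ {r : R}, ¬ ϖ ∣ r → IsUnit r := fun {r} hr => by
    by_contra h
    refine hr ?_
    rwa [← mem_nonunits_iff, ← mem_maximalIdeal, hϖ.maximalIdeal_eq,
      Ideal.mem_span_singleton] at h
  intro v
  induction v using Nat.strong_induction_on with
  | _ v ih =>
    intro M u hdet
    obtain ⟨x, ⟨i, hi⟩, ⟨hx, j, hj⟩ | ⟨hx, hSx⟩⟩ := exists_zero_dichotomy hϖ M hι
    · obtain ⟨t, ht⟩ := exists_dvd_qf_sub_of_hensel hϖ M 0 (c := 0) (x := x) (j := j)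
        (by simpa using hx) (by simpa using hj) k
      refine ⟨_, ⟨i, hnu fun hd => hϖ.not_isUnit (isUnit_of_dvd_unit ?_ hi)⟩, by simpa using ht⟩
      rw [Pi.add_apply] at hd
      refine (dvd_add_left ?_).1 hd
      by_cases hij : i = j
      · subst hij; simp
      · simp [hij]
    · let T : Matrix ι ι R := Matrix.of fun a b => if b = i then x a else if a = b then ϖ else 0
      have hT : ∀ c, T *ᵥ c = c i • x + ϖ • (c - Pi.single i (c i)) := by
        intro c
        ext a
        simp only [T, Matrix.mulVec, dotProduct, Matrix.of_apply, Pi.add_apply, Pi.smul_apply,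
          Pi.sub_apply, smul_eq_mul]
        rw [← Finset.add_sum_erase _ _ (Finset.mem_univ i), if_pos rfl, mul_comm]
        congr 1
        rw [Finset.sum_congr rfl (g := fun b => if a = b then ϖ * c b else 0)
          (fun b hb => by rw [if_neg (Finset.ne_of_mem_erase hb)]; split_ifs <;> simp)]
        by_cases hai : a = i
        · subst hai; simp
        · simp [hai]
      have hTdet : T.det = x i * ϖ ^ (Fintype.card ι - 1) := by
        have h1 : T = (ϖ • (1 : Matrix ι ι R)).updateCol i x := by
          ext a b
          by_cases hb : b = i
          · subst hb; simp [T]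
          · simp [T, hb, Matrix.one_apply]
        rw [h1, ← Matrix.cramer_apply, Matrix.cramer_eq_adjugate_mulVec, Matrix.adjugate_smul,
          Matrix.adjugate_one, Matrix.smul_mulVec, Matrix.one_mulVec, Pi.smul_apply, smul_eq_mul,
          mul_comm]
      have hdvd : ∀ c, ϖ ^ 2 ∣ qf (Tᵀ * M * T) c := by
        intro c
        rw [qf_mulVec, hT, qf_add, qf_smul, qf_smul, polar_comm]
        refine dvd_add (dvd_add (hx.mul_left _) (dvd_mul_right _ _)) ?_
        rw [smul_dotProduct, Matrix.mulVec_smul, dotProduct_smul, smul_eq_mul, smul_eq_mul, pow_two]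
        refine mul_dvd_mul_left _ (Dvd.dvd.mul_left (Finset.dvd_sum fun j _ => ?_) _)
        exact (hSx j).mul_left _
      obtain ⟨N, hN⟩ := exists_qf_eq_mul hdvd
      have hNS : Tᵀ * (M + Mᵀ) * T = ϖ ^ 2 • (N + Nᵀ) := by
        have h1 : Tᵀ * (M + Mᵀ) * T = Tᵀ * M * T + (Tᵀ * M * T)ᵀ := by
          simp [Matrix.mul_add, Matrix.add_mul, Matrix.mul_assoc]
        rw [h1]
        ext a b
        rw [← polar_single, hN, hN, hN, Matrix.smul_apply, ← polar_single, smul_eq_mul]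
        ring
      have hdet' : (x i) ^ 2 * (M + Mᵀ).det = ϖ ^ 2 * (N + Nᵀ).det := by
        have h1 := congrArg Matrix.det hNS
        rw [Matrix.det_mul, Matrix.det_mul, Matrix.det_transpose, Matrix.det_smul, hTdet] at h1
        have h2 : (ϖ ^ 2) ^ Fintype.card ι = ϖ ^ 2 * (ϖ ^ (Fintype.card ι - 1)) ^ 2 := by
          rw [← pow_mul, ← pow_mul, ← pow_add]; congr 1; lia
        rw [h2] at h1
        refine mul_right_cancel₀ (pow_ne_zero 2 (pow_ne_zero (Fintype.card ι - 1) hϖ.ne_zero)) ?_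
        linear_combination h1
      obtain ⟨w, hw⟩ := hi
      have hv : 2 ≤ v := by
        by_contra! hv
        rw [hdet, ← hw] at hdet'
        have : ϖ ^ 2 ∣ ϖ ^ v := by
          refine (Units.dvd_mul_left (u := w ^ 2 * u)).1 ?_
          exact ⟨_, by push_cast; rw [← hdet']; ring⟩
        exact absurd ((pow_dvd_pow_iff hϖ.ne_zero hϖ.not_isUnit).1 this) (by lia)
      obtain ⟨z, ⟨l, hl⟩, hz⟩ := ih (v - 2) (by lia) N (w ^ 2 * u) (by
        refine mul_left_cancel₀ (pow_ne_zero 2 hϖ.ne_zero) ?_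
        rw [← hdet', hdet, ← hw]
        push_cast
        rw [show ϖ ^ v = ϖ ^ 2 * ϖ ^ (v - 2) by rw [← pow_add]; congr 1; lia]
        ring)
      have hq : qf M (T *ᵥ z) = ϖ ^ 2 * qf N z := by rw [← qf_mulVec, hN]
      by_cases hzi : ϖ ∣ z i
      · obtain ⟨b, hb⟩ := hzi
        have hTz : T *ᵥ z = ϖ • (b • x + (z - Pi.single i (z i))) := by
          rw [hT, hb, smul_add, smul_smul]
        refine ⟨b • x + (z - Pi.single i (z i)), ?_, ?_⟩
        · by_contra! hn
          have hn' : ∀ a, ϖ ∣ b * x a + (z a - (Pi.single i (z i) : ι → R) a) := fun a => by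
            by_contra h
            exact hn a (by simpa using hnu h)
          have hbd : ϖ ∣ b := by
            have := hn' i
            rw [Pi.single_eq_same, sub_self, add_zero, ← hw] at this
            exact (Units.dvd_mul_right).1 this
          have hli : l ≠ i := by
            rintro rfl
            exact hϖ.not_isUnit (isUnit_of_dvd_unit ⟨b, hb⟩ hl)
          have := hn' l
          rw [Pi.single_eq_of_ne hli, sub_zero, dvd_add_right (hbd.mul_right _)] at this
          exact hϖ.not_isUnit (isUnit_of_dvd_unit this hl)
        · rw [hTz, qf_smul] at hq
          rwa [mul_left_cancel₀ (pow_ne_zero 2 hϖ.ne_zero) hq]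
      · refine ⟨T *ᵥ z, ⟨i, hnu fun hd => hzi ?_⟩, hq ▸ hz.mul_left _⟩
        rw [hT, Pi.add_apply, Pi.smul_apply, Pi.smul_apply, smul_eq_mul, smul_eq_mul,
          dvd_add_left (dvd_mul_right _ _), ← hw] at hd
        exact (Units.dvd_mul_right).1 hd

end Isotropy

section FiniteField

variable {ι F : Type*} [Fintype ι] [DecidableEq ι] [Field F] [Fintype F] [DecidableEq F]

lemma card_dotProduct_eq {v : ι → F} (hv : v ≠ 0) (c : F) :
    Fintype.card F * (Finset.univ.filter fun x : ι → F => x ⬝ᵥ v = c).card =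
      Fintype.card F ^ Fintype.card ι := by
  obtain ⟨i, hi⟩ := Function.ne_iff.1 hv
  let φ : (ι → F) →+ F :=
    { toFun := fun x => x ⬝ᵥ v
      map_zero' := zero_dotProduct v
      map_add' := fun x y => add_dotProduct x y v }
  have hsurj : ∀ b, b ∈ Set.range φ := fun b =>
    ⟨Pi.single i (b / v i), by simpa [φ] using div_mul_cancel₀ b hi⟩
  have h := Finset.card_eq_sum_card_fiberwise (s := Finset.univ) (t := Finset.univ) (f := φ)
    (by simp)
  rw [Finset.sum_congr rfl fun b _ => AddMonoidHom.card_fiber_eq_of_mem_range φ (hsurj b) (hsurj c),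
    Finset.sum_const, smul_eq_mul] at h
  simpa [φ] using h.symm

/-- The second moment of the representation numbers of a nondegenerate form. -/
lemma sum_card_qf_eq_sq {M : Matrix ι ι F} (hM : (M + Mᵀ).det ≠ 0) :
    Fintype.card F * ∑ a, (Finset.univ.filter fun x : ι → F => qf M x = a).card ^ 2 =
      Fintype.card F * Fintype.card F ^ Fintype.card ι +
        (Fintype.card F ^ Fintype.card ι - 1) * Fintype.card F ^ Fintype.card ι := by
  have h1 : ∑ a, (Finset.univ.filter fun x : ι → F => qf M x = a).card ^ 2 =
      ∑ h : ι → F, (Finset.univ.filter fun x : ι → F => qf M (x + h) = qf M x).card := by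
    have h2 : ∀ a, (Finset.univ.filter fun x : ι → F => qf M x = a).card ^ 2 =
        ∑ x : ι → F, ∑ y : ι → F, if qf M x = a ∧ qf M y = a then 1 else 0 := by
      intro a
      simp only [pow_two, Finset.card_filter, Finset.sum_mul_sum]
      refine Finset.sum_congr rfl fun x _ => Finset.sum_congr rfl fun y _ => ?_
      by_cases h1 : qf M x = a <;> by_cases h2 : qf M y = a <;> simp [h1, h2]
    simp_rw [h2, Finset.card_filter]
    rw [Finset.sum_comm]
    conv_rhs => rw [Finset.sum_comm]
    refine Finset.sum_congr rfl fun x _ => ?_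
    rw [Finset.sum_comm]
    refine (Equiv.sum_comp (Equiv.addLeft x) _).symm.trans ?_
    refine Finset.sum_congr rfl fun h _ => ?_
    rw [Finset.sum_eq_single (qf M x)]
    · simp
    · intro b _ hb
      rw [if_neg fun h' => hb h'.1.symm]
    · simp
  rw [h1, ← Finset.add_sum_erase _ _ (Finset.mem_univ 0), mul_add, Finset.mul_sum]
  congr 1
  · simp
  · rw [Finset.sum_congr rfl (g := fun _ => Fintype.card F ^ Fintype.card ι), Finset.sum_const,
      Finset.card_erase_of_mem (Finset.mem_univ _)]
    · simp
    · intro h hh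
      have hne : (M + Mᵀ) *ᵥ h ≠ 0 := fun h0 =>
        Finset.ne_of_mem_erase hh (Matrix.eq_zero_of_mulVec_eq_zero hM h0)
      rw [← card_dotProduct_eq hne (-qf M h)]
      congr 3
      ext x
      rw [qf_add]
      constructor <;> intro h <;> linear_combination h

lemma sq_card_qf_eq_sub_le {M : Matrix ι ι F} (hM : (M + Mᵀ).det ≠ 0) [Nonempty ι] (a : F) :
    (((Finset.univ.filter fun x : ι → F => qf M x = a).card : ℝ) -
      (Fintype.card F : ℝ) ^ (Fintype.card ι - 1)) ^ 2 ≤ (Fintype.card F : ℝ) ^ Fintype.card ι := by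
  set N : F → ℝ := fun a => ((Finset.univ.filter fun x : ι → F => qf M x = a).card : ℝ) with hN
  set q : ℝ := (Fintype.card F : ℝ) with hq
  have hq1 : 1 ≤ q := by
    rw [hq]
    exact_mod_cast Nat.one_le_iff_ne_zero.2 (Fintype.card_ne_zero (α := F))
  obtain ⟨m, hm⟩ : ∃ m, Fintype.card ι = m + 1 :=
    ⟨_, (Nat.succ_pred_eq_of_pos Fintype.card_pos).symm⟩
  have h1 : ∑ b, N b = q ^ (m + 1) := by
    have h := Finset.card_eq_sum_card_fiberwise (s := Finset.univ) (t := Finset.univ)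
      (f := fun x : ι → F => qf M x) (by simp)
    simp only [hN]
    rw [← Nat.cast_sum, ← h, ← hm]
    simp [hq]
  have h2 : q * ∑ b, N b ^ 2 = q * q ^ (m + 1) + (q ^ (m + 1) - 1) * q ^ (m + 1) := by
    have h := congrArg (Nat.cast (R := ℝ)) (sum_card_qf_eq_sq hM)
    rw [hm] at h
    push_cast [Nat.cast_sub (Nat.one_le_pow (m + 1) (Fintype.card F) Fintype.card_pos)] at h
    simpa [hN] using h
  have h3 : ∑ b, (N b - q ^ m) ^ 2 = q ^ (m + 1) - q ^ m := by
    have h4 : ∑ b, (N b - q ^ m) ^ 2 =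
        ∑ b, N b ^ 2 - 2 * q ^ m * ∑ b, N b + q * (q ^ m) ^ 2 := by
      simp only [sub_sq, Finset.sum_add_distrib, Finset.sum_sub_distrib, Finset.sum_const,
        Finset.card_univ, nsmul_eq_mul, ← hq, Finset.mul_sum]
      congr 2
      exact Finset.sum_congr rfl fun b _ => by ring
    have h5 : ∑ b, N b ^ 2 = q ^ (m + 1) + (q ^ (m + 1) - 1) * q ^ m := by
      refine mul_left_cancel₀ (show q ≠ 0 by positivity) ?_
      rw [h2]; ring
    rw [h4, h5, h1]; ring
  rw [hm, Nat.add_sub_cancel]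
  have h4 := Finset.single_le_sum (f := fun b => (N b - q ^ m) ^ 2) (fun b _ => sq_nonneg _)
    (Finset.mem_univ a)
  have h5 : 0 ≤ q ^ m := by positivity
  linarith

lemma le_card_qf_eq_ne_zero {M : Matrix ι ι F} (hM : (M + Mᵀ).det ≠ 0) (hι : 5 ≤ Fintype.card ι)
    (a : F) : (Fintype.card F : ℝ) ^ (Fintype.card ι - 1) * (1 - 2 / √(Fintype.card F) ^ 3) ≤
      (Finset.univ.filter fun x : ι → F => qf M x = a ∧ x ≠ 0).card := by
  have : Nonempty ι := Fintype.card_pos_iff.1 (by lia)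
  obtain ⟨m, hm⟩ : ∃ m, Fintype.card ι = m + 5 := ⟨_, (Nat.sub_add_cancel hι).symm⟩
  have h1 := sq_card_qf_eq_sub_le hM a
  have hq1 : (1 : ℝ) ≤ Fintype.card F := by
    exact_mod_cast Nat.one_le_iff_ne_zero.2 (Fintype.card_ne_zero (α := F))
  set s : ℝ := √(Fintype.card F) with hs
  have hs2 : s ^ 2 = Fintype.card F := Real.sq_sqrt (by positivity)
  have hs1 : 1 ≤ s := Real.one_le_sqrt.2 hq1
  have h2 : ((Finset.univ.filter fun x : ι → F => qf M x = a).card : ℝ) ≤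
      (Finset.univ.filter fun x : ι → F => qf M x = a ∧ x ≠ 0).card + 1 := by
    have h := Finset.pred_card_le_card_erase (a := (0 : ι → F))
      (s := Finset.univ.filter fun x : ι → F => qf M x = a)
    have h' : (Finset.univ.filter fun x : ι → F => qf M x = a).erase 0 =
        Finset.univ.filter fun x : ι → F => qf M x = a ∧ x ≠ 0 := by
      ext x; simp [and_comm]
    rw [h'] at h
    exact_mod_cast Nat.sub_le_iff_le_add.1 h
  rw [← hs2, hm] at h1 ⊢
  have h3 := abs_le_of_sq_le_sq' (h1.trans_eq (pow_right_comm s 2 (m + 5))) (by positivity)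
  have h4 : (s ^ 2) ^ (m + 5 - 1) * (1 - 2 / s ^ 3) =
      (s ^ 2) ^ (m + 5 - 1) - 2 * s ^ (m + 5) * s ^ m := by
    have : (s ^ 2) ^ (m + 5 - 1) = s ^ (m + 5) * s ^ m * s ^ 3 := by
      rw [← pow_mul, ← pow_add, ← pow_add]; congr 1; lia
    rw [this]
    field_simp
  have h5 : 1 ≤ s ^ (m + 5) := one_le_pow₀ hs1
  have h6 : 1 ≤ s ^ m := one_le_pow₀ hs1
  rw [h4]
  nlinarith [h3.1]

end FiniteField

section LocalCount

variable {ι A : Type*} [Fintype ι] [CommRing A]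

/-- The number of solutions of `qf C x = a` modulo the ideal `I`. -/
noncomputable def solCount (C : Matrix ι ι A) (I : Ideal A) (a : A) : ℕ :=
  Nat.card {x : ι → A ⧸ I // qf (C.map (Ideal.Quotient.mk I)) x = Ideal.Quotient.mk I a}

open IsLocalRing

variable {R : Type*} [CommRing R] [IsDomain R] [IsDiscreteValuationRing R]

lemma mem_maximalIdeal_pow_iff {ϖ : R} (hϖ : Irreducible ϖ) {k : ℕ} {x : R} :
    x ∈ maximalIdeal R ^ k ↔ ϖ ^ k ∣ x := by
  rw [hϖ.maximalIdeal_eq, Ideal.span_singleton_pow, Ideal.mem_span_singleton]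

lemma mk_eq_mk_iff_dvd {ϖ : R} (hϖ : Irreducible ϖ) {k : ℕ} {x y : R} :
    Ideal.Quotient.mk (maximalIdeal R ^ k) x = Ideal.Quotient.mk (maximalIdeal R ^ k) y ↔
      ϖ ^ k ∣ x - y := by
  rw [Ideal.Quotient.eq, mem_maximalIdeal_pow_iff hϖ]

lemma exists_injective_of_hensel [DecidableEq ι] {ϖ : R} (hϖ : Irreducible ϖ) (M : Matrix ι ι R)
    (a : R) {c : ℕ} {x : ι → R} {j : ι} (hx : ϖ ^ (2 * c + 1) ∣ qf M x - a)
    (hj : ¬ ϖ ^ (c + 1) ∣ ((M + Mᵀ) *ᵥ x) j) (r : ℕ) :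
    ∃ f : ({i // i ≠ j} → R ⧸ maximalIdeal R ^ r) → ι → R ⧸ maximalIdeal R ^ (2 * c + 1 + r),
      f.Injective ∧ ∀ y,
        qf (M.map (Ideal.Quotient.mk (maximalIdeal R ^ (2 * c + 1 + r)))) (f y) =
          Ideal.Quotient.mk _ a ∧
        ∀ i, ∃ s, f y i = Ideal.Quotient.mk _ (x i + ϖ ^ (c + 1) * s) := by
  classical
  let w : ({i // i ≠ j} → R ⧸ maximalIdeal R ^ r) → ι → R :=
    fun y i => if h : i ≠ j then (y ⟨i, h⟩).out else 0
  have key : ∀ y : {i // i ≠ j} → R ⧸ maximalIdeal R ^ r, ∃ t : R,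
      ϖ ^ (2 * c + 1 + r) ∣ qf M (x + ϖ ^ (2 * c + 1) • w y +
        Pi.single j (ϖ ^ (c + 1) * t)) - a := by
    intro y
    have hmem : ∀ i, (x + ϖ ^ (2 * c + 1) • w y) i - x i ∈ Ideal.span {ϖ ^ (2 * c + 1)} := by
      intro i
      rw [Ideal.mem_span_singleton, Pi.add_apply, add_sub_cancel_left]
      exact dvd_mul_right _ _
    refine exists_dvd_qf_sub_of_hensel hϖ M a (c := c) ?_ ?_ _
    · have h1 := qf_sub_mem M hmem
      rw [Ideal.mem_span_singleton] at h1
      have := dvd_add h1 hx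
      rwa [sub_add_sub_cancel] at this
    · have h1 := mulVec_sub_mem (M + Mᵀ) hmem j
      rw [Ideal.mem_span_singleton] at h1
      intro h2
      refine hj ((dvd_sub_right h2).1 (dvd_trans (pow_dvd_pow ϖ (by lia)) h1))
  choose t ht using key
  refine ⟨fun y i => Ideal.Quotient.mk _ ((x + ϖ ^ (2 * c + 1) • w y +
    (Pi.single j (ϖ ^ (c + 1) * t y) : ι → R)) i), ?_, fun y => ⟨?_, fun i => ?_⟩⟩
  · intro y y' h
    ext ⟨i, hi⟩
    have h1 := congrFun h i
    simp only [Pi.add_apply, Pi.smul_apply, smul_eq_mul, Pi.single_eq_of_ne hi, add_zero] at h1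
    rw [mk_eq_mk_iff_dvd hϖ, add_sub_add_left_eq_sub, ← mul_sub, pow_add,
      mul_dvd_mul_iff_left (pow_ne_zero _ hϖ.ne_zero), ← mk_eq_mk_iff_dvd hϖ] at h1
    simpa [w, hi] using h1
  · rw [← map_qf, mk_eq_mk_iff_dvd hϖ]
    exact ht y
  · refine ⟨ϖ ^ c * w y i + (Pi.single j (t y) : ι → R) i, ?_⟩
    simp only [Pi.add_apply, Pi.smul_apply, smul_eq_mul]
    have : (Pi.single j (ϖ ^ (c + 1) * t y) : ι → R) i =
        ϖ ^ (c + 1) * (Pi.single j (t y) : ι → R) i := by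
      by_cases h : i = j
      · subst h; simp
      · simp [h]
    rw [this]
    congr 1
    ring

lemma card_quotient_maximalIdeal_pow (k : ℕ) :
    Nat.card (R ⧸ maximalIdeal R ^ k) = Nat.card (ResidueField R) ^ k :=
  cardQuot_pow_of_prime (IsDiscreteValuationRing.not_a_field R)

variable [Finite (ResidueField R)]

instance finite_quotient_maximalIdeal_pow (k : ℕ) : Finite (R ⧸ maximalIdeal R ^ k) :=
  Nat.finite_of_card_ne_zero (by
    rw [card_quotient_maximalIdeal_pow]; exact pow_ne_zero _ Nat.card_pos.ne')

lemma card_pow_le_solCount_of_hensel [DecidableEq ι] {ϖ : R} (hϖ : Irreducible ϖ)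
    (M : Matrix ι ι R) (a : R) {c : ℕ} {x : ι → R} {j : ι} (hx : ϖ ^ (2 * c + 1) ∣ qf M x - a)
    (hj : ¬ ϖ ^ (c + 1) ∣ ((M + Mᵀ) *ᵥ x) j) (r : ℕ) :
    (Nat.card (ResidueField R) ^ r) ^ (Fintype.card ι - 1) ≤
      solCount M (maximalIdeal R ^ (2 * c + 1 + r)) a := by
  obtain ⟨f, hf, hf'⟩ := exists_injective_of_hensel hϖ M a hx hj r
  have h := Nat.card_le_card_of_injective
    (fun y => (⟨f y, (hf' y).1⟩ : {x : ι → R ⧸ maximalIdeal R ^ (2 * c + 1 + r) //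
      qf (M.map (Ideal.Quotient.mk _)) x = Ideal.Quotient.mk _ a}))
    (fun y y' h => hf (congrArg Subtype.val h))
  have hc : Nat.card {i // i ≠ j} = Fintype.card ι - 1 := by
    rw [Nat.card_eq_fintype_card, Fintype.card_subtype_compl, Fintype.card_subtype_eq]
  rwa [Nat.card_fun, card_quotient_maximalIdeal_pow, hc] at h

/-- A uniform lower bound for the number of solutions modulo powers of the maximal ideal of a
locally solvable equation. -/
lemma card_pow_le_mul_solCount [DecidableEq ι] {ϖ : R} (hϖ : Irreducible ϖ)
    (hι : 5 ≤ Fintype.card ι) {M : Matrix ι ι R} {v : ℕ} {u : Rˣ}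
    (hdet : (M + Mᵀ).det = u * ϖ ^ v) {a : R}
    (ha : ∃ x, ϖ ^ (4 * v + 2) ∣ qf M x - a) (k : ℕ) (hk : ∃ x, ϖ ^ k ∣ qf M x - a) :
    (Nat.card (ResidueField R) ^ k) ^ (Fintype.card ι - 1) ≤
      (Nat.card (ResidueField R) ^ (4 * v + 1)) ^ (Fintype.card ι - 1) *
        solCount M (maximalIdeal R ^ k) a := by
  set q := Nat.card (ResidueField R)
  have hq : 0 < q := Nat.card_pos
  have hadj : ∀ (x : ι → R) (i : ι) (s : ℕ), (∀ j, ϖ ^ (s + v) ∣ ((M + Mᵀ) *ᵥ x) j) →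
      ϖ ^ s ∣ x i := by
    intro x i s h
    have h1 : (M + Mᵀ).adjugate *ᵥ ((M + Mᵀ) *ᵥ x) = (u * ϖ ^ v) • x := by
      rw [Matrix.mulVec_mulVec, Matrix.adjugate_mul, Matrix.smul_mulVec, Matrix.one_mulVec, hdet]
    have h2 : ϖ ^ (s + v) ∣ u * ϖ ^ v * x i := by
      rw [← smul_eq_mul (a := (u : R) * ϖ ^ v), ← Pi.smul_apply, ← h1]
      exact Finset.dvd_sum fun j _ => (h j).mul_left _
    rw [mul_assoc, Units.dvd_mul_left, add_comm, pow_add] at h2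
    exact (mul_dvd_mul_iff_left (pow_ne_zero _ hϖ.ne_zero)).1 h2
  by_cases hkv : k < 4 * v + 1
  · obtain ⟨x, hx⟩ := hk
    have h1 : 0 < solCount M (maximalIdeal R ^ k) a := by
      refine Nat.card_pos_iff.2 ⟨⟨fun i => Ideal.Quotient.mk _ (x i), ?_⟩, inferInstance⟩
      rw [← map_qf, mk_eq_mk_iff_dvd hϖ]
      exact hx
    exact (Nat.pow_le_pow_left (Nat.pow_le_pow_right hq hkv.le) _).trans
      (Nat.le_mul_of_pos_right _ h1)
  have main : ∀ (c : ℕ), c ≤ 2 * v → ∀ (x : ι → R) (j : ι), ϖ ^ (2 * c + 1) ∣ qf M x - a →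
      ¬ ϖ ^ (c + 1) ∣ ((M + Mᵀ) *ᵥ x) j →
      (q ^ k) ^ (Fintype.card ι - 1) ≤
      (q ^ (4 * v + 1)) ^ (Fintype.card ι - 1) * solCount M (maximalIdeal R ^ k) a := by
    intro c hc x j hx hj
    obtain ⟨r, rfl⟩ : ∃ r, k = 2 * c + 1 + r := ⟨k - (2 * c + 1), by lia⟩
    refine le_trans ?_ (Nat.mul_le_mul_left _ (card_pow_le_solCount_of_hensel hϖ M a hx hj r))
    rw [← mul_pow, ← pow_add]
    exact Nat.pow_le_pow_left (Nat.pow_le_pow_right hq (by lia)) _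
  obtain ⟨x, hx⟩ := ha
  by_cases hdiv : ∀ i, ϖ ^ (v + 1) ∣ x i
  · obtain ⟨z, ⟨i, hi⟩, hz⟩ := exists_primitive_dvd_qf hϖ hι (2 * v + 1) v M u hdet
    have hj : ∃ j, ¬ ϖ ^ (v + 1) ∣ ((M + Mᵀ) *ᵥ z) j := by
      by_contra! h
      have := hadj z i 1 (by simpa only [add_comm] using h)
      rw [pow_one] at this
      exact hϖ.not_isUnit (isUnit_of_dvd_unit this hi)
    obtain ⟨j, hj⟩ := hj
    refine main v (by lia) z j (dvd_sub hz ?_) hj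
    have h1 : ϖ ^ (2 * v + 1) ∣ qf M x := by
      choose y hy using hdiv
      have : x = ϖ ^ (v + 1) • y := funext hy
      rw [this, qf_smul, ← pow_mul]
      exact (pow_dvd_pow ϖ (by lia)).mul_right _
    have h2 := dvd_sub h1 ((pow_dvd_pow ϖ (show 2 * v + 1 ≤ 4 * v + 2 by lia)).trans hx)
    rwa [sub_sub_cancel] at h2
  · push Not at hdiv
    obtain ⟨i, hi⟩ := hdiv
    have hj : ∃ j, ¬ ϖ ^ (2 * v + 1) ∣ ((M + Mᵀ) *ᵥ x) j := by
      by_contra! h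
      refine hi (hadj x i (v + 1) fun j => ?_)
      rw [show v + 1 + v = 2 * v + 1 by lia]
      exact h j
    obtain ⟨j, hj⟩ := hj
    exact main (2 * v) le_rfl x j ((pow_dvd_pow ϖ (by lia)).trans hx) hj

end LocalCount

section GoodLocalCount

open IsLocalRing

variable {ι R : Type*} [Fintype ι] [CommRing R] [IsDomain R] [IsDiscreteValuationRing R]
  [Finite (ResidueField R)]

/-- At a place of good reduction the number of solutions is close to the expected one. -/
lemma le_solCount_of_isUnit_det [DecidableEq ι] (hι : 5 ≤ Fintype.card ι) {M : Matrix ι ι R}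
    (hdet : IsUnit (M + Mᵀ).det) (a : R) (k : ℕ) :
    ((Nat.card (ResidueField R) : ℝ) ^ k) ^ (Fintype.card ι - 1) *
      (1 - 2 / √(Nat.card (ResidueField R)) ^ 3) ≤ solCount M (maximalIdeal R ^ k) a := by
  classical
  obtain ⟨ϖ, hϖ⟩ := IsDiscreteValuationRing.exists_irreducible R
  rcases Nat.eq_zero_or_pos k with rfl | hk
  · have h1 : 0 < solCount M (maximalIdeal R ^ 0) a := by
      refine Nat.card_pos_iff.2 ⟨⟨fun i => 0, ?_⟩, inferInstance⟩
      have : Subsingleton (R ⧸ maximalIdeal R ^ 0) :=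
        Ideal.Quotient.subsingleton_iff.2 (by rw [pow_zero, Ideal.one_eq_top])
      exact Subsingleton.elim _ _
    have h2 : (1 : ℝ) ≤ solCount M (maximalIdeal R ^ 0) a := by exact_mod_cast h1
    refine le_trans ?_ h2
    rw [pow_zero, one_pow, one_mul, sub_le_self_iff]
    positivity
  obtain ⟨r, rfl⟩ : ∃ r, k = 2 * 0 + 1 + r := ⟨k - 1, by lia⟩
  have := Fintype.ofFinite (ResidueField R)
  let Mk := M.map (residue R)
  have hMk : (Mk + Mkᵀ).det ≠ 0 := by
    have h1 : Mk + Mkᵀ = (M + Mᵀ).map (residue R) := by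
      ext i j; simp [Mk]
    rw [h1, ← RingHom.mapMatrix_apply, ← RingHom.map_det]
    exact (hdet.map (residue R)).ne_zero
  have hres : ∀ r : R, residue R r = 0 ↔ ϖ ∣ r := fun r => by
    rw [residue_eq_zero_iff, hϖ.maximalIdeal_eq, Ideal.mem_span_singleton]
  have hcount := le_card_qf_eq_ne_zero hMk hι (residue R a)
  set T := Finset.univ.filter fun x : ι → ResidueField R => qf Mk x = residue R a ∧ x ≠ 0
  have hsol : ∀ s : T, ∃ x : ι → R, (∀ i, residue R (x i) = s.1 i) ∧ ∃ j,
      ϖ ^ (2 * 0 + 1) ∣ qf M x - a ∧ ¬ ϖ ^ (0 + 1) ∣ ((M + Mᵀ) *ᵥ x) j := by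
    rintro ⟨s, hs⟩
    obtain ⟨hs, hs0⟩ := (Finset.mem_filter.1 hs).2
    choose x hx using fun i => residue_surjective (s i)
    obtain rfl : (fun i => residue R (x i)) = s := funext hx
    have hne : (Mk + Mkᵀ) *ᵥ (fun i => residue R (x i)) ≠ 0 := fun h0 =>
        hs0 (Matrix.eq_zero_of_mulVec_eq_zero hMk h0)
    obtain ⟨j, hj⟩ := Function.ne_iff.1 hne
    refine ⟨x, hx, j, ?_, ?_⟩
    · rw [mul_zero, zero_add, pow_one, ← hres, map_sub, map_qf, sub_eq_zero]
      exact hs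
    · rw [zero_add, pow_one, ← hres]
      convert hj using 1
      simp [Mk, Matrix.mulVec, dotProduct, map_sum]
  choose x hx j hxa hxj using hsol
  choose f hf hf' using fun s => exists_injective_of_hensel hϖ M a (hxa s) (hxj s) r
  have h := Nat.card_le_card_of_injective
    (fun y : (s : T) × ({i // i ≠ j s} → R ⧸ maximalIdeal R ^ r) =>
      (⟨f y.1 y.2, (hf' y.1 y.2).1⟩ : {x : ι → R ⧸ maximalIdeal R ^ (2 * 0 + 1 + r) //
      qf (M.map (Ideal.Quotient.mk _)) x = Ideal.Quotient.mk _ a}))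
    (by
      rintro ⟨s, y⟩ ⟨s', y'⟩ h
      replace h : f s y = f s' y' := congrArg Subtype.val h
      have hs : s = s' := by
        refine Subtype.ext (funext fun i => ?_)
        obtain ⟨b, hb⟩ := (hf' s y).2 i
        obtain ⟨b', hb'⟩ := (hf' s' y').2 i
        rw [← hx, ← hx, ← sub_eq_zero, ← map_sub, hres]
        rw [h, hb', mk_eq_mk_iff_dvd hϖ] at hb
        have h1 := (pow_dvd_pow ϖ (show 1 ≤ 2 * 0 + 1 + r by lia)).trans hb
        simp only [zero_add, pow_one] at h1
        rw [← dvd_neg, neg_sub]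
        have h2 : x s' i - x s i = x s' i + ϖ * b' - (x s i + ϖ * b) - ϖ * (b' - b) := by ring
        rw [h2]
        exact dvd_sub h1 (dvd_mul_right _ _)
      subst hs
      rw [hf s h])
  have hc : ∀ j : ι, Nat.card {i // i ≠ j} = Fintype.card ι - 1 := fun j => by
    rw [Nat.card_eq_fintype_card, Fintype.card_subtype_compl, Fintype.card_subtype_eq]
  have hc' : ∀ s : T, Nat.card ({i // i ≠ j s} → R ⧸ maximalIdeal R ^ r) =
      (Nat.card (ResidueField R) ^ r) ^ (Fintype.card ι - 1) := fun s => by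
    rw [Nat.card_fun, card_quotient_maximalIdeal_pow, hc]
  rw [Nat.card_sigma, Finset.sum_congr rfl fun s _ => hc' s, Finset.sum_const, Finset.card_univ,
    Fintype.card_coe, smul_eq_mul] at h
  have h' : (T.card : ℝ) * ((Nat.card (ResidueField R) : ℝ) ^ r) ^ (Fintype.card ι - 1) ≤
      solCount M (maximalIdeal R ^ (2 * 0 + 1 + r)) a := by exact_mod_cast h
  refine le_trans ?_ h'
  rw [Nat.card_eq_fintype_card] at *
  refine le_trans (le_of_eq ?_) (mul_le_mul_of_nonneg_right hcount (by positivity))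
  rw [mul_zero, zero_add, pow_add, pow_one, mul_pow]
  ring

end GoodLocalCount

section PrimeSum

open IsDedekindDomain NumberField

variable {K : Type*} [Field K] [NumberField K]

lemma exists_prime_mem_le_absNorm (v : HeightOneSpectrum (𝓞 K)) :
    ∃ ℓ : ℕ, ℓ.Prime ∧ (ℓ : 𝓞 K) ∈ v.asIdeal ∧ ℓ ≤ Ideal.absNorm v.asIdeal := by
  have hne : Ideal.absNorm v.asIdeal ≠ 0 := Ideal.absNorm_eq_zero_iff.not.2 v.ne_bot
  have h1 := Ideal.absNorm_mem v.asIdeal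
  rw [← Nat.prod_primeFactorsList hne, Nat.cast_list_prod, ← Multiset.prod_coe,
    v.isPrime.multiset_prod_mem_iff_exists_mem] at h1
  obtain ⟨x, hx, hxv⟩ := h1
  obtain ⟨ℓ, hℓ, rfl⟩ := List.mem_map.1 hx
  exact ⟨ℓ, Nat.prime_of_mem_primeFactorsList hℓ, hxv,
    Nat.le_of_dvd (Nat.pos_of_ne_zero hne) (Nat.dvd_of_mem_primeFactorsList hℓ)⟩

lemma card_le_finrank_of_prime_mem {ℓ : ℕ} (hℓ : ℓ.Prime) (u : Finset (HeightOneSpectrum (𝓞 K)))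
    (hu : ∀ v ∈ u, (ℓ : 𝓞 K) ∈ v.asIdeal ∧ ℓ ≤ Ideal.absNorm v.asIdeal) :
    u.card ≤ Module.finrank ℚ K := by
  have h1 : ∏ v ∈ u, v.asIdeal ∣ Ideal.span {(ℓ : 𝓞 K)} := by
    refine Finset.prod_dvd_of_coprime ?_ ?_
    · intro v _ w _ hvw
      refine Ideal.isCoprime_iff_sup_eq.2 ?_
      refine (v.isMaximal.coprime_of_ne w.isMaximal fun h => hvw (HeightOneSpectrum.ext h))
    · intro v hv
      rw [Ideal.dvd_span_singleton]
      exact (hu v hv).1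
  have h2 := map_dvd Ideal.absNorm h1
  rw [map_prod, Ideal.absNorm_span_natCast, RingOfIntegers.rank] at h2
  have h4 : ℓ ^ u.card ≤ ∏ v ∈ u, Ideal.absNorm v.asIdeal :=
    Finset.pow_card_le_prod _ _ _ fun v hv => (hu v hv).2
  exact (Nat.pow_le_pow_iff_right hℓ.one_lt).1
    (h4.trans (Nat.le_of_dvd (pow_pos hℓ.pos _) h2))

lemma summable_absNorm : Summable fun v : HeightOneSpectrum (𝓞 K) =>
    2 / √(Ideal.absNorm v.asIdeal) ^ 3 := by
  classical
  choose ℓ hℓ hmem hle using exists_prime_mem_le_absNorm (K := K)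
  have hs : Summable fun m : ℕ => 2 / √m ^ 3 := by
    have := (Real.summable_one_div_nat_rpow (p := 3 / 2)).2 (by norm_num)
    refine (this.mul_left 2).congr fun m => ?_
    rw [Real.sqrt_eq_rpow, ← Real.rpow_natCast, ← Real.rpow_mul (by positivity), mul_one_div]
    norm_num
  refine summable_of_sum_le (c := Module.finrank ℚ K * ∑' m : ℕ, 2 / √m ^ 3)
    (fun v => by positivity) fun u => ?_
  calc ∑ v ∈ u, 2 / √(Ideal.absNorm v.asIdeal) ^ 3 ≤ ∑ v ∈ u, 2 / √(ℓ v) ^ 3 := by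
        refine Finset.sum_le_sum fun v _ => ?_
        have := hle v
        have h0 := (hℓ v).pos
        gcongr
    _ = ∑ m ∈ u.image ℓ, ∑ v ∈ u with ℓ v = m, 2 / √(ℓ v) ^ 3 :=
        (Finset.sum_fiberwise_of_maps_to (fun v hv => Finset.mem_image_of_mem _ hv) _).symm
    _ ≤ ∑ m ∈ u.image ℓ, Module.finrank ℚ K * (2 / √m ^ 3) := by
        refine Finset.sum_le_sum fun m hm => ?_
        rw [Finset.sum_congr rfl (g := fun _ => 2 / √m ^ 3)
          fun v hv => by rw [(Finset.mem_filter.1 hv).2], Finset.sum_const, nsmul_eq_mul]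
        refine mul_le_mul_of_nonneg_right ?_ (by positivity)
        obtain ⟨v, _, rfl⟩ := Finset.mem_image.1 hm
        refine Nat.cast_le.2 (card_le_finrank_of_prime_mem (hℓ v) _ fun w hw => ?_)
        rw [← (Finset.mem_filter.1 hw).2]
        exact ⟨hmem w, hle w⟩
    _ ≤ _ := by
        rw [← Finset.mul_sum]
        exact mul_le_mul_of_nonneg_left (hs.sum_le_tsum _ fun m _ => by positivity) (by positivity)

end PrimeSum

section SolCountTransfer

variable {ι A B : Type*} [Fintype ι] [CommRing A] [CommRing B]

/-- The number of solutions is multiplicative. -/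
lemma solCount_eq_prod {κ : Type*} [Fintype κ] {I : Ideal A} {J : κ → Ideal A}
    (e : A ⧸ I ≃+* ∀ i, A ⧸ J i)
    (he : ∀ x i, e (Ideal.Quotient.mk I x) i = Ideal.Quotient.mk (J i) x)
    (C : Matrix ι ι A) (a : A) : solCount C I a = ∏ i, solCount C (J i) a := by
  simp only [solCount]
  rw [← Nat.card_pi]
  let f : (ι → A ⧸ I) ≃ (∀ i, ι → A ⧸ J i) :=
    ((Equiv.refl ι).arrowCongr e.toEquiv).trans (Equiv.piComm _)
  have hf : ∀ x i, qf (C.map (Ideal.Quotient.mk (J i))) (f x i) =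
      e (qf (C.map (Ideal.Quotient.mk I)) x) i := by
    intro x i
    have := map_qf ((Pi.evalRingHom (fun i => A ⧸ J i) i).comp (e : A ⧸ I →+* ∀ i, A ⧸ J i))
      (C.map (Ideal.Quotient.mk I)) x
    simp only [RingHom.comp_apply, Pi.evalRingHom_apply, RingHom.coe_coe] at this
    rw [this]
    congr 1
    ext j l
    simp [he]
  refine Nat.card_congr ((f.subtypeEquiv (q := fun y => ∀ i,
    qf (C.map (Ideal.Quotient.mk (J i))) (y i) = Ideal.Quotient.mk (J i) a) fun x => ?_).trans
    (Equiv.subtypePiEquivPi (β := fun i => ι → A ⧸ J i) (p := fun {i} y =>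
      qf (C.map (Ideal.Quotient.mk (J i))) y = Ideal.Quotient.mk (J i) a)))
  simp_rw [hf, ← he a, ← funext_iff, e.injective.eq_iff]

lemma solCount_eq_of_equiv [Algebra A B] {I : Ideal A} {J : Ideal B} (e : A ⧸ I ≃+* B ⧸ J)
    (he : ∀ x, e (Ideal.Quotient.mk I x) = Ideal.Quotient.mk J (algebraMap A B x))
    (C : Matrix ι ι A) (a : A) :
    solCount C I a = solCount (C.map (algebraMap A B)) J (algebraMap A B a) := by
  refine Nat.card_congr (((Equiv.refl ι).arrowCongr e.toEquiv).subtypeEquiv fun x => ?_)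
  rw [← e.injective.eq_iff, he]
  have := map_qf (e : A ⧸ I →+* B ⧸ J) (C.map (Ideal.Quotient.mk I)) x
  simp only [RingHom.coe_coe] at this
  rw [this]
  have h2 : (C.map (Ideal.Quotient.mk I)).map e =
      (C.map (algebraMap A B)).map (Ideal.Quotient.mk J) := by
    ext i j; simp [he]
  rw [h2]
  rfl

end SolCountTransfer

section GlobalDensity

open IsDedekindDomain NumberField IsLocalRing

variable {ι K : Type*} [Fintype ι] [Field K] [NumberField K]

/-- `a` is represented by the form modulo every prime power. -/
def LocallyRepresented (C : Matrix ι ι (𝓞 K)) (a : 𝓞 K) : Prop :=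
  ∀ (v : HeightOneSpectrum (𝓞 K)) (k : ℕ), ∃ y, qf C y - a ∈ v.asIdeal ^ k

lemma exists_localBound [DecidableEq ι] (hι : 5 ≤ Fintype.card ι) {C : Matrix ι ι (𝓞 K)}
    (hdet : (C + Cᵀ).det ≠ 0) (v : HeightOneSpectrum (𝓞 K)) :
    (∃ β : ℝ, 0 < β ∧ ∀ k a, LocallyRepresented C a →
      β * ((Ideal.absNorm v.asIdeal : ℝ) ^ k) ^ (Fintype.card ι - 1) ≤
        solCount C (v.asIdeal ^ k) a) ∧
    ((C + Cᵀ).det ∉ v.asIdeal → ∀ k a,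
      (1 - 2 / √(Ideal.absNorm v.asIdeal) ^ 3) *
        ((Ideal.absNorm v.asIdeal : ℝ) ^ k) ^ (Fintype.card ι - 1) ≤
        solCount C (v.asIdeal ^ k) a) := by
  let p := v.asIdeal
  have hp : p.IsMaximal := v.isMaximal
  let R := Localization.AtPrime p
  have hdvr : IsDiscreteValuationRing R :=
    IsLocalization.AtPrime.isDiscreteValuationRing_of_dedekind_domain (𝓞 K) v.ne_bot R
  let e0 : (𝓞 K ⧸ p) ≃ ResidueField R := (IsLocalization.AtPrime.equivQuotMaximalIdeal p R).toEquiv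
  have hq : Nat.card (ResidueField R) = Ideal.absNorm p := (Nat.card_congr e0).symm
  have hfin : Finite (ResidueField R) :=
    Nat.finite_of_card_ne_zero (by rw [hq]; exact Ideal.absNorm_eq_zero_iff.not.2 v.ne_bot)
  have hcount : ∀ k a, solCount C (p ^ k) a =
      solCount (C.map (algebraMap (𝓞 K) R)) (maximalIdeal R ^ k) (algebraMap (𝓞 K) R a) :=
    fun k a => solCount_eq_of_equiv
      (IsLocalization.AtPrime.equivQuotMaximalIdealPow p R k).toRingEquiv (fun x => rfl) C a
  have hM : ((C.map (algebraMap (𝓞 K) R)) + (C.map (algebraMap (𝓞 K) R))ᵀ).det =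
      algebraMap (𝓞 K) R (C + Cᵀ).det := by
    rw [RingHom.map_det, RingHom.mapMatrix_apply]
    congr 1
    ext i j; simp
  refine ⟨?_, fun hdv k a => ?_⟩
  · obtain ⟨ϖ, hϖ⟩ := IsDiscreteValuationRing.exists_irreducible R
    have hne : algebraMap (𝓞 K) R (C + Cᵀ).det ≠ 0 :=
      fun h => hdet ((IsLocalization.injective R p.primeCompl_le_nonZeroDivisors)
        (h.trans (map_zero _).symm))
    obtain ⟨w, u, hu⟩ := IsDiscreteValuationRing.eq_unit_mul_pow_irreducible hne hϖ
    rw [← hM] at hu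
    have hloc : ∀ a k, LocallyRepresented C a → ∃ x, ϖ ^ k ∣ qf (C.map (algebraMap (𝓞 K) R)) x -
        algebraMap (𝓞 K) R a := by
      intro a k ha
      obtain ⟨y, hy⟩ := ha v k
      refine ⟨fun i => algebraMap (𝓞 K) R (y i), ?_⟩
      rw [← map_qf, ← map_sub, ← mem_maximalIdeal_pow_iff hϖ,
        ← Localization.AtPrime.map_eq_maximalIdeal, ← Ideal.map_pow]
      exact Ideal.mem_map_of_mem _ hy
    have hpos : (0 : ℝ) <
        ((Nat.card (ResidueField R) : ℝ) ^ (4 * w + 1)) ^ (Fintype.card ι - 1) := by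
      have : 0 < Nat.card (ResidueField R) := Nat.card_pos
      positivity
    refine ⟨_, inv_pos.2 hpos, fun k a ha => ?_⟩
    have h := card_pow_le_mul_solCount hϖ hι hu (hloc a _ ha) k (hloc a _ ha)
    rw [inv_mul_le_iff₀ hpos, hcount k a, ← hq]
    exact_mod_cast h
  · rw [hcount, ← hq, mul_comm]
    refine le_solCount_of_isUnit_det hι ?_ _ k
    rw [hM]
    exact IsLocalization.map_units R (⟨_, hdv⟩ : p.primeCompl)

lemma exists_solCount_eq_prod_pow (C : Matrix ι ι (𝓞 K)) {I : Ideal (𝓞 K)} (hI : I ≠ ⊥) :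
    ∃ (F : Finset (HeightOneSpectrum (𝓞 K))) (k : HeightOneSpectrum (𝓞 K) → ℕ),
      (∀ a, solCount C I a = ∏ v ∈ F, solCount C (v.asIdeal ^ k v) a) ∧
      Ideal.absNorm I = ∏ v ∈ F, Ideal.absNorm v.asIdeal ^ k v := by
  classical
  let F := (UniqueFactorizationMonoid.factors I).toFinset
  have hpr : ∀ P : F, Prime (P : Ideal (𝓞 K)) := fun P =>
    UniqueFactorizationMonoid.prime_of_factor _ (Multiset.mem_toFinset.1 P.2)
  let w : F → HeightOneSpectrum (𝓞 K) := fun P =>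
    ⟨P, Ideal.isPrime_of_prime (hpr P), (hpr P).ne_zero⟩
  have hw : w.Injective := fun P P' h => Subtype.ext (congrArg HeightOneSpectrum.asIdeal h)
  let e := IsDedekindDomain.quotientEquivPiFactors hI
  refine ⟨Finset.univ.image w,
    fun v => Multiset.count v.asIdeal (UniqueFactorizationMonoid.factors I), fun a => ?_, ?_⟩
  · rw [Finset.prod_image hw.injOn]
    exact solCount_eq_prod e (fun x i => rfl) C a
  · rw [Finset.prod_image hw.injOn]
    have h := Nat.card_congr e.toEquiv
    rw [Nat.card_pi] at h
    refine h.trans (Finset.prod_congr rfl fun P _ => ?_)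
    rw [← map_pow]
    rfl

lemma one_sub_sum_le_prod {α : Type*} {x : α → ℝ} {s : Finset α} (h0 : ∀ i, 0 ≤ x i)
    (h1 : ∀ i ∈ s, x i ≤ 1) :
    1 - ∑ i ∈ s, x i ≤ ∏ i ∈ s, (1 - x i) := by
  classical
  induction s using Finset.induction_on with
  | empty => simp
  | insert a s ha ih =>
    rw [Finset.sum_insert ha, Finset.prod_insert ha]
    have h2 := ih fun i hi => h1 i (Finset.mem_insert_of_mem hi)
    have h3 := h1 a (Finset.mem_insert_self a s)
    have h4 := Finset.sum_nonneg fun i (_ : i ∈ s) => h0 i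
    nlinarith [h0 a]

/-- Uniform lower bound for the number of solutions modulo arbitrary ideals of a locally solvable
equation in at least five variables. -/
theorem exists_density [DecidableEq ι] (hι : 5 ≤ Fintype.card ι) {C : Matrix ι ι (𝓞 K)}
    (hdet : (C + Cᵀ).det ≠ 0) : ∃ δ : ℝ, 0 < δ ∧ ∀ I : Ideal (𝓞 K), I ≠ ⊥ →
      ∀ a, LocallyRepresented C a →
        δ * (Ideal.absNorm I : ℝ) ^ (Fintype.card ι - 1) ≤ solCount C I a := by
  classical
  let x : HeightOneSpectrum (𝓞 K) → ℝ := fun v => 2 / √(Ideal.absNorm v.asIdeal) ^ 3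
  have hx0 : ∀ v, 0 ≤ x v := fun v => by positivity
  have hbad : {v : HeightOneSpectrum (𝓞 K) | (C + Cᵀ).det ∈ v.asIdeal}.Finite := by
    have h := Ideal.finite_factors (I := Ideal.span {(C + Cᵀ).det})
      (by simpa using hdet)
    refine h.subset fun v hv => ?_
    simpa [Ideal.dvd_span_singleton] using hv
  obtain ⟨T, hT⟩ := (summable_iff_vanishing_norm.1 (summable_absNorm (K := K))) (1 / 2)
    (by norm_num)
  choose β hβ0 hβ using fun v => (exists_localBound hι hdet v).1
  let B := T ∪ hbad.toFinset
  let γ : HeightOneSpectrum (𝓞 K) → ℝ := fun v => if v ∈ B then min (β v) 1 else 1 - x v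
  have hγ : ∀ v k a, LocallyRepresented C a →
      γ v * ((Ideal.absNorm v.asIdeal : ℝ) ^ k) ^ (Fintype.card ι - 1) ≤
        solCount C (v.asIdeal ^ k) a := by
    intro v k a ha
    by_cases hv : v ∈ B
    · simp only [γ, if_pos hv]
      exact (mul_le_mul_of_nonneg_right (min_le_left _ _) (by positivity)).trans (hβ v k a ha)
    · simp only [γ, if_neg hv]
      refine (exists_localBound hι hdet v).2 (fun h => hv ?_) k a
      exact Finset.mem_union_right _ (by simpa using h)
  have hγ0 : ∀ v, 0 ≤ γ v := by
    intro v
    by_cases hv : v ∈ B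
    · simp only [γ, if_pos hv]
      exact le_min (hβ0 v).le zero_le_one
    · simp only [γ, if_neg hv]
      have := hT {v} (Finset.disjoint_singleton_left.2 fun h => hv (Finset.mem_union_left _ h))
      rw [Finset.sum_singleton, Real.norm_of_nonneg (hx0 v)] at this
      change x v < _ at this
      linarith
  have hprod : ∀ u : Finset (HeightOneSpectrum (𝓞 K)),
      (∏ v ∈ B, min (β v) 1) * (1 / 2) ≤ ∏ v ∈ u, γ v := by
    intro u
    rw [← Finset.prod_inter_mul_prod_sdiff u B]
    have h1 : ∏ v ∈ B, min (β v) 1 ≤ ∏ v ∈ u ∩ B, γ v := by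
      rw [Finset.prod_congr rfl (g := fun v => min (β v) 1) (s₁ := u ∩ B)
        fun v hv => if_pos (Finset.mem_inter.1 hv).2]
      exact Finset.prod_le_prod_of_subset_of_le_one Finset.inter_subset_right
        (fun v _ => le_min (hβ0 v).le zero_le_one) fun v _ _ => min_le_right _ _
    have h2 : (1 / 2 : ℝ) ≤ ∏ v ∈ u \ B, γ v := by
      have hlt : ∑ v ∈ u \ B, x v < 1 / 2 := by
        refine (Real.norm_of_nonneg (Finset.sum_nonneg fun v _ => hx0 v)).symm.trans_lt (hT _ ?_)
        exact Finset.sdiff_disjoint.mono_right Finset.subset_union_left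
      rw [Finset.prod_congr rfl (g := fun v => 1 - x v)
        fun v hv => if_neg (Finset.mem_sdiff.1 hv).2]
      refine le_trans (by linarith) (one_sub_sum_le_prod hx0 fun v hv => ?_)
      exact (Finset.single_le_sum (fun v _ => hx0 v) hv).trans (hlt.le.trans (by norm_num))
    exact mul_le_mul h1 h2 (by norm_num) (Finset.prod_nonneg fun v _ => hγ0 v)
  refine ⟨(∏ v ∈ B, min (β v) 1) * (1 / 2), ?_, fun I hI a ha => ?_⟩
  · have := Finset.prod_pos fun v (_ : v ∈ B) => lt_min (hβ0 v) one_pos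
    positivity
  · obtain ⟨F, k, hcount, hI'⟩ := exists_solCount_eq_prod_pow C hI
    have hF := Finset.prod_le_prod
      (fun v _ => mul_nonneg (hγ0 v) (pow_nonneg (pow_nonneg (Nat.cast_nonneg _) _) _))
      fun v (_ : v ∈ F) => hγ v (k v) a ha
    rw [Finset.prod_mul_distrib, Finset.prod_pow] at hF
    have hc : (solCount C I a : ℝ) = ∏ v ∈ F, (solCount C (v.asIdeal ^ k v) a : ℝ) := by
      rw [hcount, Nat.cast_prod]
    have hn : (Ideal.absNorm I : ℝ) = ∏ v ∈ F, (Ideal.absNorm v.asIdeal : ℝ) ^ k v := by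
      rw [hI', Nat.cast_prod]
      exact Finset.prod_congr rfl fun v _ => Nat.cast_pow _ _
    rw [hc, hn]
    exact (mul_le_mul_of_nonneg_right (hprod F) (pow_nonneg (hn ▸ Nat.cast_nonneg _) _)).trans hF

end GlobalDensity

section Boxes

variable {O W : Type*} [CommRing O] [Fintype W]

lemma exists_ne_abs_sub_lt {α : Type*} {s : Finset α} {f : α → W → ℝ}
    (hf : ∀ a ∈ s, ∀ w, |f a w| ≤ 1) {q : ℕ} (hq : 0 < q)
    (hs : (q + 1) ^ Fintype.card W < s.card) :
    ∃ a ∈ s, ∃ b ∈ s, a ≠ b ∧ ∀ w, |f a w - f b w| < 2 / q := by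
  classical
  have hq' : (0 : ℝ) < q := by exact_mod_cast hq
  let g : α → W → ℕ := fun a w => ⌊(f a w + 1) / 2 * q⌋₊
  have hg : ∀ a ∈ s, g a ∈ Fintype.piFinset fun _ : W => Finset.range (q + 1) := by
    intro a ha
    refine Fintype.mem_piFinset.2 fun w => Finset.mem_range.2 (Nat.lt_succ_of_le ?_)
    refine Nat.floor_le_of_le ?_
    have := (abs_le.1 (hf a ha w)).2
    nlinarith
  have hcard : (Fintype.piFinset fun _ : W => Finset.range (q + 1)).card < s.card := by
    simpa using hs
  obtain ⟨a, ha, b, hb, hne, hab⟩ := Finset.exists_ne_map_eq_of_card_lt_of_maps_to hcard hg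
  refine ⟨a, ha, b, hb, hne, fun w => ?_⟩
  have h := congrFun hab w
  have h1 : ∀ c ∈ s, 0 ≤ (f c w + 1) / 2 * q := fun c hc => by
    have := (abs_le.1 (hf c hc w)).1
    exact mul_nonneg (by linarith) hq'.le
  have h2 := Nat.floor_le (h1 a ha)
  have h3 := Nat.lt_floor_add_one ((f a w + 1) / 2 * q)
  have h4 := Nat.floor_le (h1 b hb)
  have h5 := Nat.lt_floor_add_one ((f b w + 1) / 2 * q)
  have h6 : ((⌊(f a w + 1) / 2 * q⌋₊ : ℕ) : ℝ) = ⌊(f b w + 1) / 2 * q⌋₊ := by exact_mod_cast h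
  rw [lt_div_iff₀ hq', show |f a w - f b w| * (q : ℝ) = |(f a w - f b w) * q| by
    rw [abs_mul, abs_of_pos hq'], abs_lt]
  constructor <;> nlinarith

/-- The norm from a family of real embeddings is at least `1` on nonzero elements. -/
def IsDiscreteFamily (σ : W → O →+* ℝ) : Prop := ∀ x, x ≠ 0 → 1 ≤ ∏ w, |σ w x|

variable {σ : W → O →+* ℝ}

lemma IsDiscreteFamily.eq_zero (hσ : IsDiscreteFamily σ) {x : O} {s : W → ℝ}
    (hx : ∀ w, |σ w x| ≤ s w) (hs : ∏ w, s w < 1) : x = 0 := by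
  by_contra h
  exact absurd ((hσ x h).trans (Finset.prod_le_prod (fun w _ => abs_nonneg _) fun w _ => hx w))
    (not_le.2 hs)

lemma IsDiscreteFamily.map_ne_zero (hσ : IsDiscreteFamily σ) {x : O} (hx : x ≠ 0) (w : W) :
    σ w x ≠ 0 := by
  intro h
  have := hσ x hx
  rw [Finset.prod_eq_zero (Finset.mem_univ w) (by simp [h])] at this
  linarith

lemma IsDiscreteFamily.card_le [Nonempty W] (hσ : IsDiscreteFamily σ) {c s : W → ℝ}
    (hs0 : ∀ w, 0 < s w)
    (hs : 1 ≤ ∏ w, s w) (A : Finset O) (hA : ∀ x ∈ A, ∀ w, |σ w x - c w| ≤ s w) :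
    (A.card : ℝ) ≤ 5 ^ Fintype.card W * ∏ w, s w := by
  classical
  set D := Fintype.card W with hD
  have hD0 : D ≠ 0 := Fintype.card_ne_zero
  set μ := (∏ w, s w) ^ ((D : ℝ)⁻¹) with hμ
  have hμD : μ ^ D = ∏ w, s w := Real.rpow_inv_natCast_pow (by linarith) hD0
  have hμ1 : 1 ≤ μ := Real.one_le_rpow hs (by positivity)
  set q := ⌊2 * μ⌋₊ + 1 with hq
  have hq1 : 2 * μ < q := by
    rw [hq]; push_cast; exact Nat.lt_floor_add_one _
  have hq2 : ((q : ℝ) + 1) ≤ 5 * μ := by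
    have : (⌊2 * μ⌋₊ : ℝ) ≤ 2 * μ := Nat.floor_le (by linarith)
    rw [hq]; push_cast; linarith
  have hq0 : (0 : ℝ) < q := by positivity
  by_contra! hlt
  have hlt' : (q + 1) ^ D < A.card := by
    have : ((q : ℝ) + 1) ^ D ≤ 5 ^ D * ∏ w, s w := by
      rw [← hμD, ← mul_pow]
      exact pow_le_pow_left₀ (by positivity) hq2 D
    exact_mod_cast this.trans_lt hlt
  obtain ⟨x, hx, y, hy, hne, hxy⟩ := exists_ne_abs_sub_lt (s := A)
    (f := fun x w => (σ w x - c w) / s w) (fun x hx w => by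
      rw [abs_div, abs_of_pos (hs0 w), div_le_one (hs0 w)]
      exact hA x hx w) (Nat.succ_pos _) hlt'
  refine hne (sub_eq_zero.1 (hσ.eq_zero (s := fun w => s w * (2 / q)) (fun w => ?_) ?_))
  · have h := (hxy w).le
    rw [← sub_div, abs_div, abs_of_pos (hs0 w), div_le_iff₀ (hs0 w)] at h
    rw [map_sub, mul_comm]
    refine le_trans (le_of_eq ?_) h
    congr 1
    ring
  · rw [Finset.prod_mul_distrib, Finset.prod_const, Finset.card_univ, ← hD, ← hμD, ← mul_pow]
    refine pow_lt_one₀ (by positivity) ?_ hD0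
    rw [mul_div_assoc', div_lt_one hq0]
    linarith

/-- The small solutions `ℓ` of the approximate congruence `ξ ℓ ≡ 0` modulo `m`. -/
def approxKernel (σ : W → O →+* ℝ) (m : ℕ) (X : ℝ) (ξ : O) : Set O :=
  {l | (∀ w, |σ w l| ≤ X) ∧ ∃ k : O, ∀ w, |σ w (ξ * l - m * k)| ≤ X}

lemma IsDiscreteFamily.exists_small_of_card_lt [IsDomain O] [Nonempty W]
    (hσ : IsDiscreteFamily σ) {m : ℕ}
    {X : ℝ} (hX : 0 < X) (hm : 2 * X ^ 2 < m) {ξ : O} {A : Finset O}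
    (hA : ∀ l ∈ A, l ∈ approxKernel σ m X ξ) {t : ℕ} (ht : 0 < t)
    (hcard : (t + 1) ^ Fintype.card W < A.card) :
    ∃ l, l ≠ 0 ∧ (∀ w, |σ w l| ≤ 2 * X / t) ∧ ∃ k : O, ∀ w, |σ w (ξ * l - m * k)| ≤ 2 * X / t := by
  classical
  have hm0 : (0 : ℝ) < m := by nlinarith
  have hA' : ∀ l : A, ∃ k : O, ∀ w, |σ w (ξ * l - m * k)| ≤ X := fun l => (hA l l.2).2
  choose k hk using hA'
  obtain ⟨l₀, hl₀, hl₀'⟩ : ∃ l ∈ A, l ≠ 0 := by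
    have : 1 < A.card := lt_of_le_of_lt (Nat.one_le_pow _ _ (by omega)) hcard
    obtain ⟨a, ha, b, hb, hab⟩ := Finset.one_lt_card.1 this
    rcases eq_or_ne a 0 with rfl | h
    · exact ⟨b, hb, hab.symm⟩
    · exact ⟨a, ha, h⟩
  have hcol : ∀ l : A, ∀ l' : A, (l : O) * k l' = l' * k l := by
    intro l l'
    refine sub_eq_zero.1 (hσ.eq_zero (s := fun _ => 2 * X ^ 2 / m) (fun w => ?_) ?_)
    · have h1 : σ w (l * k l' - l' * k l) * m =
          σ w l' * σ w (ξ * l - m * k l) - σ w l * σ w (ξ * l' - m * k l') := by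
        rw [← map_mul, ← map_mul, ← map_sub, ← map_natCast (σ w) m, ← map_mul]
        congr 1
        ring
      rw [le_div_iff₀ hm0, show |σ w (l * k l' - l' * k l)| * (m : ℝ) =
        |σ w (l * k l' - l' * k l) * m| by rw [abs_mul, abs_of_pos hm0], h1]
      refine (abs_sub _ _).trans ?_
      rw [abs_mul, abs_mul]
      have := mul_le_mul ((hA l' l'.2).1 w) (hk l w) (abs_nonneg _) hX.le
      have := mul_le_mul ((hA l l.2).1 w) (hk l' w) (abs_nonneg _) hX.le
      linarith
    · rw [Finset.prod_const]
      refine pow_lt_one₀ (by positivity) ?_ (Finset.card_ne_zero.2 Finset.univ_nonempty)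
      rwa [div_lt_one hm0]
  let ρ : W → ℝ := fun w => |σ w (ξ * l₀ - m * k ⟨l₀, hl₀⟩)| / |σ w l₀|
  have hρ : ∀ (l : A) w, |σ w (ξ * l - m * k l)| = ρ w * |σ w l| := by
    intro l w
    have h0 : |σ w l₀| ≠ 0 := abs_ne_zero.2 (hσ.map_ne_zero hl₀' w)
    rw [div_mul_eq_mul_div, eq_div_iff h0, ← abs_mul, ← abs_mul, ← map_mul, ← map_mul]
    congr 2
    linear_combination (-(m : O)) * hcol ⟨l₀, hl₀⟩ l
  have hg0 : ∀ w, 0 < max 1 (ρ w) / X := fun w => by positivity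
  obtain ⟨l, hl, l', hl', hne, hll⟩ := exists_ne_abs_sub_lt (s := A)
    (f := fun l w => max 1 (ρ w) / X * σ w l) (fun l hl w => by
      rw [abs_mul, abs_of_pos (hg0 w), div_mul_eq_mul_div, div_le_one hX, max_mul_of_nonneg _ _
        (abs_nonneg _), max_le_iff, one_mul]
      exact ⟨(hA l hl).1 w, (hρ ⟨l, hl⟩ w).symm.trans_le (hk ⟨l, hl⟩ w)⟩) ht hcard
  have key : ∀ w, max 1 (ρ w) * |σ w (l - l')| ≤ 2 * X / t := fun w => by
    have := (hll w).le
    rw [← mul_sub, ← map_sub, abs_mul, abs_of_pos (hg0 w), div_mul_eq_mul_div,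
      div_le_iff₀ hX] at this
    refine this.trans (le_of_eq (by ring))
  refine ⟨l - l', sub_ne_zero.2 hne, fun w => ?_, k ⟨l, hl⟩ - k ⟨l', hl'⟩, fun w => ?_⟩
  · refine le_trans ?_ (key w)
    exact le_mul_of_one_le_left (abs_nonneg _) (le_max_left _ _)
  · refine le_trans ?_ (key w)
    have h0 : |σ w l₀| ≠ 0 := abs_ne_zero.2 (hσ.map_ne_zero hl₀' w)
    have : |σ w (ξ * (l - l') - m * (k ⟨l, hl⟩ - k ⟨l', hl'⟩))| = ρ w * |σ w (l - l')| := by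
      rw [div_mul_eq_mul_div, eq_div_iff h0, ← abs_mul, ← abs_mul, ← map_mul, ← map_mul]
      congr 2
      linear_combination (-(m : O)) * (hcol ⟨l₀, hl₀⟩ ⟨l, hl⟩ - hcol ⟨l₀, hl₀⟩ ⟨l', hl'⟩)
    rw [this]
    exact mul_le_mul_of_nonneg_right (le_max_right _ _) (abs_nonneg _)

end Boxes

section LevelSet

variable {O W : Type*} [CommRing O] [Fintype W] {σ : W → O →+* ℝ}

lemma card_le_mul_of_image_le {α β : Type*} [DecidableEq β] {s : Finset α} {f : α → β} {M N : ℝ}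
    (hM : 0 ≤ M) (hfib : ∀ b ∈ s.image f, ((s.filter fun a => f a = b).card : ℝ) ≤ M)
    (himg : ((s.image f).card : ℝ) ≤ N) : (s.card : ℝ) ≤ M * N := by
  rw [Finset.card_eq_sum_card_image f s, Nat.cast_sum]
  refine (Finset.sum_le_card_nsmul _ _ _ hfib).trans ?_
  rw [nsmul_eq_mul, mul_comm]
  exact mul_le_mul_of_nonneg_left himg hM

lemma IsDiscreteFamily.card_fiber_le [Nonempty W] (hσ : IsDiscreteFamily σ) {m : ℕ} (hm : 0 < m)
    {c lam : ℝ} (hc : 1 ≤ c) (hl : 1 ≤ lam) {l : O} (hl0 : l ≠ 0) (hll : ∀ w, |σ w l| ≤ lam)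
    {A : Finset O} (hA : ∀ ξ ∈ A, ∀ w, |σ w ξ| ≤ c * m)
    (hA' : ∀ ξ ∈ A, ∃ k : O, ∀ w, |σ w (ξ * l - m * k)| ≤ lam) :
    (A.card : ℝ) ≤ (25 * (c * (c + 1)) * lam) ^ Fintype.card W := by
  classical
  have hm0 : (0 : ℝ) < m := by exact_mod_cast hm
  have hm1 : (1 : ℝ) ≤ m := by exact_mod_cast hm
  have hpos : ∀ w, 0 < |σ w l| := fun w => abs_pos.2 (hσ.map_ne_zero hl0 w)
  choose! k hk using hA'
  let s : W → ℝ := fun w => if lam ≤ m * |σ w l| then lam / |σ w l| else c * m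
  have hs1 : ∀ w, 1 ≤ s w := by
    intro w
    by_cases h : lam ≤ m * |σ w l|
    · simp only [s, if_pos h, one_le_div (hpos w)]
      exact hll w
    · simp only [s, if_neg h]
      nlinarith
  let u : W → ℝ := fun w => c * |σ w l| + lam / m
  have hu : ∀ w, |σ w l| ≤ u w := fun w => by
    have : 0 < lam / m := by positivity
    have := hpos w
    simp only [u]
    nlinarith
  have hsu : ∀ w, s w * u w ≤ c * (c + 1) * lam := by
    intro w
    have := hpos w
    by_cases h : lam ≤ m * |σ w l|
    · simp only [s, if_pos h, u]
      have h1 : lam / m ≤ |σ w l| := by rwa [div_le_iff₀ hm0, mul_comm]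
      calc lam / |σ w l| * (c * |σ w l| + lam / m)
          ≤ lam / |σ w l| * (c * |σ w l| + |σ w l|) := by gcongr
        _ = (c + 1) * lam := by field_simp
        _ ≤ c * (c + 1) * lam := by
          rw [mul_assoc]
          exact le_mul_of_one_le_left (by nlinarith) hc
    · simp only [s, if_neg h, u]
      have h1 : |σ w l| ≤ lam / m := by
        rw [le_div_iff₀ hm0]; linarith
      calc c * m * (c * |σ w l| + lam / m)
          ≤ c * m * (c * (lam / m) + lam / m) := by gcongr
        _ = c * (c + 1) * lam := by field_simp
  have hfib : ∀ b ∈ A.image k, ((A.filter fun a => k a = b).card : ℝ) ≤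
      5 ^ Fintype.card W * ∏ w, s w := by
    intro b _
    refine hσ.card_le (c := fun w => if lam ≤ m * |σ w l| then m * σ w b / σ w l else 0)
      (fun w => one_pos.trans_le (hs1 w)) (Finset.one_le_prod fun w _ => hs1 w) _ ?_
    intro ξ hξ w
    obtain ⟨hξA, rfl⟩ := Finset.mem_filter.1 hξ
    by_cases h : lam ≤ m * |σ w l|
    · simp only [s, if_pos h]
      rw [le_div_iff₀ (hpos w), ← abs_mul, sub_mul, div_mul_cancel₀ _ (hσ.map_ne_zero hl0 w)]
      simpa using hk ξ hξA w
    · simp only [s, if_neg h, sub_zero]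
      exact hA ξ hξA w
  have himg : ((A.image k).card : ℝ) ≤ 5 ^ Fintype.card W * ∏ w, u w := by
    refine hσ.card_le (c := 0) (fun w => (hpos w).trans_le (hu w))
      ((hσ l hl0).trans (Finset.prod_le_prod (fun w _ => (hpos w).le) fun w _ => hu w)) _ ?_
    intro b hb w
    obtain ⟨ξ, hξ, rfl⟩ := Finset.mem_image.1 hb
    have h1 := hk ξ hξ w
    rw [map_sub, map_mul, map_mul, map_natCast] at h1
    have h2 : |(m : ℝ) * σ w (k ξ)| ≤ lam + c * m * |σ w l| := by
      have h3 := abs_sub_abs_le_abs_sub (m * σ w (k ξ)) (σ w ξ * σ w l)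
      rw [abs_sub_comm (m * σ w (k ξ)), abs_mul (σ w ξ)] at h3
      have h4 := mul_le_mul_of_nonneg_right (hA ξ hξ w) (hpos w).le
      linarith
    rw [abs_mul, abs_of_pos hm0] at h2
    simp only [u, Pi.zero_apply, sub_zero]
    rw [← sub_le_iff_le_add', le_div_iff₀ hm0]
    linarith
  refine (card_le_mul_of_image_le ?_ hfib himg).trans ?_
  · exact mul_nonneg (by positivity) (Finset.prod_nonneg fun w _ => zero_le_one.trans (hs1 w))
  · calc (5 ^ Fintype.card W * ∏ w, s w) * (5 ^ Fintype.card W * ∏ w, u w)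
        = (5 * 5) ^ Fintype.card W * ∏ w, (s w * u w) := by
          rw [Finset.prod_mul_distrib, mul_pow]; ring
      _ ≤ (5 * 5) ^ Fintype.card W * ∏ _w : W, (c * (c + 1) * lam) := by
          refine mul_le_mul_of_nonneg_left (Finset.prod_le_prod (fun w _ => ?_) fun w _ => hsu w)
            (by positivity)
          exact mul_nonneg (zero_le_one.trans (hs1 w)) ((abs_nonneg _).trans (hu w))
      _ = _ := by rw [Finset.prod_const, Finset.card_univ, ← mul_pow]; ring

lemma IsDiscreteFamily.card_approx_le [Nonempty W] (hσ : IsDiscreteFamily σ) {m : ℕ} (hm : 0 < m)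
    {c lam : ℝ} (hc : 1 ≤ c) (hl : 1 ≤ lam)
    {A : Finset O} (hA : ∀ ξ ∈ A, ∀ w, |σ w ξ| ≤ c * m)
    (hA' : ∀ ξ ∈ A, ∃ l, l ≠ 0 ∧ (∀ w, |σ w l| ≤ lam) ∧
      ∃ k : O, ∀ w, |σ w (ξ * l - m * k)| ≤ lam) :
    (A.card : ℝ) ≤ (125 * (c * (c + 1)) * lam ^ 2) ^ Fintype.card W := by
  classical
  choose! l hl0 hll k hk using hA'
  refine (card_le_mul_of_image_le (f := l) (by positivity) (fun b hb => ?_) ?_).trans_eq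
    (b := (25 * (c * (c + 1)) * lam) ^ Fintype.card W *
      (5 ^ Fintype.card W * ∏ _w : W, lam)) ?_
  · obtain ⟨ξ, hξ, rfl⟩ := Finset.mem_image.1 hb
    refine hσ.card_fiber_le hm hc hl (hl0 ξ hξ) (hll ξ hξ)
      (fun η hη => hA η (Finset.mem_filter.1 hη).1) fun η hη => ?_
    obtain ⟨h1, h2⟩ := Finset.mem_filter.1 hη
    exact ⟨k η, h2 ▸ hk η h1⟩
  · refine hσ.card_le (c := 0) (fun _ => by positivity) (Finset.one_le_prod fun _ _ => hl) _ ?_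
    intro b hb w
    obtain ⟨ξ, hξ, rfl⟩ := Finset.mem_image.1 hb
    simpa using hll ξ hξ w
  · rw [Finset.prod_const, Finset.card_univ, ← mul_pow, ← mul_pow]
    ring

end LevelSet

section LargeSieve

variable {I : Type*} [Fintype I] {m : ℕ}

/-- The integer points of a cube centred at the origin. -/
noncomputable def intCube (I : Type*) [Fintype I] [DecidableEq I] (P : ℕ) : Finset (I → ℤ) :=
  Fintype.piFinset fun _ => Finset.Icc (-(P : ℤ)) P

lemma mem_intCube [DecidableEq I] {P : ℕ} {h : I → ℤ} : h ∈ intCube I P ↔ ∀ i, |h i| ≤ P := by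
  simp [intCube, Fintype.mem_piFinset, abs_le]

lemma intCast_injOn_intCube [DecidableEq I] {P : ℕ} (hP : 2 * P < m) :
    Set.InjOn (fun (h : I → ℤ) i => (h i : ZMod m)) (intCube I P : Set (I → ℤ)) := by
  intro h hh h' hh' heq
  funext i
  have h1 := (ZMod.intCast_eq_intCast_iff_dvd_sub _ _ _).1 (congrFun heq i)
  have h2 := mem_intCube.1 hh i
  have h3 := mem_intCube.1 hh' i
  have h4 := Int.eq_zero_of_abs_lt_dvd h1 (by
    have := abs_sub (h' i) (h i)
    omega)
  omega

variable [NeZero m]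

lemma stdAddChar_dotProduct (h u : I → ZMod m) :
    ZMod.stdAddChar (h ⬝ᵥ u) = ∏ i, ZMod.stdAddChar (h i * u i) := by
  classical
  rw [dotProduct]
  induction (Finset.univ : Finset I) using Finset.induction_on with
  | empty => simp
  | insert a s ha ih => rw [Finset.sum_insert ha, Finset.prod_insert ha, AddChar.map_add_eq_mul, ih]

lemma sum_stdAddChar_dotProduct [DecidableEq I] (u : I → ZMod m) :
    ∑ h : I → ZMod m, ZMod.stdAddChar (h ⬝ᵥ u) = if u = 0 then (m : ℂ) ^ Fintype.card I else 0 := by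
  simp_rw [stdAddChar_dotProduct]
  rw [← Fintype.piFinset_univ, ← Finset.prod_univ_sum (fun _ : I => Finset.univ)
    fun i (x : ZMod m) => ZMod.stdAddChar (x * u i)]
  simp_rw [AddChar.sum_mulShift _ (ZMod.isPrimitive_stdAddChar m), ZMod.card]
  by_cases hu : u = 0
  · simp [hu]
  · rw [if_neg hu]
    obtain ⟨i, hi⟩ := Function.ne_iff.1 hu
    exact Finset.prod_eq_zero (Finset.mem_univ i) (by simp [show u i ≠ 0 from hi])

lemma sum_norm_sq_le {J : Type*} [DecidableEq I] (s : Finset J) {c : J → ℂ}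
    (hc : ∀ j ∈ s, ‖c j‖ ≤ 1) (u : J → I → ZMod m) :
    ∑ h : I → ZMod m, ‖∑ j ∈ s, c j * ZMod.stdAddChar (h ⬝ᵥ u j)‖ ^ 2 ≤
      (m : ℝ) ^ Fintype.card I * ((s ×ˢ s).filter fun p => u p.1 = u p.2).card := by
  have h1 : ((∑ h : I → ZMod m, ‖∑ j ∈ s, c j * ZMod.stdAddChar (h ⬝ᵥ u j)‖ ^ 2 : ℝ) : ℂ) =
      ∑ p ∈ s ×ˢ s, c p.1 * (starRingEnd ℂ) (c p.2) *
        ∑ h : I → ZMod m, ZMod.stdAddChar (h ⬝ᵥ (u p.1 - u p.2)) := by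
    push_cast
    simp_rw [← Complex.mul_conj', map_sum, Finset.sum_mul_sum, ← Finset.sum_product',
      Finset.mul_sum]
    rw [Finset.sum_product_right]
    refine Finset.sum_congr rfl fun p _ => Finset.sum_congr rfl fun h _ => ?_
    rw [map_mul, dotProduct_sub, sub_eq_add_neg, AddChar.map_add_eq_mul,
      AddChar.map_neg_eq_conj]
    ring
  have h2 : 0 ≤ ∑ h : I → ZMod m, ‖∑ j ∈ s, c j * ZMod.stdAddChar (h ⬝ᵥ u j)‖ ^ 2 := by positivity
  rw [← Real.norm_of_nonneg h2, ← Complex.norm_real, h1]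
  refine (norm_sum_le _ _).trans ?_
  rw [Finset.card_filter, Nat.cast_sum, Finset.mul_sum]
  refine Finset.sum_le_sum fun p hp => ?_
  obtain ⟨hp1, hp2⟩ := Finset.mem_product.1 hp
  rw [sum_stdAddChar_dotProduct]
  by_cases h : u p.1 = u p.2
  · simp only [h, sub_self, if_true, norm_mul, RCLike.norm_conj, norm_pow, Complex.norm_natCast,
      Nat.cast_one, mul_one]
    refine mul_le_of_le_one_left (by positivity) ?_
    exact mul_le_one₀ (hc _ hp1) (norm_nonneg _) (hc _ hp2)
  · simp [h, sub_eq_zero]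

lemma le_norm_sum_stdAddChar {P : ℕ} (hP : 6 * P ^ 2 ≤ m) {z : ℤ} (hz : |z| ≤ P) :
    ((P : ℝ) + 1) / 2 ≤
      ‖∑ η ∈ Finset.range (P + 1), ZMod.stdAddChar ((z : ZMod m) * (η : ZMod m))‖ := by
  refine le_trans ?_ ((le_abs_self _).trans (Complex.abs_re_le_norm _))
  rw [Complex.re_sum]
  have hm : (0 : ℝ) < m := by exact_mod_cast Nat.pos_of_ne_zero (NeZero.ne m)
  have h1 : ∀ η ∈ Finset.range (P + 1), (1 / 2 : ℝ) ≤
      (ZMod.stdAddChar ((z : ZMod m) * (η : ZMod m)) : ℂ).re := by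
    intro η hη
    have h2 : ((z : ZMod m) * (η : ZMod m)) = ((z * η : ℤ) : ZMod m) := by push_cast; rfl
    have h3 : (2 * Real.pi * Complex.I * ((z * η : ℤ) : ℂ) / m : ℂ) =
        ((2 * Real.pi * (z * η) / m : ℝ) : ℂ) * Complex.I := by
      push_cast; ring
    rw [h2, ZMod.stdAddChar_coe, h3, Complex.exp_ofReal_mul_I_re, ← Real.cos_abs,
      ← Real.cos_pi_div_three]
    refine Real.cos_le_cos_of_nonneg_of_le_pi (abs_nonneg _) (by linarith [Real.pi_pos]) ?_
    have hz' : |(z : ℝ)| ≤ P := by exact_mod_cast hz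
    have hη' : (η : ℝ) ≤ P := by exact_mod_cast Nat.lt_succ_iff.1 (Finset.mem_range.1 hη)
    have hP' : (6 * P ^ 2 : ℝ) ≤ m := by exact_mod_cast hP
    rw [abs_div, abs_mul, abs_mul, abs_mul, abs_of_pos hm, abs_of_pos Real.pi_pos, abs_two,
      Nat.abs_cast, div_le_iff₀ hm]
    have h4 : |(z : ℝ)| * η ≤ P * P := mul_le_mul hz' hη' (by positivity) (by positivity)
    nlinarith [Real.pi_pos]
  calc ((P : ℝ) + 1) / 2 = (Finset.range (P + 1)).card • (1 / 2 : ℝ) := by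
        rw [Finset.card_range, nsmul_eq_mul]; push_cast; ring
    _ ≤ _ := Finset.card_nsmul_le_sum _ _ _ h1

lemma le_norm_sum_stdAddChar_dotProduct [DecidableEq I] {P : ℕ} (hP : 6 * P ^ 2 ≤ m) {h : I → ℤ}
    (hh : h ∈ intCube I P) :
    (((P : ℝ) + 1) / 2) ^ Fintype.card I ≤
      ‖∑ η ∈ Fintype.piFinset fun _ : I => Finset.range (P + 1),
        ZMod.stdAddChar ((fun i => (h i : ZMod m)) ⬝ᵥ fun i => (η i : ZMod m))‖ := by
  simp_rw [stdAddChar_dotProduct]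
  rw [← Finset.prod_univ_sum (fun _ : I => Finset.range (P + 1))
    (fun i (η : ℕ) => ZMod.stdAddChar ((h i : ZMod m) * (η : ZMod m))), norm_prod]
  rw [← Finset.card_univ, ← Finset.prod_const]
  exact Finset.prod_le_prod (fun _ _ => by positivity)
    fun i _ => le_norm_sum_stdAddChar hP (mem_intCube.1 hh i)

/-- A large sieve inequality for the characters of `(ZMod m) ^ I`. -/
lemma large_sieve [DecidableEq I] {P : ℕ} (hP : 6 * P ^ 2 ≤ m) {J : Type*} (s : Finset J)
    {c : J → ℂ} (hc : ∀ j ∈ s, ‖c j‖ ≤ 1) (g : J → I → ZMod m) {M : ℕ}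
    (hM : ∀ s' ⊆ s ×ˢ s, (∀ p ∈ s', ∀ i, ∃ z : ℤ, |z| ≤ P ∧ g p.1 i - g p.2 i = z) →
      s'.card ≤ M) :
    ((P : ℝ) + 1) ^ Fintype.card I *
      ∑ h ∈ intCube I P, ‖∑ j ∈ s, c j * ZMod.stdAddChar ((fun i => (h i : ZMod m)) ⬝ᵥ g j)‖ ^ 2 ≤
      (4 * m : ℝ) ^ Fintype.card I * M := by
  classical
  have hm : 0 < m := Nat.pos_of_ne_zero (NeZero.ne m)
  have hPm : 2 * P < m := by
    rcases Nat.eq_zero_or_pos P with rfl | h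
    · simpa using hm
    · nlinarith
  set Ξ := Fintype.piFinset fun _ : I => Finset.range (P + 1)
  let S : (I → ZMod m) → ℂ := fun h => ∑ j ∈ s, c j * ZMod.stdAddChar (h ⬝ᵥ g j)
  let E : (I → ZMod m) → ℂ := fun h => ∑ η ∈ Ξ, ZMod.stdAddChar (h ⬝ᵥ fun i => (η i : ZMod m))
  let u : J × (I → ℕ) → I → ZMod m := fun q => g q.1 + fun i => (q.2 i : ZMod m)
  have hSE : ∀ h, S h * E h = ∑ q ∈ s ×ˢ Ξ, c q.1 * ZMod.stdAddChar (h ⬝ᵥ u q) := by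
    intro h
    simp only [S, E, Finset.sum_mul_sum, ← Finset.sum_product']
    refine Finset.sum_congr rfl fun q _ => ?_
    rw [dotProduct_add, AddChar.map_add_eq_mul, mul_assoc]
  have h1 : (((P : ℝ) + 1) / 2) ^ (2 * Fintype.card I) *
      ∑ h ∈ intCube I P, ‖S fun i => (h i : ZMod m)‖ ^ 2 ≤ ∑ h, ‖S h * E h‖ ^ 2 := by
    rw [Finset.mul_sum]
    refine le_trans (Finset.sum_le_sum (g := fun h : I → ℤ =>
      ‖S (fun i => (h i : ZMod m)) * E (fun i => (h i : ZMod m))‖ ^ 2) fun h hh => ?_) ?_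
    · rw [norm_mul, mul_pow, mul_comm, mul_comm 2, pow_mul]
      refine mul_le_mul_of_nonneg_left ?_ (by positivity)
      exact pow_le_pow_left₀ (by positivity) (le_norm_sum_stdAddChar_dotProduct hP hh) 2
    · rw [← Finset.sum_image (f := fun h => ‖S h * E h‖ ^ 2) (intCast_injOn_intCube hPm)]
      exact Finset.sum_le_univ_sum_of_nonneg fun _ => by positivity
  have h2 : ∑ h, ‖S h * E h‖ ^ 2 ≤ (m : ℝ) ^ Fintype.card I *
      (((P : ℝ) + 1) ^ Fintype.card I * M) := by
    simp_rw [hSE]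
    refine (sum_norm_sq_le (s ×ˢ Ξ) (fun q hq => hc _ (Finset.mem_product.1 hq).1) u).trans ?_
    refine mul_le_mul_of_nonneg_left ?_ (by positivity)
    set A := ((s ×ˢ Ξ) ×ˢ (s ×ˢ Ξ)).filter fun p => u p.1 = u p.2
    let s' := A.image fun p => (p.1.1, p.2.1)
    have hs' : s'.card ≤ M := by
      refine hM s' ?_ ?_
      · intro p hp
        obtain ⟨q, hq, rfl⟩ := Finset.mem_image.1 hp
        simp only [A, Finset.mem_filter, Finset.mem_product] at hq ⊢
        exact ⟨hq.1.1.1, hq.1.2.1⟩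
      · intro p hp i
        obtain ⟨q, hq, rfl⟩ := Finset.mem_image.1 hp
        simp only [A, Ξ, Finset.mem_filter, Finset.mem_product, Fintype.mem_piFinset,
          Finset.mem_range] at hq
        refine ⟨q.2.2 i - q.1.2 i, ?_, ?_⟩
        · have := hq.1.1.2 i
          have := hq.1.2.2 i
          rw [abs_le]
          omega
        · have := congrFun hq.2 i
          simp only [u, Pi.add_apply] at this
          push_cast
          linear_combination this
    have hA : A.card ≤ s'.card * Ξ.card := by
      rw [← Finset.card_product]
      refine Finset.card_le_card_of_injOn (fun p => ((p.1.1, p.2.1), p.1.2)) ?_ ?_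
      · intro p hp
        have hp' := hp
        simp only [A, Finset.coe_filter, Set.mem_ofPred_eq, Finset.mem_product] at hp'
        exact Finset.mem_coe.2 (Finset.mem_product.2
          ⟨Finset.mem_image_of_mem (fun p : (J × (I → ℕ)) × (J × (I → ℕ)) => (p.1.1, p.2.1)) hp,
            hp'.1.1.2⟩)
      · rintro ⟨⟨a, η⟩, b, θ⟩ hp ⟨⟨a', η'⟩, b', θ'⟩ hq h
        simp only [Prod.mk.injEq] at h
        obtain ⟨⟨rfl, rfl⟩, rfl⟩ := h
        simp only [A, Ξ, Finset.coe_filter, Set.mem_ofPred_eq, Finset.mem_product,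
          Fintype.mem_piFinset, Finset.mem_range] at hp hq
        have h3 := hp.2.symm.trans hq.2
        have h4 : θ = θ' := by
          funext i
          have h5 := congrFun h3 i
          simp only [u, Pi.add_apply, add_right_inj] at h5
          have h6 := (ZMod.natCast_eq_natCast_iff' _ _ _).1 h5
          have := hp.1.2.2 i
          have := hq.1.2.2 i
          rwa [Nat.mod_eq_of_lt (by omega), Nat.mod_eq_of_lt (by omega)] at h6
        rw [h4]
    have hΞ : Ξ.card = (P + 1) ^ Fintype.card I := by simp [Ξ]
    rw [hΞ] at hA
    have : A.card ≤ (P + 1) ^ Fintype.card I * M :=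
      hA.trans (by rw [mul_comm]; exact Nat.mul_le_mul_left _ hs')
    exact_mod_cast this
  have h3 := h1.trans h2
  have h4 : (((P : ℝ) + 1) / 2) ^ (2 * Fintype.card I) =
      (((P : ℝ) + 1) ^ Fintype.card I) * ((P : ℝ) + 1) ^ Fintype.card I / 4 ^ Fintype.card I := by
    rw [two_mul, pow_add, div_pow, div_mul_div_comm, ← mul_pow 2 2]
    norm_num
  rw [h4] at h3
  have h5 : 0 < ((P : ℝ) + 1) ^ Fintype.card I := by positivity
  have h6 : (0 : ℝ) < 4 ^ Fintype.card I := by positivity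
  rw [div_mul_eq_mul_div, div_le_iff₀ h6] at h3
  refine le_of_mul_le_mul_left ?_ h5
  calc _ = _ := ?_
    _ ≤ _ := h3
    _ = _ := ?_
  · simp only [S]; ring
  · rw [mul_pow]; ring

end LargeSieve

section Frame

/-- A commutative ring, free of finite rank over `ℤ`, with a family of real embeddings, a trace
functional and the integral multiple `Δ` of the dual of a basis, with a common size bound. -/
structure TraceFrame (O ι W : Type*) [CommRing O] [Fintype ι] [Fintype W] where
  basis : Module.Basis ι ℤ O
  σ : W → O →+* ℝ
  discrete : IsDiscreteFamily σ
  card_eq : Fintype.card ι = Fintype.card W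
  tr : O →+ ℤ
  tr_eq : ∀ x, (tr x : ℝ) = ∑ w, σ w x
  dual : ι → O
  Δ : ℕ
  Δ_pos : 0 < Δ
  tr_dual_mul : ∀ i x, tr (dual i * x) = Δ * basis.repr x i
  sum_tr_mul_dual : ∀ x, ∑ i, (tr (x * basis i) : O) * dual i = Δ * x
  bound : ℝ
  one_le_bound : 1 ≤ bound
  abs_basis_le : ∀ w i, |σ w (basis i)| ≤ bound
  abs_dual_le : ∀ w i, |σ w (dual i)| ≤ bound
  abs_repr_le : ∀ x M, (∀ w, |σ w x| ≤ M) → ∀ i, |(basis.repr x i : ℝ)| ≤ bound * M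

/-- The elements with a good rational approximation of small denominator. -/
def IsMajor {O W : Type*} [CommRing O] (σ : W → O →+* ℝ) (m : ℕ) (Y : ℝ) (ξ : O) : Prop :=
  ∃ l, l ≠ 0 ∧ (∀ w, |σ w l| ≤ Y) ∧ ∃ k : O, ∀ w, |σ w (ξ * l - m * k)| ≤ Y

namespace TraceFrame

variable {O ι W κ : Type*} [CommRing O] [Fintype ι] [Fintype W]
  (F : TraceFrame O ι W)

lemma abs_sum_mul_le {c : ι → ℝ} {M : ℝ} (hc : ∀ i, |c i| ≤ M) {f : ι → O}
    (hf : ∀ w i, |F.σ w (f i)| ≤ F.bound) (w : W) :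
    |∑ i, c i * F.σ w (f i)| ≤ Fintype.card ι * F.bound * M := by
  refine (Finset.abs_sum_le_sum_abs _ _).trans ?_
  refine (Finset.sum_le_card_nsmul _ _ (M * F.bound) fun i _ => ?_).trans_eq ?_
  · rw [abs_mul]
    exact mul_le_mul (hc i) (hf w i) (abs_nonneg _) ((abs_nonneg _).trans (hc i))
  · rw [Finset.card_univ, nsmul_eq_mul]; ring

/-- The element with prescribed coordinates. -/
noncomputable def ofCoord (h : ι → ℤ) : O := ∑ i, (h i : O) * F.basis i

lemma ofCoord_eq (h : ι → ℤ) : F.ofCoord h = F.basis.equivFun.symm h := by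
  simp [ofCoord, Module.Basis.equivFun_symm_apply]

lemma repr_ofCoord (h : ι → ℤ) (i : ι) : F.basis.repr (F.ofCoord h) i = h i := by
  rw [ofCoord_eq, ← F.basis.equivFun_apply, LinearEquiv.apply_symm_apply]

lemma ofCoord_repr (x : O) : F.ofCoord (fun i => F.basis.repr x i) = x := by
  rw [ofCoord_eq]
  exact F.basis.equivFun.symm_apply_apply x

lemma ofCoord_injective : Function.Injective F.ofCoord := fun h h' H =>
  funext fun i => by rw [← F.repr_ofCoord h, H, F.repr_ofCoord]

lemma ofCoord_sub (h h' : ι → ℤ) : F.ofCoord (h - h') = F.ofCoord h - F.ofCoord h' := by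
  simp [ofCoord, sub_mul, Finset.sum_sub_distrib]

lemma abs_ofCoord_le {h : ι → ℤ} {M : ℝ} (hh : ∀ i, |(h i : ℝ)| ≤ M) (w : W) :
    |F.σ w (F.ofCoord h)| ≤ Fintype.card ι * F.bound * M := by
  simpa [ofCoord] using F.abs_sum_mul_le hh F.abs_basis_le w

/-- The vector with prescribed coordinates. -/
noncomputable def vec (h : κ × ι → ℤ) (k : κ) : O := F.ofCoord fun i => h (k, i)

lemma vec_injective : Function.Injective (F.vec (κ := κ)) := fun _ _ H =>
  funext fun p => congrFun (F.ofCoord_injective (congrFun H p.1)) p.2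

lemma vec_sub (h h' : κ × ι → ℤ) : F.vec (h - h') = F.vec h - F.vec h' :=
  funext fun _ => F.ofCoord_sub _ _

/-- The lift to `O` of a character modulo `m`. -/
noncomputable def lift {m : ℕ} (a : ι → ZMod m) : O := ∑ i, ((a i).val : O) * F.dual i

lemma tr_lift_mul {m : ℕ} (a : ι → ZMod m) (x : O) :
    F.tr (F.lift a * x) = F.Δ * ∑ i, (a i).val * F.basis.repr x i := by
  rw [lift, Finset.sum_mul, map_sum, Finset.mul_sum]
  refine Finset.sum_congr rfl fun i _ => ?_
  rw [mul_assoc, ← nsmul_eq_mul, map_nsmul, F.tr_dual_mul, nsmul_eq_mul]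
  ring

lemma lift_injective [DecidableEq ι] {m : ℕ} [NeZero m] :
    Function.Injective (F.lift (m := m)) := by
  intro a b hab
  funext i
  have h := F.tr_lift_mul a (F.basis i)
  rw [hab, F.tr_lift_mul b] at h
  have h' := mul_left_cancel₀ (Nat.cast_ne_zero.2 F.Δ_pos.ne') h
  simp only [Module.Basis.repr_self, Finsupp.single_apply, mul_ite, mul_one, mul_zero,
    Finset.sum_ite_eq, Finset.mem_univ, if_true] at h'
  exact (ZMod.val_injective m (by exact_mod_cast h')).symm

lemma abs_lift_le {m : ℕ} [NeZero m] (a : ι → ZMod m) (w : W) :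
    |F.σ w (F.lift a)| ≤ Fintype.card ι * F.bound * m := by
  simp only [lift, map_sum, map_mul, map_natCast]
  exact F.abs_sum_mul_le (fun i => by rw [Nat.abs_cast]; exact_mod_cast (ZMod.val_lt _).le)
    F.abs_dual_le w

/-- The additive character of `O` modulo `m` with given frequencies. -/
noncomputable def chr {m : ℕ} [NeZero m] (a : ι → ZMod m) (x : O) : ℂ :=
  ZMod.stdAddChar (a ⬝ᵥ fun i => (F.basis.repr x i : ZMod m))

section chr

variable {m : ℕ} [NeZero m]

lemma chr_add (a : ι → ZMod m) (x y : O) : F.chr a (x + y) = F.chr a x * F.chr a y := by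
  rw [chr, chr, chr, ← AddChar.map_add_eq_mul, ← dotProduct_add]
  congr 2
  funext i
  simp

lemma norm_chr (a : ι → ZMod m) (x : O) : ‖F.chr a x‖ = 1 := AddChar.norm_apply _ _

lemma sum_chr_eq_zero [DecidableEq ι] {x : O} (hx : x ≠ 0)
    (hm : ∀ i, |F.basis.repr x i| < m) : ∑ a : ι → ZMod m, F.chr a x = 0 := by
  refine (sum_stdAddChar_dotProduct _).trans (if_neg fun h => hx ?_)
  have h0 : ∀ i, F.basis.repr x i = 0 := fun i =>
    Int.eq_zero_of_abs_lt_dvd ((ZMod.intCast_zmod_eq_zero_iff_dvd _ _).1 (congrFun h i)) (hm i)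
  exact F.basis.repr.map_eq_zero_iff.1 (Finsupp.ext h0)

lemma sum_chr_zero [DecidableEq ι] :
    ∑ a : ι → ZMod m, F.chr a 0 = (m : ℂ) ^ Fintype.card ι := by
  refine (sum_stdAddChar_dotProduct _).trans (if_pos ?_)
  funext i
  simp

lemma chr_vec_dotProduct [Fintype κ] (a : ι → ZMod m) (h : κ × ι → ℤ) (y : κ → O) :
    F.chr a (F.vec h ⬝ᵥ y) = ZMod.stdAddChar ((fun p => (h p : ZMod m)) ⬝ᵥ
      fun p : κ × ι => a ⬝ᵥ fun i => (F.basis.repr (F.basis p.2 * y p.1) i : ZMod m)) := by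
  rw [chr]
  congr 1
  have h1 : ∀ i, F.basis.repr (F.vec h ⬝ᵥ y) i =
      ∑ p : κ × ι, h p * F.basis.repr (F.basis p.2 * y p.1) i := by
    intro i
    rw [dotProduct, map_sum, Finsupp.finsetSum_apply, Fintype.sum_prod_type]
    refine Finset.sum_congr rfl fun k _ => ?_
    rw [vec, ofCoord, Finset.sum_mul, map_sum, Finsupp.finsetSum_apply]
    refine Finset.sum_congr rfl fun j _ => ?_
    rw [mul_assoc, ← zsmul_eq_mul, map_zsmul]
    rfl
  simp_rw [h1]
  simp only [dotProduct]
  push_cast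
  simp only [Finset.mul_sum]
  rw [Finset.sum_comm]
  exact Finset.sum_congr rfl fun p _ => Finset.sum_congr rfl fun i _ => by ring

end chr

/-- If every frequency of the character `x ↦ chr a (l x)` is small, then `l` lies in the
approximate kernel of the lift of `a`. -/
lemma mem_approxKernel [IsDomain O] [CharZero O] {m P : ℕ} [NeZero m] {X : ℝ}
    (hX : Fintype.card ι * F.bound ≤ X) (a : ι → ZMod m) {l : O}
    (hl : ∀ w, |F.σ w l| ≤ X * P)
    (hz : ∀ j, ∃ z : ℤ, |z| ≤ P ∧
      a ⬝ᵥ (fun i => (F.basis.repr (F.basis j * l) i : ZMod m)) = z) :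
    l ∈ approxKernel F.σ m (X * P) (F.lift a) := by
  refine ⟨hl, ?_⟩
  choose z hzP hz using hz
  have h1 : ∀ j, (m : ℤ) ∣ ∑ i, (a i).val * F.basis.repr (F.basis j * l) i - z j := by
    intro j
    rw [← ZMod.intCast_zmod_eq_zero_iff_dvd, Int.cast_sub, ← hz, sub_eq_zero]
    push_cast
    simp [dotProduct]
  choose k hk using h1
  refine ⟨∑ j, (k j : O) * F.dual j, fun w => ?_⟩
  have h2 : F.lift a * l - m * ∑ j, (k j : O) * F.dual j = ∑ j, (z j : O) * F.dual j := by
    have hΔ : (F.Δ : O) ≠ 0 := Nat.cast_ne_zero.2 F.Δ_pos.ne'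
    refine mul_left_cancel₀ hΔ ?_
    rw [mul_sub, ← F.sum_tr_mul_dual, Finset.mul_sum, Finset.mul_sum, Finset.mul_sum,
      ← Finset.sum_sub_distrib]
    refine Finset.sum_congr rfl fun j _ => ?_
    have h3 := F.tr_lift_mul a (F.basis j * l)
    rw [sub_eq_iff_eq_add.1 (hk j)] at h3
    rw [mul_assoc, mul_comm l, h3]
    push_cast
    ring
  rw [h2]
  have h4 := F.abs_sum_mul_le (c := fun j => (z j : ℝ)) (M := P)
    (fun j => by exact_mod_cast hzP j) F.abs_dual_le w
  have h5 : F.σ w (∑ j, (z j : O) * F.dual j) = ∑ j, (z j : ℝ) * F.σ w (F.dual j) := by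
    simp
  rw [h5]
  exact h4.trans (mul_le_mul_of_nonneg_right hX (Nat.cast_nonneg _))

end TraceFrame

end Frame

section ExpSum

namespace TraceFrame

variable {O ι W κ : Type*} [CommRing O] [Fintype ι] [Fintype W] [Fintype κ]
  [DecidableEq ι] [DecidableEq κ] (F : TraceFrame O ι W) {m : ℕ} [NeZero m]

/-- The exponential sum attached to a quadratic form and a character. -/
noncomputable def expSum (C : Matrix κ κ O) (P : ℕ) (a : ι → ZMod m) : ℂ :=
  ∑ q ∈ intCube (κ × ι) P ×ˢ intCube (κ × ι) P, F.chr a (qf C (F.vec q.1 + F.vec q.2))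

lemma norm_expSum_sq_le (C : Matrix κ κ O) {P : ℕ} (hP : 6 * P ^ 2 ≤ m) (a : ι → ZMod m) {M : ℕ}
    (hM : ∀ s' ⊆ intCube (κ × ι) P ×ˢ intCube (κ × ι) P,
      (∀ p ∈ s', ∀ i : κ × ι, ∃ z : ℤ, |z| ≤ P ∧
        (a ⬝ᵥ fun j =>
          (F.basis.repr (F.basis i.2 * ((C + Cᵀ) *ᵥ F.vec (p.1 - p.2)) i.1) j : ZMod m))
          = z) → s'.card ≤ M) :
    ((P : ℝ) + 1) ^ Fintype.card (κ × ι) * ‖F.expSum C P a‖ ^ 2 ≤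
      (intCube (κ × ι) P).card * ((4 * m : ℝ) ^ Fintype.card (κ × ι) * M) := by
  set Q := intCube (κ × ι) P
  let g : (κ × ι → ℤ) → κ × ι → ZMod m := fun k i =>
    a ⬝ᵥ fun j => (F.basis.repr (F.basis i.2 * ((C + Cᵀ) *ᵥ F.vec k) i.1) j : ZMod m)
  have hg : ∀ k k' i, g k i - g k' i =
      a ⬝ᵥ fun j => (F.basis.repr (F.basis i.2 * ((C + Cᵀ) *ᵥ F.vec (k - k')) i.1) j : ZMod m) := by
    intro k k' i
    simp only [g]
    rw [← dotProduct_sub, F.vec_sub, Matrix.mulVec_sub, Pi.sub_apply, mul_sub, map_sub]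
    congr 1
    funext j
    simp
  let E : (κ × ι → ℤ) → ℂ := fun h => ∑ k ∈ Q, F.chr a (qf C (F.vec k)) *
    ZMod.stdAddChar ((fun i => (h i : ZMod m)) ⬝ᵥ g k)
  have h1 : F.expSum C P a = ∑ h ∈ Q, F.chr a (qf C (F.vec h)) * E h := by
    rw [expSum, Finset.sum_product]
    refine Finset.sum_congr rfl fun h _ => ?_
    rw [Finset.mul_sum]
    refine Finset.sum_congr rfl fun k _ => ?_
    rw [qf_add, F.chr_add, F.chr_add, F.chr_vec_dotProduct, mul_assoc]
  have h2 : ‖F.expSum C P a‖ ^ 2 ≤ Q.card * ∑ h ∈ Q, ‖E h‖ ^ 2 := by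
    refine le_trans (pow_le_pow_left₀ (norm_nonneg _) (b := ∑ h ∈ Q, ‖E h‖) ?_ 2)
      sq_sum_le_card_mul_sum_sq
    rw [h1]
    refine (norm_sum_le _ _).trans_eq (Finset.sum_congr rfl fun h _ => ?_)
    rw [norm_mul, F.norm_chr, one_mul]
  have h3 := large_sieve hP Q (c := fun k => F.chr a (qf C (F.vec k)))
    (fun k _ => (F.norm_chr _ _).le) g (M := M) fun s' hs' h => hM s' hs' fun p hp i => by
      obtain ⟨z, hz, hz'⟩ := h p hp i
      exact ⟨z, hz, by rw [← hg, hz']⟩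
  calc _ ≤ ((P : ℝ) + 1) ^ Fintype.card (κ × ι) * (Q.card * ∑ h ∈ Q, ‖E h‖ ^ 2) := by gcongr
    _ = Q.card * (((P : ℝ) + 1) ^ Fintype.card (κ × ι) * ∑ h ∈ Q, ‖E h‖ ^ 2) := by ring
    _ ≤ _ := by gcongr

lemma card_pairs_le [IsDomain O] [CharZero O] [Nonempty W] {C : Matrix κ κ O}
    (hC : (C + Cᵀ).det ≠ 0) {X : ℝ} (hX : 0 < X) (hX1 : Fintype.card ι * F.bound ≤ X)
    (hX2 : ∀ w k, 2 * (Fintype.card ι * F.bound) * ∑ i, |F.σ w ((C + Cᵀ) k i)| ≤ X)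
    {P : ℕ} (hP : 0 < P) (hm : 2 * (X * P) ^ 2 < m) {t : ℕ} (ht : 0 < t) (a : ι → ZMod m)
    (ha : ¬ IsMajor F.σ m (2 * (X * P) / t) (F.lift a))
    (s : Finset ((κ × ι → ℤ) × (κ × ι → ℤ)))
    (hs : s ⊆ intCube (κ × ι) P ×ˢ intCube (κ × ι) P)
    (hs' : ∀ p ∈ s, ∀ i : κ × ι, ∃ z : ℤ, |z| ≤ P ∧
        (a ⬝ᵥ fun j =>
          (F.basis.repr (F.basis i.2 * ((C + Cᵀ) *ᵥ F.vec (p.1 - p.2)) i.1) j : ZMod m))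
          = z) :
    s.card ≤ (intCube (κ × ι) P).card * (t + 1) ^ Fintype.card (κ × ι) := by
  classical
  have hP0 : (0 : ℝ) < P := by exact_mod_cast hP
  let L : (κ × ι → ℤ) × (κ × ι → ℤ) → κ → O := fun p => (C + Cᵀ) *ᵥ F.vec (p.1 - p.2)
  let A : Finset O := (s ×ˢ Finset.univ).image fun q : _ × κ => L q.1 q.2
  have hA : A.card ≤ (t + 1) ^ Fintype.card W := by
    by_contra! hlt
    refine ha (F.discrete.exists_small_of_card_lt (by positivity) hm (fun l hl => ?_) ht hlt)
    obtain ⟨⟨p, k⟩, hpk, rfl⟩ := Finset.mem_image.1 hl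
    have hp := (Finset.mem_product.1 hpk).1
    refine F.mem_approxKernel hX1 a (fun w => ?_) fun j => hs' p hp (k, j)
    obtain ⟨hp1, hp2⟩ := Finset.mem_product.1 (hs hp)
    have h1 : ∀ i, |F.σ w (F.vec (p.1 - p.2) i)| ≤ Fintype.card ι * F.bound * (2 * P) := by
      intro i
      refine F.abs_ofCoord_le (fun j => ?_) w
      have h2 := mem_intCube.1 hp1 (i, j)
      have h3 := mem_intCube.1 hp2 (i, j)
      have h4 := abs_sub (p.1 (i, j)) (p.2 (i, j))
      have h5 : |(p.1 - p.2) (i, j)| ≤ 2 * (P : ℤ) := by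
        rw [Pi.sub_apply]; linarith
      exact_mod_cast h5
    simp only [L, Matrix.mulVec, dotProduct, map_sum, map_mul]
    calc |∑ i, F.σ w ((C + Cᵀ) k i) * F.σ w (F.vec (p.1 - p.2) i)|
        ≤ ∑ i, |F.σ w ((C + Cᵀ) k i)| * (Fintype.card ι * F.bound * (2 * P)) := by
          refine (Finset.abs_sum_le_sum_abs _ _).trans (Finset.sum_le_sum fun i _ => ?_)
          rw [abs_mul]
          exact mul_le_mul_of_nonneg_left (h1 i) (abs_nonneg _)
      _ = (2 * (Fintype.card ι * F.bound) * ∑ i, |F.σ w ((C + Cᵀ) k i)|) * P := by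
          rw [← Finset.sum_mul]; ring
      _ ≤ X * P := mul_le_mul_of_nonneg_right (hX2 w k) hP0.le
  have hcard : s.card ≤ (intCube (κ × ι) P ×ˢ Fintype.piFinset fun _ : κ => A).card := by
    refine Finset.card_le_card_of_injOn (fun p => (p.1, L p)) ?_ ?_
    · intro p hp
      refine Finset.mem_coe.2 (Finset.mem_product.2 ⟨(Finset.mem_product.1 (hs hp)).1,
        Fintype.mem_piFinset.2 fun k => ?_⟩)
      exact Finset.mem_image.2 ⟨(p, k), Finset.mem_product.2 ⟨hp, Finset.mem_univ _⟩, rfl⟩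
    · rintro ⟨h, k⟩ _ ⟨h', k'⟩ _ heq
      simp only [Prod.mk.injEq, L] at heq
      obtain ⟨rfl, heq⟩ := heq
      have h0 := Matrix.eq_zero_of_mulVec_eq_zero hC
        (by rw [Matrix.mulVec_sub]; exact sub_eq_zero.2 heq)
      have h1 := F.vec_injective (sub_eq_zero.1 h0)
      rw [sub_right_inj.1 h1]
  refine hcard.trans ?_
  rw [Finset.card_product, Fintype.card_piFinset, Finset.prod_const, Finset.card_univ]
  refine Nat.mul_le_mul_left _ ((Nat.pow_le_pow_left hA _).trans_eq ?_)
  rw [← pow_mul, Fintype.card_prod, F.card_eq, mul_comm]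

lemma card_intCube (I : Type*) [Fintype I] [DecidableEq I] (P : ℕ) :
    (intCube I P).card = (2 * P + 1) ^ Fintype.card I := by
  simp only [intCube, Fintype.card_piFinset, Int.card_Icc, Finset.prod_const, Finset.card_univ]
  congr 1
  omega

lemma norm_expSum_le_of_not_isMajor [IsDomain O] [CharZero O] [Nonempty W] {C : Matrix κ κ O}
    (hC : (C + Cᵀ).det ≠ 0) {X : ℝ} (hX : 0 < X) (hX1 : Fintype.card ι * F.bound ≤ X)
    (hX2 : ∀ w k, 2 * (Fintype.card ι * F.bound) * ∑ i, |F.σ w ((C + Cᵀ) k i)| ≤ X)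
    {P M₀ p t : ℕ} (hM₀ : 6 ≤ M₀) (hXM : 2 * X ^ 2 < M₀) (hPp : P = p ^ 2) (hp : 0 < p)
    (hm : m = M₀ * P ^ 2) (ht : 0 < t) (a : ι → ZMod m)
    (ha : ¬ IsMajor F.σ m (2 * (X * P) / (t ^ 2 : ℕ)) (F.lift a)) :
    ‖F.expSum C P a‖ ≤ (64 * M₀ * p ^ 3 * t : ℝ) ^ Fintype.card (κ × ι) := by
  have hP : 0 < P := by rw [hPp]; positivity
  have hP1 : (1 : ℝ) ≤ P := by exact_mod_cast hP
  have ht1 : (1 : ℝ) ≤ t := by exact_mod_cast ht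
  have hM1 : (6 : ℝ) ≤ M₀ := by exact_mod_cast hM₀
  have hm6 : 6 * P ^ 2 ≤ m := by rw [hm]; exact Nat.mul_le_mul_right _ hM₀
  have hmX : 2 * (X * P) ^ 2 < m := by
    rw [hm]; push_cast
    have : (0 : ℝ) < P ^ 2 := by positivity
    nlinarith
  have h := F.norm_expSum_sq_le C hm6 a
    (F.card_pairs_le hC hX hX1 hX2 hP hmX (pow_pos ht 2) a ha)
  set I := Fintype.card (κ × ι)
  rw [card_intCube] at h
  push_cast at h
  have h0 : (0 : ℝ) < ((P : ℝ) + 1) ^ I := by positivity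
  rw [← mul_pow, ← mul_pow, ← mul_pow] at h
  refine le_of_sq_le_sq (le_of_mul_le_mul_left (h.trans ?_) h0) (by positivity)
  rw [← pow_mul, mul_comm I 2, pow_mul, ← mul_pow]
  refine pow_le_pow_left₀ (by positivity) ?_ _
  have hPr : (P : ℝ) = p ^ 2 := by rw [hPp]; push_cast; rfl
  have hmr : (m : ℝ) = M₀ * P ^ 2 := by rw [hm]; push_cast; rfl
  rw [hmr]
  have h5 : (64 * M₀ * p ^ 3 * t : ℝ) ^ 2 = 4096 * M₀ ^ 2 * P ^ 3 * t ^ 2 := by rw [hPr]; ring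
  rw [h5]
  have h6 : (2 * (P : ℝ) + 1) ≤ 2 * (P + 1) := by linarith
  have h7 : (t : ℝ) ^ 2 + 1 ≤ 2 * t ^ 2 := by nlinarith
  have h8 : 4 * (M₀ * (P : ℝ) ^ 2) * ((2 * P + 1) * (t ^ 2 + 1)) ≤
      4 * (M₀ * (P : ℝ) ^ 2) * ((2 * (2 * P)) * (2 * t ^ 2)) := by
    gcongr
    linarith
  have h9 : 64 * M₀ * (P : ℝ) ^ 3 * t ^ 2 ≤ 4096 * M₀ ^ 2 * (P : ℝ) ^ 3 * t ^ 2 := by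
    gcongr
    · norm_num
    · nlinarith
  calc (2 * (P : ℝ) + 1) * (4 * (M₀ * (P : ℝ) ^ 2) * ((2 * P + 1) * (t ^ 2 + 1)))
      ≤ (2 * ((P : ℝ) + 1)) * (4 * (M₀ * (P : ℝ) ^ 2) * ((2 * (2 * P)) * (2 * t ^ 2))) :=
        mul_le_mul h6 h8 (by positivity) (by positivity)
    _ = ((P : ℝ) + 1) * (64 * M₀ * (P : ℝ) ^ 3 * t ^ 2) := by ring
    _ ≤ ((P : ℝ) + 1) * (4096 * M₀ ^ 2 * (P : ℝ) ^ 3 * t ^ 2) := by gcongr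

end TraceFrame

end ExpSum

section Telescope

namespace TraceFrame

variable {O ι W κ : Type*} [CommRing O] [Fintype ι] [Fintype W] [Nonempty W] [Fintype κ]
  (F : TraceFrame O ι W)

lemma one_le_card_mul_bound : 1 ≤ Fintype.card ι * F.bound := by
  have h1 : (1 : ℝ) ≤ Fintype.card ι := by
    rw [F.card_eq]; exact_mod_cast Fintype.card_pos
  nlinarith [F.one_le_bound]

/-- The constant in the bound for the number of major characters. -/
noncomputable def majorConst : ℝ :=
  125 * (Fintype.card ι * F.bound * (Fintype.card ι * F.bound + 1))

lemma majorConst_pos : 0 < F.majorConst := by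
  have := F.one_le_card_mul_bound
  unfold majorConst
  positivity

variable [DecidableEq ι]

open Classical in
lemma card_isMajor_le {m : ℕ} [NeZero m] (Y : ℝ) :
    ((Finset.univ.filter fun a : ι → ZMod m => IsMajor F.σ m Y (F.lift a)).card : ℝ) ≤
      (F.majorConst * Y ^ 2) ^ Fintype.card W := by
  have hc := F.one_le_card_mul_bound
  have hm : 0 < m := Nat.pos_of_ne_zero (NeZero.ne m)
  rcases lt_or_ge Y 1 with hY | hY
  · rw [Finset.filter_eq_empty_iff.2, Finset.card_empty, Nat.cast_zero]
    · have := F.majorConst_pos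
      positivity
    · rintro a - ⟨l, hl, hlY, -⟩
      have hY0 : 0 ≤ Y := (abs_nonneg _).trans (hlY (Classical.arbitrary W))
      refine hl (F.discrete.eq_zero hlY ?_)
      rw [Finset.prod_const, Finset.card_univ]
      exact pow_lt_one₀ hY0 hY Fintype.card_ne_zero
  · rw [← Finset.card_image_of_injective _ F.lift_injective]
    refine F.discrete.card_approx_le hm hc hY ?_ ?_
    · intro ξ hξ w
      obtain ⟨a, -, rfl⟩ := Finset.mem_image.1 hξ
      exact F.abs_lift_le a w
    · intro ξ hξ
      obtain ⟨a, ha, rfl⟩ := Finset.mem_image.1 hξ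
      exact (Finset.mem_filter.1 ha).2

variable [IsDomain O] [CharZero O] [DecidableEq κ]

/-- Admissible parameters for the circle method. -/
structure IsAdmissible (C : Matrix κ κ O) (X : ℝ) (M₀ : ℕ) : Prop where
  det_ne_zero : (C + Cᵀ).det ≠ 0
  pos : 0 < X
  bound_le : Fintype.card ι * F.bound ≤ X
  sum_le : ∀ w k, 2 * (Fintype.card ι * F.bound) * ∑ i, |F.σ w ((C + Cᵀ) k i)| ≤ X
  six_le : 6 ≤ M₀
  lt : 2 * X ^ 2 < M₀

/-- The major characters at level `J`. -/
def majorAt (X : ℝ) (i J : ℕ) {m : ℕ} (a : ι → ZMod m) : Prop :=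
  IsMajor F.σ m (2 * (X * (4 ^ i : ℕ)) / ((2 ^ J) ^ 2 : ℕ)) (F.lift a)

/-- The constant in the bound for the contribution of the minor characters. -/
noncomputable def minorConst (_C : Matrix κ κ O) (X : ℝ) (M₀ : ℕ) : ℝ :=
  max ((M₀ : ℝ) * (64 * M₀) ^ Fintype.card κ)
    (F.majorConst * (4 * X ^ 2) * (128 * M₀) ^ Fintype.card κ) ^ Fintype.card W

open Classical in
lemma sum_not_majorAt_le {C : Matrix κ κ O} {X : ℝ} {M₀ : ℕ} (hF : F.IsAdmissible C X M₀)
    (hn : 5 ≤ Fintype.card κ) {i m : ℕ} [NeZero m] (hm : m = M₀ * (4 ^ i) ^ 2) (J : ℕ) :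
    ∑ a : ι → ZMod m with ¬ F.majorAt X i J a, ‖F.expSum C (4 ^ i) a‖ ≤
      F.minorConst C X M₀ *
        (((4 : ℝ) ^ i) ^ 2 * ((2 ^ i) ^ 3) ^ Fintype.card κ) ^ Fintype.card W *
        ((2 ^ (Fintype.card κ - 4)) ^ Fintype.card W) ^ J := by
  set n := Fintype.card κ
  set D := Fintype.card W with hD
  have hD0 : D ≠ 0 := Fintype.card_ne_zero
  have hcard : Fintype.card (κ × ι) = n * D := by rw [Fintype.card_prod, F.card_eq]
  have hK1 : ((M₀ : ℝ) * (64 * M₀) ^ n) ^ D ≤ F.minorConst C X M₀ :=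
    pow_le_pow_left₀ (by positivity) (le_max_left _ _) D
  have hK2 : (F.majorConst * (4 * X ^ 2) * (128 * M₀) ^ n) ^ D ≤ F.minorConst C X M₀ :=
    pow_le_pow_left₀ (by have := F.majorConst_pos; positivity) (le_max_right _ _) D
  have hsum : ∀ (J : ℕ) (s : Finset (ι → ZMod m)), (∀ a ∈ s, ¬ F.majorAt X i J a) →
      ∑ a ∈ s, ‖F.expSum C (4 ^ i) a‖ ≤
        s.card * ((64 * M₀ * (2 ^ i) ^ 3 * 2 ^ J : ℝ) ^ n) ^ D := by
    intro J s hs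
    refine (Finset.sum_le_card_nsmul _ _ _ fun a ha => ?_).trans_eq (nsmul_eq_mul _ _)
    have h := F.norm_expSum_le_of_not_isMajor hF.det_ne_zero hF.pos hF.bound_le hF.sum_le
      hF.six_le hF.lt (p := 2 ^ i) (by rw [← pow_mul, mul_comm, pow_mul]; norm_num)
      (by positivity) hm (t := 2 ^ J) (by positivity) a (hs a ha)
    rw [hcard, pow_mul] at h
    exact_mod_cast h
  induction J with
  | zero =>
    refine (hsum 0 _ fun a ha => (Finset.mem_filter.1 ha).2).trans ?_
    have h1 : (((Finset.univ.filter fun a : ι → ZMod m => ¬ F.majorAt X i 0 a).card : ℕ) : ℝ) ≤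
        ((M₀ : ℝ) * (4 ^ i) ^ 2) ^ D := by
      have h2 := Finset.card_le_univ (Finset.univ.filter fun a : ι → ZMod m => ¬ F.majorAt X i 0 a)
      rw [Fintype.card_fun, ZMod.card, F.card_eq, ← hD] at h2
      calc _ ≤ ((m ^ D : ℕ) : ℝ) := by exact_mod_cast h2
        _ = _ := by rw [hm]; push_cast; rfl
    refine (mul_le_mul_of_nonneg_right h1 (by positivity)).trans ?_
    rw [pow_zero, pow_zero, mul_one, mul_one]
    refine le_trans (le_of_eq ?_) (mul_le_mul_of_nonneg_right hK1 (by positivity))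
    rw [← mul_pow, ← mul_pow]
    congr 1
    rw [mul_pow _ ((2 ^ i : ℝ) ^ 3)]
    ring
  | succ J ih =>
    have h1 : ∑ a : ι → ZMod m with ¬ F.majorAt X i (J + 1) a, ‖F.expSum C (4 ^ i) a‖ ≤
        ∑ a : ι → ZMod m with ¬ F.majorAt X i J a, ‖F.expSum C (4 ^ i) a‖ +
        ∑ a : ι → ZMod m with (F.majorAt X i J a ∧ ¬ F.majorAt X i (J + 1) a),
          ‖F.expSum C (4 ^ i) a‖ := by
      rw [← Finset.sum_filter_add_sum_filter_not _ (fun a => ¬ F.majorAt X i J a)]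
      refine add_le_add (Finset.sum_le_sum_of_subset_of_nonneg ?_ fun _ _ _ => norm_nonneg _)
        (Finset.sum_le_sum_of_subset_of_nonneg ?_ fun _ _ _ => norm_nonneg _) <;>
      · intro a
        simp only [Finset.mem_filter, Finset.mem_univ, true_and]
        tauto
    have h2 := hsum (J + 1) (Finset.univ.filter fun a =>
      F.majorAt X i J a ∧ ¬ F.majorAt X i (J + 1) a) fun a ha => (Finset.mem_filter.1 ha).2.2
    have h3 : (((Finset.univ.filter fun a : ι → ZMod m =>
        F.majorAt X i J a ∧ ¬ F.majorAt X i (J + 1) a).card : ℕ) : ℝ) ≤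
        (F.majorConst * (2 * (X * (4 ^ i : ℕ)) / ((2 ^ J) ^ 2 : ℕ)) ^ 2) ^ D :=
      le_trans (Nat.cast_le.2 (Finset.card_le_card fun a h =>
        Finset.mem_filter.2 ⟨Finset.mem_univ a, (Finset.mem_filter.1 h).2.1⟩))
        (F.card_isMajor_le (m := m) _)
    have hq : (2 : ℝ) ≤ (2 ^ (n - 4)) ^ D := by
      calc (2 : ℝ) = (2 ^ 1) ^ 1 := by norm_num
        _ ≤ (2 ^ (n - 4)) ^ 1 := by gcongr; · norm_num
                                    · omega
        _ ≤ _ := by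
          gcongr
          · exact one_le_pow₀ (by norm_num)
          · omega
    have h4 : (F.majorConst * (2 * (X * (4 ^ i : ℕ)) / ((2 ^ J) ^ 2 : ℕ)) ^ 2) ^ D *
        ((64 * M₀ * (2 ^ i) ^ 3 * 2 ^ (J + 1) : ℝ) ^ n) ^ D =
        (F.majorConst * (4 * X ^ 2) * (128 * M₀) ^ n) ^ D *
        (((4 : ℝ) ^ i) ^ 2 * ((2 ^ i) ^ 3) ^ n) ^ D *
            ((2 ^ (n - 4)) ^ D) ^ J := by
      have h5 : ((2 : ℝ) ^ J) ^ n = (2 ^ (n - 4)) ^ J * ((2 ^ J) ^ 2) ^ 2 := by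
        obtain ⟨k, hk⟩ : ∃ k, n = k + 4 := ⟨n - 4, by omega⟩
        rw [hk, Nat.add_sub_cancel, pow_add, ← pow_mul 2 k J, mul_comm k J, pow_mul]
        ring
      have h6 : (64 * M₀ * (2 ^ i) ^ 3 * 2 ^ (J + 1) : ℝ) ^ n =
          (128 * M₀ : ℝ) ^ n * ((2 ^ i) ^ 3) ^ n * ((2 ^ (n - 4)) ^ J * ((2 ^ J) ^ 2) ^ 2) := by
        rw [← h5, ← mul_pow, ← mul_pow]
        congr 1
        ring
      rw [h6, ← pow_mul _ D J, mul_comm D J, pow_mul _ J D, ← mul_pow, ← mul_pow, ← mul_pow]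
      push_cast
      field_simp
      ring
    calc _ ≤ _ := h1
      _ ≤ F.minorConst C X M₀ * (((4 : ℝ) ^ i) ^ 2 * ((2 ^ i) ^ 3) ^ n) ^ D *
            ((2 ^ (n - 4)) ^ D) ^ J +
          F.minorConst C X M₀ * (((4 : ℝ) ^ i) ^ 2 * ((2 ^ i) ^ 3) ^ n) ^ D *
            ((2 ^ (n - 4)) ^ D) ^ J := by
        refine add_le_add ih (h2.trans ((mul_le_mul_of_nonneg_right h3 (by positivity)).trans ?_))
        rw [h4]
        gcongr
      _ = 2 * (F.minorConst C X M₀ * (((4 : ℝ) ^ i) ^ 2 * ((2 ^ i) ^ 3) ^ n) ^ D *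
          ((2 ^ (n - 4)) ^ D) ^ J) := by ring
      _ ≤ (2 ^ (n - 4)) ^ D * (F.minorConst C X M₀ * (((4 : ℝ) ^ i) ^ 2 * ((2 ^ i) ^ 3) ^ n) ^ D *
          ((2 ^ (n - 4)) ^ D) ^ J) := by
        refine mul_le_mul_of_nonneg_right hq ?_
        have := le_trans (by positivity) hK1
        positivity
      _ = _ := by ring

end TraceFrame

end Telescope

section MajorPhase

namespace TraceFrame

variable {O ι W κ : Type*} [CommRing O] [Fintype ι] [Fintype W] (F : TraceFrame O ι W)

lemma exists_abs_tr_le : ∃ c : ℝ, 0 ≤ c ∧ ∀ x M, (∀ w, |F.σ w x| ≤ M) → |(F.tr x : ℝ)| ≤ c * M := by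
  refine ⟨(∑ i, |(F.tr (F.basis i) : ℝ)|) * F.bound,
    mul_nonneg (Finset.sum_nonneg fun _ _ => abs_nonneg _) (zero_le_one.trans F.one_le_bound),
    fun x M hx => ?_⟩
  have h1 : (F.tr x : ℝ) = ∑ i, (F.basis.repr x i : ℝ) * F.tr (F.basis i) := by
    conv_lhs => rw [← F.ofCoord_repr x, ofCoord, map_sum]
    push_cast
    refine Finset.sum_congr rfl fun i _ => ?_
    rw [← zsmul_eq_mul, map_zsmul]
    push_cast [zsmul_eq_mul]
    rfl
  rw [h1, Finset.sum_mul, Finset.sum_mul]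
  refine (Finset.abs_sum_le_sum_abs _ _).trans (Finset.sum_le_sum fun i _ => ?_)
  rw [abs_mul, mul_comm, mul_assoc]
  exact mul_le_mul_of_nonneg_left (F.abs_repr_le x M hx i) (abs_nonneg _)

lemma finite_abs_le (Y : ℝ) : {l : O | ∀ w, |F.σ w l| ≤ Y}.Finite := by
  classical
  refine Set.Finite.of_injOn (f := fun l i => F.basis.repr l i)
    (t := (intCube ι ⌈F.bound * Y⌉₊ : Set (ι → ℤ))) (fun l hl => ?_) ?_ (Finset.finite_toSet _)
  · refine Finset.mem_coe.2 (mem_intCube.2 fun i => ?_)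
    have h := (F.abs_repr_le l Y hl i).trans (Nat.le_ceil _)
    exact_mod_cast h
  · intro l _ l' _ h
    exact F.basis.repr.injective (Finsupp.ext fun i => congrFun h i)

lemma exists_multiple [IsDomain O] (Y : ℝ) : ∃ N : ℕ, 0 < N ∧ ∃ U : ℝ, 0 ≤ U ∧
    ∀ l, l ≠ 0 → (∀ w, |F.σ w l| ≤ Y) → ∃ u, l * u = N ∧ ∀ w, |F.σ w u| ≤ U := by
  classical
  have : Module.Finite ℤ O := Module.Finite.of_basis F.basis
  have : Module.Free ℤ O := Module.Free.of_basis F.basis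
  have h1 : ∀ l : O, ∃ N : ℕ, 0 < N ∧ (l ≠ 0 → l ∣ (N : O)) := by
    intro l
    by_cases hl : l = 0
    · exact ⟨1, one_pos, fun h => absurd hl h⟩
    · obtain ⟨r, hr, hlr⟩ :=
          (Algebra.IsIntegral.isIntegral (R := ℤ) l).isAlgebraic.exists_nonzero_dvd
        (mem_nonZeroDivisors_of_ne_zero hl)
      refine ⟨r.natAbs, Int.natAbs_pos.2 hr, fun _ => ?_⟩
      rcases Int.natAbs_eq r with h | h <;> rw [h] at hlr
      · simpa using hlr
      · simpa using hlr
  choose N hN hNl using h1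
  let s := (F.finite_abs_le Y).toFinset
  have h2 : ∀ l, ∃ u, l ≠ 0 → l ∈ s → l * u = ((∏ l ∈ s, N l : ℕ) : O) := by
    intro l
    by_cases hl : l ≠ 0 ∧ l ∈ s
    · obtain ⟨u, hu⟩ := (hNl l hl.1).trans (Nat.cast_dvd_cast (Finset.dvd_prod_of_mem N hl.2))
      exact ⟨u, fun _ _ => hu.symm⟩
    · exact ⟨0, fun h h' => absurd ⟨h, h'⟩ hl⟩
  choose u hu using h2
  refine ⟨∏ l ∈ s, N l, Finset.prod_pos fun l _ => hN l, ∑ l ∈ s, ∑ w, |F.σ w (u l)|,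
    by positivity, fun l hl hlY => ⟨u l, hu l hl (by simpa [s] using hlY), fun w => ?_⟩⟩
  refine (Finset.single_le_sum (f := fun w => |F.σ w (u l)|) (fun _ _ => abs_nonneg _)
    (Finset.mem_univ w)).trans ?_
  exact Finset.single_le_sum (f := fun l => ∑ w, |F.σ w (u l)|)
    (fun _ _ => Finset.sum_nonneg fun _ _ => abs_nonneg _) (by simpa [s] using hlY)

lemma norm_one_sub_stdAddChar_le {m : ℕ} [NeZero m] (z : ℤ) :
    ‖1 - (ZMod.stdAddChar (z : ZMod m) : ℂ)‖ ≤ 2 * Real.pi * |(z : ℝ)| / m := by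
  have h3 : (2 * Real.pi * Complex.I * (z : ℂ) / m : ℂ) =
      Complex.I * ((2 * Real.pi * z / m : ℝ) : ℂ) := by
    push_cast; ring
  rw [ZMod.stdAddChar_coe, h3, norm_sub_rev]
  refine (Real.norm_exp_I_mul_ofReal_sub_one_le).trans_eq ?_
  rw [Real.norm_eq_abs, abs_div, abs_mul, abs_mul, abs_of_pos Real.pi_pos, Nat.abs_cast, abs_two]

/-- Major characters are nearly constant on the multiples of a fixed integer. -/
lemma exists_norm_one_sub_chr_le [IsDomain O] (Y : ℝ) : ∃ N : ℕ, 0 < N ∧ ∃ c : ℝ, 0 ≤ c ∧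
    ∀ (m : ℕ) [NeZero m] (a : ι → ZMod m), IsMajor F.σ m Y (F.lift a) →
    ∀ (b : O) (M : ℝ), (∀ w, |F.σ w b| ≤ M) → ‖1 - F.chr a (N * b)‖ ≤ c * M / m := by
  obtain ⟨N, hN, U, hU, h⟩ := F.exists_multiple Y
  obtain ⟨c, hc, htr⟩ := F.exists_abs_tr_le
  refine ⟨F.Δ * N, Nat.mul_pos F.Δ_pos hN, 2 * Real.pi * (c * (|Y| * U)), by positivity,
    fun m _ a ⟨l, hl, hlY, k, hk⟩ b M hb => ?_⟩
  obtain ⟨u, hu, huU⟩ := h l hl hlY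
  have h1 : F.chr a ((F.Δ * N : ℕ) * b) =
      ZMod.stdAddChar (F.tr ((F.lift a * l - m * k) * (u * b)) : ZMod m) := by
    have h2 : F.chr a ((F.Δ * N : ℕ) * b) =
        ZMod.stdAddChar (F.tr (F.lift a * (N * b)) : ZMod m) := by
      rw [F.tr_lift_mul, chr]
      congr 1
      simp only [dotProduct]
      push_cast
      rw [Finset.mul_sum]
      refine Finset.sum_congr rfl fun i _ => ?_
      rw [mul_assoc, ← nsmul_eq_mul, map_nsmul, Finsupp.smul_apply, ZMod.natCast_zmod_val]
      push_cast [nsmul_eq_mul]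
      ring
    have h3 : F.lift a * (N * b) = (F.lift a * l - m * k) * (u * b) + m * (k * (u * b)) := by
      rw [← hu]; ring
    rw [h2, h3, map_add, ← nsmul_eq_mul m (k * (u * b)), map_nsmul]
    push_cast [nsmul_eq_mul]
    simp
  rw [h1]
  refine (norm_one_sub_stdAddChar_le _).trans ?_
  have h4 := htr ((F.lift a * l - m * k) * (u * b)) (|Y| * (U * M)) fun w => by
    rw [map_mul, map_mul, abs_mul, abs_mul]
    exact mul_le_mul ((hk w).trans (le_abs_self Y))
      (mul_le_mul (huU w) (hb w) (abs_nonneg _) hU) (by positivity) (abs_nonneg _)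
  calc _ ≤ 2 * Real.pi * (c * (|Y| * (U * M))) / m := by gcongr
    _ = _ := by ring

section count

variable [Fintype κ] [DecidableEq ι] [DecidableEq κ]

open Classical in
/-- The number of representations `a = Q(h + k)` with `h`, `k` in a cube. -/
noncomputable def repCount (C : Matrix κ κ O) (P : ℕ) (a : O) : ℕ :=
  ((intCube (κ × ι) P ×ˢ intCube (κ × ι) P).filter fun q =>
    qf C (F.vec q.1 + F.vec q.2) = a).card

lemma sum_expSum_mul_chr {m : ℕ} [NeZero m] (C : Matrix κ κ O) {P : ℕ} {a : O}
    (h : ∀ q ∈ intCube (κ × ι) P ×ˢ intCube (κ × ι) P, ∀ i,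
      |F.basis.repr (qf C (F.vec q.1 + F.vec q.2) - a) i| < m) :
    ∑ χ : ι → ZMod m, F.expSum C P χ * F.chr χ (-a) =
      (m : ℂ) ^ Fintype.card ι * F.repCount C P a := by
  simp only [expSum, Finset.sum_mul]
  rw [Finset.sum_comm]
  simp only [← F.chr_add, ← sub_eq_add_neg]
  classical
  rw [repCount, Finset.card_filter, Nat.cast_sum, Finset.mul_sum]
  refine Finset.sum_congr rfl fun q hq => ?_
  split_ifs with h0
  · rw [h0, sub_self, F.sum_chr_zero]; simp
  · rw [F.sum_chr_eq_zero (sub_ne_zero.2 h0) (h q hq)]; simp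

end count

end TraceFrame

end MajorPhase

section CircleMethod

lemma abs_map_qf_le {O κ : Type*} [CommRing O] [Fintype κ] (σ : O →+* ℝ) (C : Matrix κ κ O)
    {x : κ → O} {β : ℝ} (hx : ∀ k, |σ (x k)| ≤ β) :
    |σ (qf C x)| ≤ (∑ k, ∑ j, |σ (C k j)|) * β ^ 2 := by
  simp only [qf, dotProduct, Matrix.mulVec, map_sum, map_mul, Finset.sum_mul, Finset.mul_sum]
  refine (Finset.abs_sum_le_sum_abs _ _).trans (Finset.sum_le_sum fun k _ =>
    (Finset.abs_sum_le_sum_abs _ _).trans (Finset.sum_le_sum fun j _ => ?_))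
  rw [abs_mul, abs_mul]
  have hβ : 0 ≤ β := (abs_nonneg _).trans (hx k)
  calc _ ≤ β * (|σ (C k j)| * β) := by
        gcongr
        · exact hx k
        · exact hx j
    _ = _ := by ring

namespace TraceFrame

variable {O ι W κ : Type*} [CommRing O] [Fintype ι] [Fintype W] [Fintype κ]
  [DecidableEq κ] (F : TraceFrame O ι W)

lemma exists_isAdmissible {C : Matrix κ κ O} (hC : (C + Cᵀ).det ≠ 0) (M : ℝ) :
    ∃ X M₀, F.IsAdmissible C X M₀ ∧ M < (M₀ : ℝ) := by
  have hb := zero_le_one.trans F.one_le_bound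
  let S := ∑ w, ∑ k, 2 * (Fintype.card ι * F.bound) * ∑ i, |F.σ w ((C + Cᵀ) k i)|
  have hS : 0 ≤ S := by positivity
  let X := Fintype.card ι * F.bound + S + 1
  have hX : 0 < X := by positivity
  obtain ⟨M₀, hM₀⟩ := exists_nat_gt (6 + 2 * X ^ 2 + |M|)
  have h1 : (6 : ℝ) < M₀ := by nlinarith [abs_nonneg M, sq_nonneg X]
  refine ⟨X, M₀, ⟨hC, hX, by simp only [X]; linarith, fun w k => ?_, by exact_mod_cast h1.le,
    by linarith [abs_nonneg M]⟩, by nlinarith [le_abs_self M, sq_nonneg X]⟩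
  have h2 := Finset.single_le_sum (f := fun w => ∑ k, 2 * (Fintype.card ι * F.bound) *
    ∑ i, |F.σ w ((C + Cᵀ) k i)|) (fun _ _ => by positivity) (Finset.mem_univ w)
  have h3 := Finset.single_le_sum (f := fun k => 2 * (Fintype.card ι * F.bound) *
    ∑ i, |F.σ w ((C + Cᵀ) k i)|) (fun _ _ => by positivity) (Finset.mem_univ k)
  have h4 : (0 : ℝ) ≤ Fintype.card ι * F.bound := by positivity
  exact (h3.trans h2).trans (by simp only [X]; linarith)

variable [DecidableEq ι]

open Classical in
lemma sum_repCount_le_of_bounds {m : ℕ} [NeZero m] (C : Matrix κ κ O) {P : ℕ} {J : Type*}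
    (s : Finset J) (f : J → O) {a : O}
    (ha : ∀ q ∈ intCube (κ × ι) P ×ˢ intCube (κ × ι) P, ∀ i,
      |F.basis.repr (qf C (F.vec q.1 + F.vec q.2) - a) i| < m)
    (hs : ∀ j ∈ s, ∀ q ∈ intCube (κ × ι) P ×ˢ intCube (κ × ι) P, ∀ i,
      |F.basis.repr (qf C (F.vec q.1 + F.vec q.2) - (a + f j)) i| < m)
    (p : (ι → ZMod m) → Prop) {η E₁ E₂ : ℝ} (hη : 0 ≤ η)
    (hp : ∀ χ, p χ → ∀ j ∈ s, ‖1 - F.chr χ (-f j)‖ ≤ η)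
    (h₁ : ∑ χ : ι → ZMod m with ¬ p χ, ‖F.expSum C P χ‖ ≤ E₁)
    (h₂ : ∑ χ : ι → ZMod m, ‖F.expSum C P χ‖ ≤ E₂) :
    (m : ℝ) ^ Fintype.card ι * ∑ j ∈ s, (F.repCount C P (a + f j) : ℝ) ≤
      s.card * ((m : ℝ) ^ Fintype.card ι * F.repCount C P a + (2 * E₁ + η * E₂)) := by
  have h3 : (((m : ℝ) ^ Fintype.card ι * ∑ j ∈ s, (F.repCount C P (a + f j) : ℝ) -
      s.card * ((m : ℝ) ^ Fintype.card ι * F.repCount C P a) : ℝ) : ℂ) =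
      -∑ χ : ι → ZMod m, F.expSum C P χ * F.chr χ (-a) * ∑ j ∈ s, (1 - F.chr χ (-f j)) := by
    push_cast
    rw [Finset.mul_sum, Finset.sum_congr rfl fun j hj => (F.sum_expSum_mul_chr C (hs j hj)).symm,
      ← F.sum_expSum_mul_chr C ha, Finset.sum_comm, Finset.mul_sum, ← Finset.sum_sub_distrib,
      ← Finset.sum_neg_distrib]
    refine Finset.sum_congr rfl fun χ _ => ?_
    rw [Finset.sum_sub_distrib, Finset.sum_const, nsmul_eq_mul, mul_one, mul_sub, Finset.mul_sum,
      Finset.sum_congr rfl fun j _ => by rw [neg_add, F.chr_add, ← mul_assoc]]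
    ring
  have h4 : ‖∑ χ : ι → ZMod m, F.expSum C P χ * F.chr χ (-a) * ∑ j ∈ s, (1 - F.chr χ (-f j))‖ ≤
      s.card * (2 * E₁ + η * E₂) := by
    calc _ ≤ ∑ χ, ‖F.expSum C P χ‖ * ∑ j ∈ s, ‖1 - F.chr χ (-f j)‖ := by
          refine (norm_sum_le _ _).trans (Finset.sum_le_sum fun χ _ => ?_)
          rw [norm_mul, norm_mul, F.norm_chr, mul_one]
          exact mul_le_mul_of_nonneg_left (norm_sum_le _ _) (norm_nonneg _)
      _ ≤ ∑ χ, (‖F.expSum C P χ‖ * (s.card * η) +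
            if ¬ p χ then ‖F.expSum C P χ‖ * (s.card * 2) else 0) := by
          refine Finset.sum_le_sum fun χ _ => ?_
          by_cases h : p χ
          · rw [if_neg (not_not.2 h), add_zero]
            refine mul_le_mul_of_nonneg_left ?_ (norm_nonneg _)
            exact (Finset.sum_le_card_nsmul _ _ _ (hp χ h)).trans_eq (nsmul_eq_mul _ _)
          · rw [if_pos h]
            refine le_trans (mul_le_mul_of_nonneg_left (c := (s.card : ℝ) * 2) ?_ (norm_nonneg _))
              (le_add_of_nonneg_left (by positivity))
            refine (Finset.sum_le_card_nsmul _ _ 2 fun j _ => ?_).trans_eq (nsmul_eq_mul _ _)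
            refine (norm_sub_le _ _).trans_eq ?_
            rw [norm_one, F.norm_chr]; norm_num
      _ = s.card * (2 * ∑ χ with ¬ p χ, ‖F.expSum C P χ‖ + η * ∑ χ, ‖F.expSum C P χ‖) := by
          rw [Finset.sum_add_distrib, ← Finset.sum_filter, ← Finset.sum_mul, ← Finset.sum_mul]
          ring
      _ ≤ _ := by gcongr
  have h5 := Complex.re_le_norm (((m : ℝ) ^ Fintype.card ι *
    ∑ j ∈ s, (F.repCount C P (a + f j) : ℝ) -
      s.card * ((m : ℝ) ^ Fintype.card ι * F.repCount C P a) : ℝ) : ℂ)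
  rw [Complex.ofReal_re, h3, norm_neg] at h5
  linarith

lemma exists_abs_repr_qf_le (C : Matrix κ κ O) : ∃ c : ℝ, 0 ≤ c ∧ ∀ P : ℕ,
    ∀ q ∈ intCube (κ × ι) P ×ˢ intCube (κ × ι) P, ∀ i,
      |(F.basis.repr (qf C (F.vec q.1 + F.vec q.2)) i : ℝ)| ≤ c * P ^ 2 := by
  have hb := zero_le_one.trans F.one_le_bound
  refine ⟨F.bound * ((∑ w, ∑ k, ∑ j, |F.σ w (C k j)|) * (2 * (Fintype.card ι * F.bound)) ^ 2),
    by positivity, fun P q hq => ?_⟩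
  obtain ⟨h1, h2⟩ := Finset.mem_product.1 hq
  set β := 2 * (Fintype.card ι * F.bound)
  have hβ : 0 ≤ β := by positivity
  have hx : ∀ w k, |F.σ w ((F.vec q.1 + F.vec q.2) k)| ≤ β * P := by
    intro w k
    have h3 : ∀ h ∈ intCube (κ × ι) P, |F.σ w (F.vec h k)| ≤ Fintype.card ι * F.bound * P :=
      fun h hh => F.abs_ofCoord_le (fun j => by exact_mod_cast mem_intCube.1 hh (k, j)) w
    rw [Pi.add_apply, map_add]
    refine (abs_add_le _ _).trans ((add_le_add (h3 _ h1) (h3 _ h2)).trans_eq ?_)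
    ring
  have h4 := F.abs_repr_le (qf C (F.vec q.1 + F.vec q.2))
    ((∑ w, ∑ k, ∑ j, |F.σ w (C k j)|) * (β * P) ^ 2) fun w => ?_
  · intro i
    refine (h4 i).trans_eq ?_
    ring
  · refine le_trans ?_ (mul_le_mul_of_nonneg_right (Finset.single_le_sum
      (f := fun w => ∑ k, ∑ j, |F.σ w (C k j)|) (fun _ _ => by positivity) (Finset.mem_univ w))
      (by positivity))
    exact abs_map_qf_le (F.σ w) C (hx w)

end TraceFrame

end CircleMethod

section CircleMethod

namespace TraceFrame

variable {O ι W κ : Type*} [CommRing O] [IsDomain O] [CharZero O] [Fintype ι] [Fintype W]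
  [Nonempty W] [Fintype κ] [DecidableEq ι] [DecidableEq κ] (F : TraceFrame O ι W)

open Classical in
lemma sum_not_majorAt_sub_le {C : Matrix κ κ O} {X : ℝ} {M₀ : ℕ} (hF : F.IsAdmissible C X M₀)
    (hn : 5 ≤ Fintype.card κ) {i m : ℕ} [NeZero m] (hm : m = M₀ * (4 ^ i) ^ 2) {J e e' : ℕ}
    (hJ : J + e = i + e') :
    (∑ a : ι → ZMod m with ¬ F.majorAt X i J a, ‖F.expSum C (4 ^ i) a‖) *
        ((2 ^ (Fintype.card κ - 4)) ^ Fintype.card W) ^ e ≤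
      F.minorConst C X M₀ * ((2 ^ (Fintype.card κ - 4)) ^ Fintype.card W) ^ e' *
        (((16 : ℝ) ^ i) ^ Fintype.card κ) ^ Fintype.card W := by
  refine (mul_le_mul_of_nonneg_right (F.sum_not_majorAt_le hF hn hm J) (by positivity)).trans_eq ?_
  set n := Fintype.card κ
  set D := Fintype.card W
  set q : ℝ := (2 ^ (n - 4)) ^ D with hq
  have h1 : q ^ J * q ^ e = q ^ e' * q ^ i := by rw [← pow_add, hJ, pow_add, mul_comm]
  have h2 : ((((4 : ℝ) ^ i) ^ 2 * ((2 ^ i) ^ 3) ^ n) ^ D) * q ^ i = (((16 : ℝ) ^ i) ^ n) ^ D := by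
    rw [hq, ← pow_mul _ D i, mul_comm D i, pow_mul _ i D, ← mul_pow]
    congr 1
    obtain ⟨k, hk⟩ : ∃ k, n = k + 4 := ⟨n - 4, by omega⟩
    rw [hk, Nat.add_sub_cancel, ← pow_mul 2 k i, mul_comm k i, pow_mul 2 i k]
    have h4 : (4 : ℝ) ^ i = (2 ^ i) ^ 2 := by rw [← pow_mul, mul_comm, pow_mul]; norm_num
    have h16 : (16 : ℝ) ^ i = (2 ^ i) ^ 4 := by rw [← pow_mul, mul_comm, pow_mul]; norm_num
    rw [h4, h16]
    ring
  rw [mul_assoc, h1, mul_comm (q ^ e'), ← mul_assoc, mul_assoc _ _ (q ^ i), h2]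
  ring

/-- The number of representations of `a` is bounded below by the average number of representations
over a box of suitable multiples around `a`, up to a small error. -/
theorem exists_sum_repCount_le {C : Matrix κ κ O} (hC : (C + Cᵀ).det ≠ 0)
    (hn : 5 ≤ Fintype.card κ) (A : ℝ) {ε : ℝ} (hε : 0 < ε) (G : ℕ) :
    ∃ N g i₀ : ℕ, 0 < N ∧ N * G ≤ 16 ^ g ∧ g ≤ i₀ ∧ ∀ i, i₀ ≤ i → ∀ a : O,
      (∀ j, |(F.basis.repr a j : ℝ)| ≤ A * 16 ^ i) →
      ∑ b ∈ intCube ι (16 ^ (i - g)), (F.repCount C (4 ^ i) (a + N * F.ofCoord b) : ℝ) ≤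
        (intCube ι (16 ^ (i - g))).card * (F.repCount C (4 ^ i) a +
          ε * (((16 : ℝ) ^ i) ^ (Fintype.card κ - 1)) ^ Fintype.card W) := by
  classical
  obtain ⟨cQ, hcQ, hrepr⟩ := F.exists_abs_repr_qf_le C
  obtain ⟨X, M₀, hF, hM₀⟩ := F.exists_isAdmissible hC (cQ + |A| + 1)
  set n := Fintype.card κ
  set D := Fintype.card W
  set q : ℝ := (2 ^ (n - 4)) ^ D with hq
  have hX := hF.pos
  have hq2 : 2 ≤ q := by
    calc (2 : ℝ) = (2 ^ 1) ^ 1 := by norm_num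
      _ ≤ (2 ^ (n - 4)) ^ 1 := by
        gcongr
        · norm_num
        · omega
      _ ≤ _ := by
        refine pow_le_pow_right₀ (one_le_pow₀ (by norm_num)) Fintype.card_pos
  set K := F.minorConst C X M₀
  have hK : 0 ≤ K := pow_nonneg (le_max_of_le_left (by positivity)) _
  obtain ⟨e, he⟩ := pow_unbounded_of_one_lt (4 * K / ε) (one_lt_two (α := ℝ))
  obtain ⟨e', he'⟩ := pow_unbounded_of_one_lt (2 * X) (show (1 : ℝ) < 4 by norm_num)
  obtain ⟨N, hN, c, hc, hphase⟩ := F.exists_norm_one_sub_chr_le (2 * X * 4 ^ e)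
  set c' : ℝ := c * (Fintype.card ι * F.bound)
  obtain ⟨g, hg⟩ := pow_unbounded_of_one_lt (max (2 * (c' * (K * q ^ e')) / ε) (N * (G + 1) : ℕ))
    (show (1 : ℝ) < 16 by norm_num)
  have hg1 := (max_lt_iff.1 hg).1
  have hg2 : N * (G + 1) ≤ 16 ^ g := by
    have := (max_lt_iff.1 hg).2
    exact_mod_cast this.le
  refine ⟨N, g, max e g, hN, (Nat.mul_le_mul_left _ (Nat.le_succ _)).trans hg2, le_max_right _ _,
    fun i hi a ha => ?_⟩
  have hei : e ≤ i := (le_max_left _ _).trans hi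
  have hgi : g ≤ i := (le_max_right _ _).trans hi
  set T := 16 ^ (i - g) with hT
  have hTg : (16 : ℝ) ^ g * T = 16 ^ i := by
    rw [hT]; push_cast; rw [← pow_add, Nat.add_sub_cancel' hgi]
  have hNT : (N : ℝ) * T ≤ 16 ^ i := by
    rw [← hTg]
    refine mul_le_mul_of_nonneg_right ?_ (by positivity)
    exact_mod_cast (Nat.le_mul_of_pos_right _ (Nat.succ_pos _)).trans hg2
  have h6 : (6 : ℝ) ≤ M₀ := by exact_mod_cast hF.six_le
  set m := M₀ * (4 ^ i) ^ 2 with hm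
  have hmr : (m : ℝ) = M₀ * 16 ^ i := by
    rw [hm]; push_cast; rw [← pow_mul, mul_comm i 2, pow_mul]; norm_num
  have : NeZero m := ⟨by
    have : (0 : ℝ) < m := by rw [hmr]; positivity
    exact_mod_cast this.ne'⟩
  set R : ℝ := (((16 : ℝ) ^ i) ^ n) ^ D with hR
  have hR0 : 0 < R := by positivity
  -- size conditions
  have hsize : ∀ b : O, (∀ j, |(F.basis.repr b j : ℝ)| ≤ 16 ^ i) →
      ∀ q ∈ intCube (κ × ι) (4 ^ i) ×ˢ intCube (κ × ι) (4 ^ i), ∀ j,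
      |F.basis.repr (qf C (F.vec q.1 + F.vec q.2) - (a + b)) j| < m := by
    intro b hb q hq j
    have h1 := hrepr _ q hq j
    have h2 : ((4 ^ i : ℕ) : ℝ) ^ 2 = 16 ^ i := by
      push_cast; rw [← pow_mul, mul_comm i 2, pow_mul]; norm_num
    rw [h2] at h1
    have h3 : |(F.basis.repr (qf C (F.vec q.1 + F.vec q.2) - (a + b)) j : ℝ)| < m := by
      rw [map_sub, map_add, Finsupp.sub_apply, Finsupp.add_apply]
      push_cast
      refine (abs_sub _ _).trans_lt ((add_le_add h1 ((abs_add_le _ _).trans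
        (add_le_add (ha j) (hb j)))).trans_lt ?_)
      rw [hmr]
      have h4 : (0 : ℝ) < 16 ^ i := by positivity
      nlinarith [le_abs_self A]
    exact_mod_cast h3
  have hbox : ∀ b ∈ intCube ι T, ∀ j, |(b j : ℝ)| ≤ T := fun b hb j => by
    exact_mod_cast mem_intCube.1 hb j
  have hminor := F.sum_not_majorAt_sub_le hF hn (hm : m = _) (J := i - e) (e := e) (e' := 0)
    (by omega)
  have htotal := F.sum_not_majorAt_sub_le hF hn (hm : m = _) (J := i + e') (e := 0) (e' := e') rfl
  rw [← hq, pow_zero, mul_one, ← hR] at hminor htotal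
  rw [Finset.filter_true_of_mem] at htotal
  swap
  · rintro χ - ⟨l, hl, hlY, -⟩
    refine hl (F.discrete.eq_zero hlY ?_)
    rw [Finset.prod_const, Finset.card_univ]
    have h1 : 2 * (X * (4 ^ i : ℕ)) / ((2 ^ (i + e')) ^ 2 : ℕ) = 2 * X / 4 ^ e' := by
      push_cast
      rw [← pow_mul, mul_comm (i + e') 2, pow_mul, pow_add]
      norm_num
      field_simp
    rw [h1]
    refine pow_lt_one₀ (by positivity) ?_ Fintype.card_ne_zero
    rwa [div_lt_one (by positivity)]
  have hminor' : ∑ a : ι → ZMod m with ¬ F.majorAt X i (i - e) a, ‖F.expSum C (4 ^ i) a‖ ≤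
      ε / 4 * R := by
    have h1 : 4 * K ≤ ε * q ^ e := by
      rw [div_lt_iff₀ hε] at he
      have h2 : (2 : ℝ) ^ e ≤ q ^ e := pow_le_pow_left₀ zero_le_two hq2 e
      nlinarith
    have h2 : 0 < q ^ e := by positivity
    refine le_of_mul_le_mul_right (hminor.trans ?_) h2
    nlinarith
  have hmain := F.sum_repCount_le_of_bounds (m := m) C (intCube ι T)
    (fun b => (N : O) * F.ofCoord b) (a := a) (P := 4 ^ i)
    (by simpa using hsize 0 (by simp)) (fun b hb => hsize _ fun j => ?_)
    (F.majorAt X i (i - e)) (η := c' / 16 ^ g) (by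
      have := zero_le_one.trans F.one_le_bound
      positivity) (fun χ hχ b hb => ?_) hminor' htotal
  rotate_left
  · rw [← nsmul_eq_mul, map_nsmul, Finsupp.smul_apply, F.repr_ofCoord]
    push_cast [nsmul_eq_mul]
    rw [abs_mul, Nat.abs_cast]
    exact (mul_le_mul_of_nonneg_left (hbox b hb j) (Nat.cast_nonneg _)).trans hNT
  · have h1 : 2 * (X * (4 ^ i : ℕ)) / ((2 ^ (i - e)) ^ 2 : ℕ) = 2 * X * 4 ^ e := by
      push_cast
      rw [← pow_mul, mul_comm (i - e) 2, pow_mul, div_eq_iff (by positivity)]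
      norm_num
      rw [mul_assoc (2 * X), ← pow_add, Nat.add_sub_cancel' hei, mul_assoc]
    rw [majorAt, h1] at hχ
    rw [← mul_neg]
    refine (hphase m χ hχ (-F.ofCoord b) (Fintype.card ι * F.bound * T) fun w => ?_).trans ?_
    · rw [map_neg, abs_neg]
      exact F.abs_ofCoord_le (hbox b hb) w
    · rw [div_le_div_iff₀ (by rw [hmr]; positivity) (by positivity), hmr]
      have h2 : 0 ≤ c' := by
        have := zero_le_one.trans F.one_le_bound
        positivity
      calc c * (Fintype.card ι * F.bound * T) * 16 ^ g = c' * (16 ^ g * T) := by ring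
        _ = c' * (1 * 16 ^ i) := by rw [hTg, one_mul]
        _ ≤ c' * (M₀ * 16 ^ i) := by gcongr; linarith
  have herr : 2 * (ε / 4 * R) + c' / 16 ^ g * (K * q ^ e' * R) ≤ ε * R := by
    have h1 : c' / 16 ^ g * (K * q ^ e') ≤ ε / 2 := by
      rw [div_mul_eq_mul_div, div_le_iff₀ (by positivity)]
      rw [div_lt_iff₀ hε] at hg1
      linarith
    nlinarith
  have hmD : (m : ℝ) ^ Fintype.card ι * (((16 : ℝ) ^ i) ^ (n - 1)) ^ D = (M₀ : ℝ) ^ D * R := by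
    rw [F.card_eq, hmr, ← mul_pow, hR, ← mul_pow]
    congr 1
    obtain ⟨k, hk⟩ : ∃ k, n = k + 1 := ⟨n - 1, by omega⟩
    rw [hk, Nat.add_sub_cancel]
    ring
  have hmpos : 0 < (m : ℝ) ^ Fintype.card ι := by rw [hmr]; positivity
  have hM₀D : (1 : ℝ) ≤ (M₀ : ℝ) ^ D := one_le_pow₀ (by linarith)
  have hle : 2 * (ε / 4 * R) + c' / 16 ^ g * (K * q ^ e' * R) ≤
      (m : ℝ) ^ Fintype.card ι * (ε * (((16 : ℝ) ^ i) ^ (n - 1)) ^ D) := by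
    rw [mul_left_comm _ ε, hmD]
    exact herr.trans (mul_le_mul_of_nonneg_left (le_mul_of_one_le_left hR0.le hM₀D) hε.le)
  refine le_of_mul_le_mul_left (hmain.trans ?_) hmpos
  rw [mul_left_comm _ ((intCube ι T).card : ℝ), mul_add ((m : ℝ) ^ Fintype.card ι)]
  exact mul_le_mul_of_nonneg_left (add_le_add le_rfl hle) (Nat.cast_nonneg _)

end TraceFrame

end CircleMethod

section LatticePoints

namespace TraceFrame

variable {O ι W : Type*} [CommRing O] [Fintype ι] [Fintype W] (F : TraceFrame O ι W)

lemma exists_real_coord [DecidableEq ι] (t : W → ℝ) :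
    ∃ τ : ι → ℝ, ∀ w, ∑ i, τ i * F.σ w (F.basis i) = t w := by
  classical
  have hΔ : (F.Δ : ℝ) ≠ 0 := Nat.cast_ne_zero.2 F.Δ_pos.ne'
  let A : Matrix W ι ℝ := Matrix.of fun w i => F.σ w (F.basis i)
  let B : Matrix ι W ℝ := Matrix.of fun i w => F.σ w (F.dual i) / F.Δ
  have h1 : B * A = 1 := by
    ext i j
    have h2 := F.tr_eq (F.dual i * F.basis j)
    rw [F.tr_dual_mul, Module.Basis.repr_self] at h2
    simp only [Matrix.mul_apply, A, B, Matrix.of_apply, div_mul_eq_mul_div, ← Finset.sum_div,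
      ← map_mul, ← h2]
    rw [Finsupp.single_apply, Matrix.one_apply]
    by_cases hij : i = j
    · simp [hij, hΔ]
    · simp [hij, Ne.symm hij]
  have h3 : A * B = 1 := (Matrix.mul_eq_one_comm_of_card_eq _ _ _ F.card_eq).1 h1
  refine ⟨B *ᵥ t, fun w => ?_⟩
  have h4 : (A *ᵥ (B *ᵥ t)) w = t w := by rw [Matrix.mulVec_mulVec, h3, Matrix.one_mulVec]
  rw [← h4]
  exact Finset.sum_congr rfl fun i _ => mul_comm _ _

/-- A residue class has many elements in every sufficiently large cube. -/
lemma exists_finset_near [Nonempty W] : ∃ c : ℝ, 0 < c ∧ ∀ (N : ℕ), 0 < N → ∀ (ρ : O) (t : W → ℝ)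
    (H : ℝ), N ≤ c * H → ∃ s : Finset O,
      (∀ x ∈ s, (N : O) ∣ x - ρ ∧ ∀ w, |F.σ w x - t w| ≤ H) ∧
      (c * H / N) ^ Fintype.card W ≤ (s.card : ℝ) := by
  classical
  have hβ := F.one_le_card_mul_bound
  set β := Fintype.card ι * F.bound
  refine ⟨β⁻¹, by positivity, fun N hN ρ t H hH => ?_⟩
  have hN0 : (0 : ℝ) < N := by exact_mod_cast hN
  obtain ⟨τ, hτ⟩ := F.exists_real_coord fun w => (t w - F.σ w ρ) / N
  set H' := β⁻¹ * H / N with hH'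
  have h1 : 1 ≤ H' := (one_le_div hN0).2 hH
  let s₀ := Fintype.piFinset fun i => Finset.Icc ⌈τ i - H'⌉ ⌊τ i + H'⌋
  have hinj : Function.Injective fun h : ι → ℤ => ρ + N * F.ofCoord h := by
    intro h h' heq
    have h2 : N • F.ofCoord h = N • F.ofCoord h' := by
      simpa [nsmul_eq_mul] using heq
    funext i
    have h3 := congrArg (fun x => F.basis.repr x i) h2
    simp only [map_nsmul, Finsupp.smul_apply, F.repr_ofCoord] at h3
    exact smul_right_injective ℤ hN.ne' h3
  refine ⟨s₀.image fun h => ρ + N * F.ofCoord h, ?_, ?_⟩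
  · intro x hx
    obtain ⟨h, hh, rfl⟩ := Finset.mem_image.1 hx
    refine ⟨⟨F.ofCoord h, by ring⟩, fun w => ?_⟩
    have h2 : ∀ i, |(h i : ℝ) - τ i| ≤ H' := by
      intro i
      have h3 := Finset.mem_Icc.1 (Fintype.mem_piFinset.1 hh i)
      have h4 := Int.ceil_le.1 h3.1
      have h5 := Int.le_floor.1 h3.2
      rw [abs_le]; constructor <;> linarith
    have h6 := F.abs_sum_mul_le h2 F.abs_basis_le w
    have h7 : F.σ w (ρ + N * F.ofCoord h) - t w =
        N * ∑ i, ((h i : ℝ) - τ i) * F.σ w (F.basis i) := by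
      simp only [sub_mul, Finset.sum_sub_distrib, hτ, ofCoord, map_add, map_mul, map_natCast,
        map_sum, map_intCast]
      field_simp
      ring
    rw [h7, abs_mul, Nat.abs_cast]
    calc _ ≤ (N : ℝ) * (β * H') := mul_le_mul_of_nonneg_left h6 hN0.le
      _ = H := by rw [hH']; field_simp
  · rw [Finset.card_image_of_injective _ hinj, Fintype.card_piFinset, ← F.card_eq,
      ← Finset.card_univ, ← Finset.prod_const]
    push_cast
    refine Finset.prod_le_prod (fun _ _ => by positivity) fun i _ => ?_
    rw [Int.card_Icc]
    have h2 : ((⌊τ i + H'⌋ + 1 - ⌈τ i - H'⌉ : ℤ) : ℝ) ≤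
        ((⌊τ i + H'⌋ + 1 - ⌈τ i - H'⌉).toNat : ℝ) := by exact_mod_cast Int.self_le_toNat _
    refine le_trans ?_ h2
    push_cast
    have h3 := Int.lt_floor_add_one (τ i + H')
    have h4 := Int.ceil_lt_add_one (τ i - H')
    linarith

end TraceFrame

end LatticePoints

section Fibre

lemma exists_root_of_le {α L q a μ M r : ℝ} (hμ : 0 < μ) (hμα : μ ≤ α) (hαM : α ≤ M) (hM : 1 ≤ M)
    (hr : 0 ≤ r) (hL : |L| ≤ M * r) (hq : |q| ≤ r ^ 2) (hqa : q ≤ a) (ha : a ≤ r ^ 2) :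
    ∃ s, q + s * L + s ^ 2 * α = a ∧ |s| ≤ 2 * M * r / μ := by
  have hα : 0 < α := hμ.trans_le hμα
  set d := L ^ 2 + 4 * α * (a - q) with hd
  have hd0 : 0 ≤ d := by
    have : 0 ≤ α * (a - q) := mul_nonneg hα.le (sub_nonneg.2 hqa)
    nlinarith [sq_nonneg L]
  have hd1 : d ≤ (3 * M * r) ^ 2 := by
    have h1 : L ^ 2 ≤ (M * r) ^ 2 := sq_le_sq.2 (by rwa [abs_of_nonneg (by positivity : 0 ≤ M * r)])
    have h2 : a - q ≤ 2 * r ^ 2 := by linarith [neg_abs_le q]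
    have h3 : α * (a - q) ≤ M * (2 * r ^ 2) := mul_le_mul hαM h2 (sub_nonneg.2 hqa) (by linarith)
    have h4 : M * r ^ 2 ≤ M * (M * r ^ 2) :=
      mul_le_mul_of_nonneg_left (le_mul_of_one_le_left (sq_nonneg r) hM) (by linarith)
    nlinarith
  have hsq : Real.sqrt d ≤ 3 * M * r := by
    rw [← Real.sqrt_sq (by positivity : 0 ≤ 3 * M * r)]
    exact Real.sqrt_le_sqrt hd1
  refine ⟨(-L + Real.sqrt d) / (2 * α), ?_, ?_⟩
  · have h := Real.sq_sqrt hd0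
    field_simp
    nlinarith
  · rw [abs_div, abs_of_pos (by positivity : 0 < 2 * α), div_le_div_iff₀ (by positivity) hμ]
    have h1 : |-L + Real.sqrt d| ≤ 4 * M * r := by
      refine (abs_add_le _ _).trans ?_
      rw [abs_neg, abs_of_nonneg (Real.sqrt_nonneg d)]
      linarith
    calc _ ≤ 4 * M * r * α := mul_le_mul h1 hμα hμ.le (by positivity)
      _ = _ := by ring

namespace TraceFrame

variable {O ι W κ : Type*} [CommRing O] [Fintype ι] [Fintype W] [Nonempty W] [Fintype κ]
  [DecidableEq κ] (F : TraceFrame O ι W)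

set_option maxHeartbeats 2000000 in
/-- In every residue class there are many vectors on which the form is close to a given element. -/
lemma exists_finset_qf_near (C : Matrix κ κ O) (k₀ : κ) (hC : ∀ w, 0 < F.σ w (C k₀ k₀)) {R : ℝ}
    (hR : 1 ≤ R) : ∃ lam : ℝ, 0 < lam ∧ ∃ c : ℝ, 0 < c ∧ ∀ N P T : ℕ, 0 < N → 0 < P → N ≤ c * P →
      P ≤ c * T → N * T ≤ P ^ 2 → ∀ (ρ : κ → O) (a : O),
      (∀ w, lam * P ^ 2 ≤ R * F.σ w a ∧ F.σ w a ≤ lam * P ^ 2) →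
      ∃ Z : Finset (κ → O), (∀ x ∈ Z, (∀ k, (N : O) ∣ x k - ρ k) ∧
        (∀ k j, |(F.basis.repr (x k) j : ℝ)| ≤ P) ∧
        ∀ j, |(F.basis.repr (qf C x - a) j : ℝ)| ≤ N * T) ∧
      ((c * P / N) ^ (Fintype.card κ - 1) * (c * T / P)) ^ Fintype.card W ≤ (Z.card : ℝ) := by
  classical
  obtain ⟨cL, hcL, hnear⟩ := F.exists_finset_near
  obtain ⟨w₀, hw₀⟩ := Finite.exists_min fun w => F.σ w (C k₀ k₀)
  set μ := F.σ w₀ (C k₀ k₀)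
  have hμ : 0 < μ := hC w₀
  let m : W → ℝ := fun w => |F.σ w (C k₀ k₀)| + ∑ j, |F.σ w ((C + Cᵀ) k₀ j)| +
    ∑ k, ∑ j, |F.σ w (C k j)|
  obtain ⟨w₁, hw₁⟩ := Finite.exists_max m
  set M := 1 + m w₁
  have hm0 : 0 ≤ m w₁ := by positivity
  have hM : 1 ≤ M := by simp only [M]; linarith
  have hM0 : 0 < M := by linarith
  have hα : ∀ w, F.σ w (C k₀ k₀) ≤ M := fun w => by
    have h1 : |F.σ w (C k₀ k₀)| ≤ m w := by
      simp only [m]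
      have : 0 ≤ ∑ j, |F.σ w ((C + Cᵀ) k₀ j)| := by positivity
      have : 0 ≤ ∑ k, ∑ j, |F.σ w (C k j)| := by positivity
      linarith
    linarith [le_abs_self (F.σ w (C k₀ k₀)), hw₁ w]
  have hlin : ∀ w, ∑ j, |F.σ w ((C + Cᵀ) k₀ j)| ≤ M := fun w => by
    have h1 : ∑ j, |F.σ w ((C + Cᵀ) k₀ j)| ≤ m w := by
      simp only [m]
      have : 0 ≤ ∑ k, ∑ j, |F.σ w (C k j)| := by positivity
      linarith [abs_nonneg (F.σ w (C k₀ k₀))]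
    linarith [hw₁ w]
  have hquad : ∀ w, ∑ k, ∑ j, |F.σ w (C k j)| ≤ M := fun w => by
    have h1 : ∑ k, ∑ j, |F.σ w (C k j)| ≤ m w := by
      simp only [m]
      have : 0 ≤ ∑ j, |F.σ w ((C + Cᵀ) k₀ j)| := by positivity
      linarith [abs_nonneg (F.σ w (C k₀ k₀))]
    linarith [hw₁ w]
  have hμM : μ ≤ M := hα w₀
  set B := F.bound
  have hB : 1 ≤ B := F.one_le_bound
  have hB0 : 0 < B := by linarith
  set ν := μ / (4 * M * B) with hν
  have hν0 : 0 < ν := by positivity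
  have hνB : ν * (4 * M * B) = μ := by rw [hν]; field_simp
  set c₅ := ν / (M * R)
  have hc₅ : 0 < c₅ := by positivity
  have hc₅ν : c₅ * (M * R) = ν := by simp only [c₅]; field_simp
  have hMR : 1 ≤ M * R := one_le_mul_of_one_le_of_one_le hM hR
  have hc₅le : c₅ ≤ ν := by nlinarith
  have hν1 : B * ν ≤ 1 := by nlinarith
  set c₉ := 1 / (3 * M * B) with hc₉
  have hc₉0 : 0 < c₉ := by positivity
  refine ⟨ν ^ 2, by positivity, cL * min c₅ c₉, by positivity,
    fun N P T hN hP hNP hPT hNT ρ a ha => ?_⟩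
  have hN0 : (0 : ℝ) < N := by exact_mod_cast hN
  have hP0 : (0 : ℝ) < P := by exact_mod_cast hP
  have hT0 : (0 : ℝ) ≤ T := Nat.cast_nonneg _
  have hNT' : (N : ℝ) * T ≤ P ^ 2 := by exact_mod_cast hNT
  have hmin5 : min c₅ c₉ ≤ c₅ := min_le_left _ _
  have hmin9 : min c₅ c₉ ≤ c₉ := min_le_right _ _
  set η := c₉ * (N * T / P) with hη
  have hη0 : 0 ≤ η := by positivity
  have hηP : η ≤ P / (2 * B) := by
    have h1 : (N : ℝ) * T / P ≤ P := by
      rw [div_le_iff₀ hP0]; nlinarith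
    have h2 : c₉ ≤ 1 / (2 * B) := by
      rw [hc₉]
      refine one_div_le_one_div_of_le (by positivity) ?_
      nlinarith
    calc η ≤ 1 / (2 * B) * P := mul_le_mul h2 h1 (by positivity) (by positivity)
      _ = _ := by ring
  -- the coordinates other than `k₀`
  choose s hs hscard using fun k => hnear N hN (ρ k) 0 (c₅ * P) (by
    refine hNP.trans ?_
    rw [← mul_assoc]
    gcongr)
  let Y := Fintype.piFinset fun k => if k = k₀ then {0} else s k
  have hY : ∀ y ∈ Y, y k₀ = 0 ∧ ∀ k ≠ k₀, y k ∈ s k := by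
    intro y hy
    have h1 := fun k => Fintype.mem_piFinset.1 hy k
    refine ⟨by simpa using h1 k₀, fun k hk => by simpa [hk] using h1 k⟩
  have hYb : ∀ y ∈ Y, ∀ w k, |F.σ w (y k)| ≤ c₅ * P := by
    intro y hy w k
    by_cases hk : k = k₀
    · rw [hk, (hY y hy).1, map_zero, abs_zero]; positivity
    · simpa using (hs k _ ((hY y hy).2 k hk)).2 w
  have hYcard : ((cL * (c₅ * P) / N) ^ Fintype.card W) ^ (Fintype.card κ - 1) ≤ (Y.card : ℝ) := by
    rw [Fintype.card_piFinset, ← Finset.mul_prod_erase _ _ (Finset.mem_univ k₀), if_pos rfl,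
      Finset.card_singleton, one_mul, ← Finset.card_univ (α := κ),
      ← Finset.card_erase_of_mem (Finset.mem_univ k₀), ← Finset.prod_const]
    push_cast
    refine Finset.prod_le_prod (fun _ _ => by positivity) fun k hk => ?_
    rw [if_neg (Finset.ne_of_mem_erase hk)]
    exact hscard k
  -- the real root
  have hlinY : ∀ y ∈ Y, ∀ w, |F.σ w (((C + Cᵀ) *ᵥ y) k₀)| ≤ M * (c₅ * P) := by
    intro y hy w
    simp only [Matrix.mulVec, dotProduct, map_sum, map_mul]
    refine (Finset.abs_sum_le_sum_abs _ _).trans (le_trans ?_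
      (mul_le_mul_of_nonneg_right (hlin w) (by positivity)))
    rw [Finset.sum_mul]
    refine Finset.sum_le_sum fun j _ => ?_
    rw [abs_mul]
    exact mul_le_mul_of_nonneg_left (hYb y hy w j) (abs_nonneg _)
  have hquadY : ∀ y ∈ Y, ∀ w, |F.σ w (qf C y)| ≤ M * (c₅ * P) ^ 2 := fun y hy w =>
    (abs_map_qf_le _ C (hYb y hy w)).trans
      (mul_le_mul_of_nonneg_right (hquad w) (by positivity))
  have hroot : ∀ y ∈ Y, ∀ w, ∃ t : ℝ, F.σ w (qf C y) + t * F.σ w (((C + Cᵀ) *ᵥ y) k₀) +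
      t ^ 2 * F.σ w (C k₀ k₀) = F.σ w a ∧ |t| ≤ P / (2 * B) := by
    intro y hy w
    have h1 : M * (c₅ * P) ^ 2 ≤ (ν * P) ^ 2 / R := by
      rw [le_div_iff₀ (by linarith)]
      have h2 : M * (c₅ * P) ^ 2 * R = c₅ * ν * P ^ 2 := by rw [← hc₅ν]; ring
      rw [h2]
      calc c₅ * ν * P ^ 2 ≤ ν * ν * P ^ 2 := by gcongr
        _ = (ν * P) ^ 2 := by ring
    have h3 : (ν * P) ^ 2 / R ≤ F.σ w a := by
      rw [div_le_iff₀ (by linarith)]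
      linarith [(ha w).1]
    have h4 : (ν * P) ^ 2 / R ≤ (ν * P) ^ 2 := div_le_self (by positivity) hR
    obtain ⟨t, ht, ht'⟩ := exists_root_of_le (r := ν * P) hμ (hw₀ w) (hα w) hM (by positivity)
      ((hlinY y hy w).trans (by gcongr)) ((hquadY y hy w).trans (h1.trans h4))
      ((le_abs_self _).trans ((hquadY y hy w).trans (h1.trans h3)))
      (by linarith [(ha w).2])
    refine ⟨t, ht, ht'.trans_eq ?_⟩
    rw [← hνB]
    field_simp
    norm_num
  choose! t ht ht' using hroot
  choose S hS hScard using fun y => hnear N hN (ρ k₀) (t y) η (by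
    rw [hη, mul_left_comm, ← mul_assoc, mul_div_assoc', mul_comm c₉, le_div_iff₀ hP0]
    calc (N : ℝ) * P ≤ N * (cL * min c₅ c₉ * T) := by gcongr
      _ ≤ N * (cL * c₉ * T) := by gcongr
      _ = _ := by ring)
  have hinj : Set.InjOn (fun p : (_ : κ → O) × O => p.1 + Pi.single k₀ p.2) (Y.sigma S) := by
    rintro ⟨y, s⟩ hy ⟨y', s'⟩ hy' heq
    rw [Finset.mem_coe, Finset.mem_sigma] at hy hy'
    have h1 := (hY y hy.1).1
    have h2 := (hY y' hy'.1).1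
    have h3 : s = s' := by
      have := congrFun heq k₀
      simpa [h1, h2] using this
    subst h3
    have h4 : y = y' := add_right_cancel heq
    subst h4
    rfl
  refine ⟨(Y.sigma S).image fun p => p.1 + Pi.single k₀ p.2, fun x hx => ?_, ?_⟩
  · obtain ⟨⟨y, z⟩, hyz, rfl⟩ := Finset.mem_image.1 hx
    obtain ⟨hy, hz⟩ := Finset.mem_sigma.1 hyz
    obtain ⟨hz1, hz2⟩ := hS y z hz
    have hzb : ∀ w, |F.σ w z| ≤ P / B := fun w => by
      have h1 : F.σ w z = (F.σ w z - t y w) + t y w := by ring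
      rw [h1]
      refine (abs_add_le _ _).trans ((add_le_add ((hz2 w).trans hηP) (ht' y hy w)).trans_eq ?_)
      field_simp
      norm_num
    refine ⟨fun k => ?_, fun k j => ?_, fun j => ?_⟩
    · by_cases hk : k = k₀
      · subst hk
        simpa [(hY y hy).1] using hz1
      · simpa [hk] using (hs k _ ((hY y hy).2 k hk)).1
    · by_cases hk : k = k₀
      · subst hk
        simp only [Pi.add_apply, (hY y hy).1, zero_add, Pi.single_eq_same]
        exact (F.abs_repr_le z _ hzb j).trans_eq (mul_div_cancel₀ _ hB0.ne')
      · simp only [Pi.add_apply, Pi.single_eq_of_ne hk, add_zero]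
        calc _ ≤ B * (c₅ * P) := F.abs_repr_le _ _ (fun w => hYb y hy w k) j
          _ ≤ B * (ν * P) := by gcongr
          _ = B * ν * P := by ring
          _ ≤ P := mul_le_of_le_one_left hP0.le hν1
    · refine (F.abs_repr_le _ (N * T / B) (fun w => ?_) j).trans_eq (mul_div_cancel₀ _ hB0.ne')
      have h1 : F.σ w (qf C (y + Pi.single k₀ z) - a) = (F.σ w z - t y w) *
          (F.σ w (((C + Cᵀ) *ᵥ y) k₀) + (F.σ w z + t y w) * F.σ w (C k₀ k₀)) := by
        rw [map_sub, ← ht y hy w, qf_add_single]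
        simp only [map_add, map_mul, map_pow]
        ring
      have h2 : |F.σ w z + t y w| ≤ 2 * P := by
        refine (abs_add_le _ _).trans ?_
        have h3 := hzb w
        have h4 := ht' y hy w
        have h5 : P / B ≤ (P : ℝ) := div_le_self hP0.le hB
        have h6 : P / (2 * B) ≤ (P : ℝ) := div_le_self hP0.le (by linarith)
        linarith
      have h3 : |F.σ w (((C + Cᵀ) *ᵥ y) k₀) + (F.σ w z + t y w) * F.σ w (C k₀ k₀)| ≤
          3 * M * P := by
        refine (abs_add_le _ _).trans ?_
        rw [abs_mul, abs_of_pos (hC w)]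
        have h4 : |F.σ w z + t y w| * F.σ w (C k₀ k₀) ≤ 2 * P * M :=
          mul_le_mul h2 (hα w) (hC w).le (by positivity)
        have h5 : M * (c₅ * P) ≤ M * P := by
          gcongr
          refine mul_le_of_le_one_left hP0.le
             (hc₅le.trans ((le_mul_of_one_le_left hν0.le hB).trans hν1))
        linarith [hlinY y hy w]
      rw [h1, abs_mul]
      calc _ ≤ η * (3 * M * P) := mul_le_mul (hz2 w) h3 (abs_nonneg _) hη0
        _ = _ := by rw [hη, hc₉]; field_simp
  · rw [Finset.card_image_of_injOn hinj, Finset.card_sigma]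
    push_cast
    refine le_trans ?_ (Finset.card_nsmul_le_sum _ _ _ fun y _ => hScard y)
    rw [nsmul_eq_mul, mul_pow, ← pow_mul, mul_comm (Fintype.card κ - 1), pow_mul]
    refine mul_le_mul (le_trans ?_ hYcard) ?_ (by positivity) (by positivity)
    · rw [← mul_assoc cL]
      gcongr
    · rw [hη]
      have h1 : cL * (c₉ * (N * T / P)) / N = cL * c₉ * T / P := by field_simp
      rw [h1]
      gcongr

end TraceFrame

end Fibre

section Representation

open NumberField

lemma card_pow_le_card_filter_add_eq {I : Type*} [Fintype I] [DecidableEq I] {P : ℕ} {h : I → ℤ}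
    (hh : ∀ i, |h i| ≤ P) :
    P ^ Fintype.card I ≤ ((intCube I P ×ˢ intCube I P).filter fun q => q.1 + q.2 = h).card := by
  let U := Fintype.piFinset fun i =>
    if 0 ≤ h i then Finset.Icc 0 (P : ℤ) else Finset.Icc (-(P : ℤ)) 0
  have hU : P ^ Fintype.card I ≤ U.card := by
    rw [Fintype.card_piFinset, ← Finset.card_univ, ← Finset.prod_const]
    refine Finset.prod_le_prod' fun i _ => ?_
    split_ifs <;> simp only [Int.card_Icc] <;> omega
  refine hU.trans (Finset.card_le_card_of_injOn (fun u => (u, h - u)) (fun u hu => ?_)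
    fun u _ u' _ H => congrArg Prod.fst H)
  have hu' := fun i => Fintype.mem_piFinset.1 (Finset.mem_coe.1 hu) i
  simp only [Finset.coe_filter, Finset.mem_product, mem_intCube, Set.mem_ofPred_eq,
    add_sub_cancel, and_true, Pi.sub_apply, ← forall_and]
  intro i
  have h1 := hu' i
  have h2 := abs_le.1 (hh i)
  split_ifs at h1 <;> rw [Finset.mem_Icc] at h1 <;> constructor <;> rw [abs_le] <;>
    constructor <;> omega

namespace TraceFrame

lemma card_pow_mul_le_sum_repCount {O ι W κ : Type*} [CommRing O] [Fintype ι] [Fintype W]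
    [Fintype κ] [DecidableEq ι] [DecidableEq κ] (F : TraceFrame O ι W) (C : Matrix κ κ O)
    {N P T : ℕ} (hN : 0 < N) (a : O) (X : Finset (κ → O))
    (hX : ∀ x ∈ X, (∀ k j, |(F.basis.repr (x k) j : ℝ)| ≤ P) ∧
      (∀ j, |(F.basis.repr (qf C x - a) j : ℝ)| ≤ N * T) ∧ (N : O) ∣ qf C x - a) :
    P ^ (Fintype.card κ * Fintype.card ι) * X.card ≤
      ∑ b ∈ intCube ι T, F.repCount C P (a + N * F.ofCoord b) := by
  classical
  let S := (intCube (κ × ι) P ×ˢ intCube (κ × ι) P).filter fun q => F.vec q.1 + F.vec q.2 ∈ X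
  have h1 : P ^ (Fintype.card κ * Fintype.card ι) * X.card ≤ S.card := by
    rw [mul_comm, Finset.card_eq_sum_card_fiberwise (s := S) (t := X)
      (f := fun q => F.vec q.1 + F.vec q.2) fun q hq => (Finset.mem_filter.1 hq).2, ← smul_eq_mul]
    refine Finset.card_nsmul_le_sum _ _ _ fun x hx => ?_
    rw [← Fintype.card_prod]
    let h : κ × ι → ℤ := fun p => F.basis.repr (x p.1) p.2
    have hx' : F.vec h = x := funext fun k => F.ofCoord_repr (x k)
    refine (card_pow_le_card_filter_add_eq (h := h) fun p => ?_).trans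
      (Finset.card_le_card fun q hq => ?_)
    · exact_mod_cast (hX x hx).1 p.1 p.2
    · obtain ⟨hq1, hq2⟩ := Finset.mem_filter.1 hq
      have h2 : F.vec q.1 + F.vec q.2 = x := by
        rw [eq_sub_of_add_eq' hq2, F.vec_sub, hx', add_sub_cancel]
      exact Finset.mem_filter.2 ⟨Finset.mem_filter.2 ⟨hq1, h2 ▸ hx⟩, h2⟩
  refine h1.trans (le_trans (Finset.card_le_card ?_) Finset.card_biUnion_le)
  intro q hq
  obtain ⟨hq1, hq2⟩ := Finset.mem_filter.1 hq
  obtain ⟨-, hb, c, hc⟩ := hX _ hq2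
  refine Finset.mem_biUnion.2 ⟨fun i => F.basis.repr c i, mem_intCube.2 fun i => ?_,
    Finset.mem_filter.2 ⟨hq1, ?_⟩⟩
  · have h2 := hb i
    rw [hc, ← nsmul_eq_mul, map_nsmul, Finsupp.smul_apply] at h2
    push_cast [nsmul_eq_mul] at h2
    rw [abs_mul, Nat.abs_cast] at h2
    exact_mod_cast le_of_mul_le_mul_left h2 (by exact_mod_cast hN)
  · rw [F.ofCoord_repr, ← hc, add_sub_cancel]

variable {K : Type*} [Field K] [NumberField K] {ι W κ : Type*} [Fintype ι] [Fintype W]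
  [Fintype κ] [DecidableEq κ]

lemma solCount_mul_le_sum_repCount [DecidableEq ι] (F : TraceFrame (𝓞 K) ι W)
    (C : Matrix κ κ (𝓞 K)) {N P T : ℕ} (hN : 0 < N) (a : 𝓞 K) {y : ℝ}
    (h : ∀ ρ : κ → 𝓞 K, ∃ Z : Finset (κ → 𝓞 K), (∀ x ∈ Z, (∀ k, (N : 𝓞 K) ∣ x k - ρ k) ∧
        (∀ k j, |(F.basis.repr (x k) j : ℝ)| ≤ P) ∧
        ∀ j, |(F.basis.repr (qf C x - a) j : ℝ)| ≤ N * T) ∧ y ≤ (Z.card : ℝ)) :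
    P ^ (Fintype.card κ * Fintype.card ι) * (solCount C (Ideal.span {(N : 𝓞 K)}) a * y) ≤
      ∑ b ∈ intCube ι T, (F.repCount C P (a + N * F.ofCoord b) : ℝ) := by
  classical
  set I := Ideal.span {(N : 𝓞 K)}
  have hI : I ≠ ⊥ := by
    rw [Ne, Ideal.span_singleton_eq_bot]
    exact_mod_cast hN.ne'
  have : Finite (𝓞 K ⧸ I) := Ideal.finiteQuotientOfFreeOfNeBot I hI
  choose Z hZ hZy using h
  have := Fintype.ofFinite {x : κ → 𝓞 K ⧸ I // qf (C.map (Ideal.Quotient.mk I)) x =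
    Ideal.Quotient.mk I a}
  let out : (κ → 𝓞 K ⧸ I) → κ → 𝓞 K := fun s k => (s k).out
  have hout : ∀ s k, Ideal.Quotient.mk I (out s k) = s k := fun s k => Ideal.Quotient.mk_out _
  have hmk : ∀ s, ∀ x ∈ Z (out s), ∀ k, Ideal.Quotient.mk I (x k) = s k := fun s x hx k => by
    rw [← hout s k, Ideal.Quotient.mk_eq_mk_iff_sub_mem, Ideal.mem_span_singleton]
    exact (hZ _ x hx).1 k
  let X := (Finset.univ : Finset {x : κ → 𝓞 K ⧸ I // qf (C.map (Ideal.Quotient.mk I)) x =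
    Ideal.Quotient.mk I a}).biUnion fun s => Z (out s)
  have hXcard : solCount C I a * y ≤ (X.card : ℝ) := by
    rw [Finset.card_biUnion]
    · rw [solCount, Nat.card_eq_fintype_card, ← Finset.card_univ, ← nsmul_eq_mul]
      push_cast
      exact Finset.card_nsmul_le_sum _ _ _ fun s _ => hZy _
    · intro s _ s' _ hss
      refine Finset.disjoint_left.2 fun x hx hx' => hss (Subtype.ext (funext fun k => ?_))
      rw [← hmk _ x hx k, hmk _ x hx' k]
  have hX := F.card_pow_mul_le_sum_repCount C (P := P) (T := T) hN a X fun x hx => by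
    obtain ⟨s, -, hs⟩ := Finset.mem_biUnion.1 hx
    obtain ⟨h1, h2, h3⟩ := hZ _ x hs
    refine ⟨h2, h3, ?_⟩
    rw [← Ideal.mem_span_singleton, ← Ideal.Quotient.mk_eq_mk_iff_sub_mem, ← s.2, map_qf]
    congr 1
    exact funext fun k => hmk _ x hs k
  refine (mul_le_mul_of_nonneg_left hXcard (by positivity)).trans ?_
  exact_mod_cast hX

/-- A locally represented element in a cone around the positive diagonal whose size is essentially
a large power of `16` is represented. -/
theorem exists_qf_eq_of_locallyRepresented [Nonempty W] (F : TraceFrame (𝓞 K) ι W)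
    {C : Matrix κ κ (𝓞 K)}
    (hdet : (C + Cᵀ).det ≠ 0) (hn : 5 ≤ Fintype.card κ) (k₀ : κ) (hC : ∀ w, 0 < F.σ w (C k₀ k₀))
    {R : ℝ} (hR : 1 ≤ R) : ∃ lam : ℝ, 0 < lam ∧ ∃ i₀ : ℕ, ∀ i, i₀ ≤ i → ∀ a : 𝓞 K,
      LocallyRepresented C a → (∀ w, lam * 16 ^ i ≤ R * F.σ w a ∧ F.σ w a ≤ lam * 16 ^ i) →
      ∃ x, qf C x = a := by
  classical
  obtain ⟨δ, hδ, hdens⟩ := exists_density hn hdet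
  obtain ⟨lam, hlam, c, hc, hnear⟩ := F.exists_finset_qf_near C k₀ hC hR
  set n := Fintype.card κ
  set D := Fintype.card W with hD
  set ε := δ * (c ^ n / 3) ^ D / 2 with hε
  have hε0 : 0 < ε := by positivity
  obtain ⟨N, g, i₀, hN, hNg, hg, hcirc⟩ :=
    F.exists_sum_repCount_le hdet hn (F.bound * lam) hε0 1
  have hnorm : (Ideal.absNorm (Ideal.span {(N : 𝓞 K)}) : ℝ) = (N : ℝ) ^ D := by
    have h1 : Module.finrank ℤ (𝓞 K) = D := by
      rw [Module.finrank_eq_card_basis F.basis, F.card_eq]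
    have h2 := Algebra.norm_algebraMap_of_basis F.basis (N : ℤ)
    rw [F.card_eq] at h2
    rw [Ideal.absNorm_span_singleton]
    have h3 : (N : 𝓞 K) = algebraMap ℤ (𝓞 K) N := by simp
    rw [h3, h2]
    simp [hD]
  obtain ⟨i₁, hi₁⟩ := pow_unbounded_of_one_lt (max (N / c) (16 ^ g / c)) (by norm_num : (1 : ℝ) < 4)
  refine ⟨lam, hlam, max i₀ i₁, fun i hi a hloc ha => ?_⟩
  obtain ⟨hi0, hi1⟩ := max_le_iff.1 hi
  set P := 4 ^ i with hP
  set T := 16 ^ (i - g) with hT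
  have hTg : (T : ℝ) * 16 ^ g = 16 ^ i := by
    rw [hT]
    push_cast
    rw [← pow_add, Nat.sub_add_cancel (hg.trans hi0)]
  have hP2 : (P : ℝ) ^ 2 = 16 ^ i := by
    rw [hP]
    push_cast
    rw [← pow_mul, mul_comm, pow_mul]
    norm_num
  have hP0 : (0 : ℝ) < P := by simp [hP]
  have hT1 : (1 : ℝ) ≤ T := by exact_mod_cast Nat.one_le_pow _ _ (by norm_num)
  have hN0 : (0 : ℝ) < N := by exact_mod_cast hN
  have h4 : max ((N : ℝ) / c) (16 ^ g / c) ≤ P := by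
    refine hi₁.le.trans ?_
    rw [hP]
    push_cast
    exact pow_le_pow_right₀ (by norm_num) hi1
  obtain ⟨h4N, h4g⟩ := max_le_iff.1 h4
  rw [div_le_iff₀ hc] at h4N h4g
  have hNP : (N : ℝ) ≤ c * P := by linarith
  have hPT : (P : ℝ) ≤ c * T := by
    have h5 : (P : ℝ) * 16 ^ g ≤ c * T * 16 ^ g := by
      calc (P : ℝ) * 16 ^ g ≤ P * (P * c) := by gcongr
        _ = c * P ^ 2 := by ring
        _ = c * T * 16 ^ g := by rw [hP2, ← hTg]; ring
    exact le_of_mul_le_mul_right h5 (by positivity)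
  have hNT : N * T ≤ P ^ 2 := by
    have h5 : (N : ℝ) * T ≤ P ^ 2 := by
      rw [hP2, ← hTg, mul_comm]
      gcongr
      have : (N : ℝ) * (1 : ℕ) ≤ 16 ^ g := by exact_mod_cast hNg
      simpa using this
    exact_mod_cast h5
  have hlow := F.solCount_mul_le_sum_repCount C (P := P) (T := T) hN a
    fun ρ => hnear N P T hN (by positivity) hNP hPT hNT ρ a fun w => by
      rw [hP2]
      exact ha w
  have hup := hcirc i hi0 a fun j => by
    rw [mul_assoc]
    refine F.abs_repr_le a _ (fun w => ?_) j
    have h5 : 0 ≤ R * F.σ w a := le_trans (by positivity) (ha w).1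
    rw [abs_of_nonneg (nonneg_of_mul_nonneg_right h5 (by linarith))]
    exact (ha w).2
  have hsol := hdens (Ideal.span {(N : 𝓞 K)}) (by
    rw [Ne, Ideal.span_singleton_eq_bot]
    exact_mod_cast hN.ne') a hloc
  rw [hnorm] at hsol
  set r := F.repCount C P a with hr
  have hr0 : 0 < r := by
    by_contra hr0
    have h6 : (r : ℝ) = 0 := by exact_mod_cast Nat.le_zero.1 (not_lt.1 hr0)
    rw [h6, zero_add] at hup
    have h7 := hlow.trans hup
    rw [card_intCube] at h7
    have h8 : (((2 * T + 1) ^ Fintype.card ι : ℕ) : ℝ) ≤ (3 * T) ^ D := by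
      rw [F.card_eq]
      push_cast
      gcongr
      linarith
    obtain ⟨k, hk⟩ : ∃ k, n = k + 1 := ⟨n - 1, by omega⟩
    have h9 : (P : ℝ) ^ (n * Fintype.card ι) * (δ * ((N : ℝ) ^ D) ^ (n - 1) *
        ((c * P / N) ^ (n - 1) * (c * T / P)) ^ D) =
        2 * (ε * ((3 * T) ^ D * (((16 : ℝ) ^ i) ^ (n - 1)) ^ D)) := by
      rw [hε, F.card_eq, ← hP2, hk, Nat.add_sub_cancel]
      have e1 : (c * P / N) ^ k * (c * T / P) = c ^ (k + 1) * (P ^ k * T / (N ^ k * P)) := by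
        rw [div_pow]; field_simp; ring
      have e2 : (P : ℝ) ^ ((k + 1) * D) = (P ^ (k + 1)) ^ D := pow_mul _ _ _
      have e3 : ((N : ℝ) ^ D) ^ k = (N ^ k) ^ D := by rw [← pow_mul, mul_comm, pow_mul]
      rw [e1, e2, e3]
      have e4 : (P : ℝ) ^ (k + 1) * (N ^ k * (c ^ (k + 1) * (P ^ k * T / (N ^ k * P)))) =
          c ^ (k + 1) / 3 * (3 * T * (P ^ 2) ^ k) := by
        field_simp; ring
      calc _ = δ * (P ^ (k + 1) * (N ^ k * (c ^ (k + 1) * (P ^ k * T / (N ^ k * P))))) ^ D := by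
            rw [mul_pow, mul_pow]; ring
        _ = _ := by rw [e4, mul_pow, mul_pow]; ring
    have h10 : (P : ℝ) ^ (n * Fintype.card ι) * (δ * ((N : ℝ) ^ D) ^ (n - 1) *
        ((c * P / N) ^ (n - 1) * (c * T / P)) ^ D) ≤
        ε * ((3 * T) ^ D * (((16 : ℝ) ^ i) ^ (n - 1)) ^ D) := by
      refine le_trans (le_trans ?_ h7) ?_
      · gcongr
      · rw [mul_left_comm]
        gcongr
    have h11 : 0 < ε * ((3 * T) ^ D * (((16 : ℝ) ^ i) ^ (n - 1)) ^ D) := by positivity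
    linarith
  obtain ⟨q, hq⟩ := Finset.card_pos.1 hr0
  exact ⟨_, (Finset.mem_filter.1 hq).2⟩

end TraceFrame

end Representation

section TotallyReal

open NumberField Module

/-- A ring homomorphism to `ℂ` with real values, as a ring homomorphism to `ℝ`. -/
def RingHom.toReal {A : Type*} [Semiring A] (φ : A →+* ℂ) (h : ∀ x, (φ x).im = 0) : A →+* ℝ where
  toFun x := (φ x).re
  map_one' := by simp
  map_mul' x y := by simp [h]
  map_zero' := by simp
  map_add' x y := by simp

lemma RingHom.ofReal_toReal {A : Type*} [Semiring A] (φ : A →+* ℂ) (h : ∀ x, (φ x).im = 0)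
    (x : A) : (φ.toReal h x : ℂ) = φ x := Complex.ext rfl (h x).symm

lemma RingHom.abs_toReal {A : Type*} [Semiring A] (φ : A →+* ℂ) (h : ∀ x, (φ x).im = 0) (x : A) :
    |φ.toReal h x| = ‖φ x‖ := by
  rw [← φ.ofReal_toReal h, Complex.norm_real, Real.norm_eq_abs]

variable {K : Type*} [Field K] [NumberField K]

lemma exists_natCast_smul_traceDual_eq {ι : Type*} [Fintype ι] [DecidableEq ι] (b : Basis ι ℚ K) :
    ∃ (Δ : ℕ) (c : ι → 𝓞 K), 0 < Δ ∧ ∀ i, algebraMap (𝓞 K) K (c i) = Δ * b.traceDual i := by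
  classical
  have : Algebra.IsAlgebraic ℤ K := (IsFractionRing.comap_isAlgebraic_iff (K := ℚ)).2 inferInstance
  obtain ⟨y, hy, h⟩ := Algebra.IsAlgebraic.exists_integral_multiples ℤ
    (Finset.univ.image b.traceDual)
  have h' : ∀ i, IsIntegral ℤ (y.natAbs • b.traceDual i) := fun i => by
    have h1 := h _ (Finset.mem_image_of_mem _ (Finset.mem_univ i))
    rcases Int.natAbs_eq y with h2 | h2
    · rwa [h2, natCast_zsmul] at h1
    · rw [h2, neg_smul, natCast_zsmul] at h1
      simpa using h1.neg
  refine ⟨y.natAbs, fun i => ⟨_, h' i⟩, Int.natAbs_pos.2 hy, fun i => ?_⟩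
  exact nsmul_eq_mul _ _

lemma exists_traceFrame (hK : ∀ φ : K →+* ℂ, ∀ x : K, (φ x).im = 0) :
    ∃ F : TraceFrame (𝓞 K) (Free.ChooseBasisIndex ℤ (𝓞 K)) (K →ₐ[ℚ] ℂ), ∀ φ x,
      F.σ φ x = (φ : K →+* ℂ).toReal (hK φ) x := by
  classical
  let b := integralBasis K
  obtain ⟨Δ, c, hΔ, hc⟩ := exists_natCast_smul_traceDual_eq b
  let σ : (K →ₐ[ℚ] ℂ) → 𝓞 K →+* ℝ := fun φ =>
    ((φ : K →+* ℂ).toReal (hK φ)).comp (algebraMap (𝓞 K) K)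
  have hint : ∀ x : 𝓞 K, ((Algebra.trace ℤ (𝓞 K) x : ℤ) : ℚ) =
      Algebra.trace ℚ K (algebraMap (𝓞 K) K x) := fun x => Algebra.coe_trace_int x
  have htr : ∀ x : 𝓞 K, (Algebra.trace ℤ (𝓞 K) x : ℝ) = ∑ φ, σ φ x := fun x => by
    have h1 := trace_eq_sum_embeddings (K := ℚ) (L := K) ℂ (x := algebraMap (𝓞 K) K x)
    rw [← hint] at h1
    have h2 : ((Algebra.trace ℤ (𝓞 K) x : ℝ) : ℂ) = ((∑ φ, σ φ x : ℝ) : ℂ) := by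
      rw [Complex.ofReal_sum]
      simpa [σ, RingHom.ofReal_toReal] using h1
    exact_mod_cast h2
  have hdual : ∀ i x, Algebra.trace ℤ (𝓞 K) (c i * x) = Δ * (RingOfIntegers.basis K).repr x i := by
    intro i x
    have h1 : ((Algebra.trace ℤ (𝓞 K) (c i * x) : ℤ) : ℚ) =
        ((Δ * (RingOfIntegers.basis K).repr x i : ℤ) : ℚ) := by
      rw [hint, map_mul]
      have h2 := b.traceDual.traceDual_repr_apply (algebraMap (𝓞 K) K x) i
      rw [Basis.traceDual_traceDual, integralBasis_repr_apply, Algebra.traceForm_apply] at h2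
      rw [hc, mul_assoc, ← nsmul_eq_mul, map_nsmul, mul_comm (b.traceDual i), ← h2, nsmul_eq_mul]
      simp
    exact_mod_cast h1
  let B : ℝ := 1 + ∑ φ, ∑ i, |σ φ (RingOfIntegers.basis K i)| + ∑ φ, ∑ i, |σ φ (c i)|
  have hs1 : 0 ≤ ∑ φ, ∑ i, |σ φ (RingOfIntegers.basis K i)| := by positivity
  have hs2 : 0 ≤ ∑ φ, ∑ i, |σ φ (c i)| := by positivity
  have hle : ∀ f : (K →ₐ[ℚ] ℂ) → Free.ChooseBasisIndex ℤ (𝓞 K) → ℝ, (∀ φ i, 0 ≤ f φ i) →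
      ∀ φ i, f φ i ≤ ∑ φ, ∑ i, f φ i := fun f hf φ i =>
    (Finset.single_le_sum (fun j _ => hf φ j) (Finset.mem_univ i)).trans
      (Finset.single_le_sum (f := fun φ => ∑ i, f φ i)
        (fun ψ _ => Finset.sum_nonneg fun j _ => hf ψ j) (Finset.mem_univ φ))
  refine ⟨{ basis := RingOfIntegers.basis K
            σ := σ
            discrete := fun x hx => ?_
            card_eq := ?_
            tr := (Algebra.trace ℤ (𝓞 K)).toAddMonoidHom
            tr_eq := htr
            dual := c
            Δ := Δ
            Δ_pos := hΔ
            tr_dual_mul := hdual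
            sum_tr_mul_dual := fun x => ?_
            bound := B
            one_le_bound := ?_
            abs_basis_le := fun φ i => ?_
            abs_dual_le := fun φ i => ?_
            abs_repr_le := fun x M hM i => ?_ }, fun _ _ => rfl⟩
  · have h1 := Algebra.norm_eq_prod_embeddings ℚ (L := K) ℂ (x : K)
    have h2 : ∏ φ, |σ φ x| = |(Algebra.norm ℤ x : ℝ)| := by
      have h3 := congrArg norm h1
      rw [norm_prod, ← Algebra.coe_norm_int] at h3
      simp only [σ, RingHom.comp_apply, RingHom.abs_toReal]
      simpa using h3.symm
    rw [h2]
    exact_mod_cast Int.one_le_abs (Algebra.norm_ne_zero_iff.2 hx)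
  · rw [AlgHom.card, ← RingOfIntegers.rank, finrank_eq_card_chooseBasisIndex]
  · apply RingOfIntegers.coe_injective
    have h1 := b.traceDual.sum_repr (algebraMap (𝓞 K) K x)
    simp only [Basis.traceDual_repr_apply, Algebra.traceForm_apply] at h1
    simp only [map_sum, map_mul, map_natCast]
    conv_rhs => rw [← h1, Finset.mul_sum]
    refine Finset.sum_congr rfl fun i _ => ?_
    rw [hc]
    have h2 : ((Algebra.trace ℤ (𝓞 K) (x * RingOfIntegers.basis K i) : ℤ) : ℚ) =
        Algebra.trace ℚ K (algebraMap (𝓞 K) K x * b i) := by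
      rw [hint, map_mul, integralBasis_apply]
    rw [← h2, Algebra.smul_def]
    simp
    ring
  · linarith
  · have := hle _ (fun φ i => abs_nonneg (σ φ (RingOfIntegers.basis K i))) φ i
    linarith
  · have := hle _ (fun φ i => abs_nonneg (σ φ (c i))) φ i
    linarith
  · have h1 : |((RingOfIntegers.basis K).repr x i : ℝ)| ≤
        |((Algebra.trace ℤ (𝓞 K) (c i * x) : ℤ) : ℝ)| := by
      rw [hdual]
      push_cast
      rw [abs_mul, Nat.abs_cast]
      exact le_mul_of_one_le_left (abs_nonneg _) (by exact_mod_cast hΔ)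
    have hM0 : 0 ≤ M := (abs_nonneg _).trans (hM IsAlgClosed.lift)
    refine h1.trans ?_
    rw [htr]
    refine (Finset.abs_sum_le_sum_abs _ _).trans ?_
    calc ∑ φ, |σ φ (c i * x)| ≤ ∑ φ, |σ φ (c i)| * M := Finset.sum_le_sum fun φ _ => by
          rw [map_mul, abs_mul]
          exact mul_le_mul_of_nonneg_left (hM φ) (abs_nonneg _)
      _ = (∑ φ, |σ φ (c i)|) * M := (Finset.sum_mul _ _ _).symm
      _ ≤ B * M := by
          refine mul_le_mul_of_nonneg_right ?_ hM0
          have h2 : ∑ φ, |σ φ (c i)| ≤ ∑ φ, ∑ i, |σ φ (c i)| := Finset.sum_le_sum fun φ _ =>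
            Finset.single_le_sum (f := fun i => |σ φ (c i)|) (fun _ _ => abs_nonneg _)
              (Finset.mem_univ i)
          linarith

end TotallyReal

section BalancedUnit

open NumberField NumberField.Units NumberField.Units.dirichletUnitTheorem

variable (K : Type*) [Field K] [NumberField K]

open scoped Classical in
lemma exists_norm_sub_two_nsmul_logEmbedding_le : ∃ B : ℝ, ∀ v : logSpace K, ∃ u : (𝓞 K)ˣ,
    ‖v - (2 : ℕ) • logEmbedding K (Additive.ofMul u)‖ ≤ B := by
  let b := (basisUnitLattice K).ofZLatticeBasis ℝ (unitLattice K)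
  refine ⟨2 * ∑ i, ‖b i‖, fun v => ?_⟩
  let z := ZSpan.floor b ((2 : ℝ)⁻¹ • v)
  have hz : (z : logSpace K) ∈ unitLattice K :=
    ((basisUnitLattice K).ofZLatticeBasis_span ℝ (L := unitLattice K)).le z.2
  obtain ⟨u, -, hu⟩ := hz
  refine ⟨u.toMul, ?_⟩
  have h1 : v - (2 : ℕ) • logEmbedding K (Additive.ofMul u.toMul) =
      (2 : ℝ) • ZSpan.fract b ((2 : ℝ)⁻¹ • v) := by
    rw [ZSpan.fract_apply, smul_sub, smul_inv_smul₀ two_ne_zero, ofMul_toMul,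
      show (ZSpan.floor b ((2 : ℝ)⁻¹ • v) : logSpace K) = _ from hu.symm, two_nsmul, two_smul]
    rfl
  rw [h1, norm_smul, Real.norm_two]
  exact mul_le_mul_of_nonneg_left (ZSpan.norm_fract_le b _) two_pos.le

open scoped Classical in
/-- In a totally real field, any nonzero integer can be multiplied by the square of a unit so that
its absolute values become comparable. -/
lemma exists_unit_sq_mul_balanced (hK : ∀ w : InfinitePlace K, w.IsReal) : ∃ R : ℝ, 1 ≤ R ∧
    ∀ a : 𝓞 K, a ≠ 0 → ∃ u : (𝓞 K)ˣ, ∃ y : ℝ, 0 < y ∧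
      ∀ w : InfinitePlace K, y ≤ w (((u : 𝓞 K) ^ 2 * a : 𝓞 K) : K) ∧
        w (((u : 𝓞 K) ^ 2 * a : 𝓞 K) : K) ≤ R * y := by
  obtain ⟨B, hB⟩ := exists_norm_sub_two_nsmul_logEmbedding_le K
  have hB0 : 0 ≤ B := (norm_nonneg _).trans (hB 0).choose_spec
  set D : ℝ := ((Fintype.card (InfinitePlace K) : ℕ) : ℝ) with hD
  have hD1 : 1 ≤ D := by
    rw [hD]
    exact_mod_cast (Fintype.card_pos : 0 < Fintype.card (InfinitePlace K))
  have hBD : B ≤ D * B := le_mul_of_one_le_left hB0 hD1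
  refine ⟨Real.exp (2 * (D * B)), Real.one_le_exp (by positivity), fun a ha => ?_⟩
  have hpos : ∀ (w : InfinitePlace K) (x : 𝓞 K), x ≠ 0 → 0 < w (x : K) := fun w x hx =>
    InfinitePlace.pos_iff.2 (RingOfIntegers.coe_ne_zero_iff.2 hx)
  have hmult : ∀ w : InfinitePlace K, w.mult = 1 := fun w => InfinitePlace.mult_isReal ⟨w, hK w⟩
  set l := (∑ w : InfinitePlace K, Real.log (w (a : K))) / D with hl
  obtain ⟨u, hu⟩ := hB fun w => Real.log (w.1 (a : K)) - l
  let f : InfinitePlace K → ℝ := fun w =>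
    Real.log (w (a : K)) - l - 2 * Real.log (w ((u : 𝓞 K) : K))
  have hf : ∀ w, w ≠ w₀ → |f w| ≤ B := fun w hw => by
    have h1 := (norm_le_pi_norm _ (⟨w, hw⟩ : {w : InfinitePlace K // w ≠ w₀})).trans hu
    rw [Real.norm_eq_abs] at h1
    simpa [f, logEmbedding_component, hmult, two_mul, two_nsmul] using h1
  have hsum : ∑ w, f w = 0 := by
    have h1 : ∑ w : InfinitePlace K, Real.log (w ((u : 𝓞 K) : K)) = 0 := by
      simpa [hmult] using sum_mult_mul_log u
    simp only [f, Finset.sum_sub_distrib, ← Finset.mul_sum, h1, Finset.sum_const, Finset.card_univ,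
      nsmul_eq_mul, ← hD, hl]
    field_simp
    ring
  have hf' : ∀ w, |f w| ≤ D * B := fun w => by
    by_cases hw : w = w₀
    · subst hw
      rw [← Finset.add_sum_erase _ _ (Finset.mem_univ w₀)] at hsum
      rw [eq_neg_of_add_eq_zero_left hsum, abs_neg]
      refine (Finset.abs_sum_le_sum_abs _ _).trans ((Finset.sum_le_card_nsmul _ _ B
        fun w hw => hf w (Finset.ne_of_mem_erase hw)).trans ?_)
      rw [nsmul_eq_mul]
      refine mul_le_mul_of_nonneg_right ?_ hB0
      rw [hD]
      exact_mod_cast (Finset.card_le_univ _)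
    · exact (hf w hw).trans hBD
  refine ⟨u⁻¹, Real.exp (l - D * B), Real.exp_pos _, fun w => ?_⟩
  have h1 : w (((u⁻¹ : (𝓞 K)ˣ) ^ 2 * a : 𝓞 K) : K) = Real.exp (f w + l) := by
    have hu0 := hpos w _ u.ne_zero
    have h2 : w (((u⁻¹ : (𝓞 K)ˣ) : 𝓞 K) : K) = (w ((u : 𝓞 K) : K))⁻¹ := by
      rw [← map_inv₀]
      congr 1
      refine eq_inv_of_mul_eq_one_left ?_
      rw [← map_mul, Units.inv_mul, map_one]
    rw [show f w + l = Real.log (w (a : K)) - 2 * Real.log (w ((u : 𝓞 K) : K)) by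
      simp only [f]; ring,
      Real.exp_sub, Real.exp_log (hpos w a ha), mul_comm 2, Real.exp_mul, Real.exp_log hu0]
    push_cast
    rw [map_mul, map_pow, h2]
    field_simp
    norm_cast
    ring
  have h2 := abs_le.1 (hf' w)
  rw [h1, ← Real.exp_add, Real.exp_le_exp, Real.exp_le_exp]
  constructor <;> linarith

end BalancedUnit

section FiniteExceptions

open NumberField

variable {K : Type*} [Field K]

lemma LocallyRepresented.units_sq_mul {ι : Type*} [Fintype ι] {C : Matrix ι ι (𝓞 K)} {a : 𝓞 K}
    (h : LocallyRepresented C a) (u : (𝓞 K)ˣ) : LocallyRepresented C ((u : 𝓞 K) ^ 2 * a) :=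
  fun v k => by
    obtain ⟨y, hy⟩ := h v k
    refine ⟨(u : 𝓞 K) • y, ?_⟩
    rw [qf_smul, ← mul_sub]
    exact Ideal.mul_mem_left _ _ hy

lemma exists_qf_eq_of_units_sq_mul {ι A : Type*} [Fintype ι] [CommRing A] {C : Matrix ι ι A} {a : A}
    (u : Aˣ) (h : ∃ x, qf C x = (u : A) ^ 2 * a) : ∃ x, qf C x = a := by
  obtain ⟨x, hx⟩ := h
  refine ⟨((u⁻¹ : Aˣ) : A) • x, ?_⟩
  rw [qf_smul, hx, ← mul_assoc, ← mul_pow, Units.inv_mul, one_pow, one_mul]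

/-- Up to squares of units, only finitely many totally positive locally represented integers are not
represented. -/
theorem exists_finite_exceptions [NumberField K] (hK : ∀ φ : K →+* ℂ, ∀ x : K, (φ x).im = 0)
    {κ : Type*}
    [Fintype κ] [DecidableEq κ] {C : Matrix κ κ (𝓞 K)} (hdet : (C + Cᵀ).det ≠ 0)
    (hn : 5 ≤ Fintype.card κ) (k₀ : κ)
    (hC : ∀ φ : K →+* ℂ, 0 < φ.toReal (hK φ) (algebraMap (𝓞 K) K (C k₀ k₀))) :
    ∃ E : Set (𝓞 K), E.Finite ∧ ∀ a : 𝓞 K, LocallyRepresented C a →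
      (∀ φ : K →+* ℂ, 0 < φ.toReal (hK φ) (algebraMap (𝓞 K) K a)) → (¬ ∃ x, qf C x = a) →
      ∃ u : (𝓞 K)ˣ, (u : 𝓞 K) ^ 2 * a ∈ E := by
  obtain ⟨F, hF⟩ := exists_traceFrame hK
  have hF' : ∀ φ x, F.σ φ x = (φ : K →+* ℂ).toReal (hK φ) (algebraMap (𝓞 K) K x) := hF
  have hW : Nonempty (K →ₐ[ℚ] ℂ) := ⟨(Classical.arbitrary (K →+* ℂ)).toRatAlgHom⟩
  obtain ⟨R₀, hR₀, hunit⟩ := exists_unit_sq_mul_balanced K fun w => by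
    rw [InfinitePlace.isReal_iff, ComplexEmbedding.isReal_iff]
    ext x
    exact Complex.conj_eq_iff_im.2 (hK _ x)
  obtain ⟨lam, hlam, i₀, hi₀⟩ := F.exists_qf_eq_of_locallyRepresented hdet hn k₀
    (fun w => by rw [hF']; exact hC _) (R := 16 * R₀) (by linarith)
  refine ⟨_, F.finite_abs_le (lam * 16 ^ i₀), fun a hloc hpos hrep => ?_⟩
  have ha : a ≠ 0 := by
    rintro rfl
    exact hrep ⟨0, qf_zero C⟩
  obtain ⟨u, y, hy, hu⟩ := hunit a ha
  refine ⟨u, fun w => ?_⟩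
  have hwpos : ∀ w, 0 < F.σ w ((u : 𝓞 K) ^ 2 * a) := fun w => by
    rw [map_mul, map_pow]
    refine mul_pos (sq_pos_of_ne_zero ?_) ?_
    · exact F.discrete.map_ne_zero u.ne_zero w
    · rw [hF']
      exact hpos _
  have hbd : ∀ w, y ≤ F.σ w ((u : 𝓞 K) ^ 2 * a) ∧ F.σ w ((u : 𝓞 K) ^ 2 * a) ≤ R₀ * y := fun w => by
    have h1 := hu (InfinitePlace.mk (w : K →+* ℂ))
    rw [InfinitePlace.apply] at h1
    rw [← abs_of_pos (hwpos w), hF', RingHom.abs_toReal]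
    exact h1
  rw [abs_of_pos (hwpos w)]
  by_contra! hlt
  have hex : ∃ i, i₀ ≤ i ∧ R₀ * y ≤ lam * 16 ^ i := by
    obtain ⟨i, hi⟩ := pow_unbounded_of_one_lt (R₀ * y / lam) (by norm_num : (1 : ℝ) < 16)
    refine ⟨max i i₀, le_max_right _ _, ?_⟩
    rw [div_lt_iff₀' hlam] at hi
    exact hi.le.trans (mul_le_mul_of_nonneg_left
      (pow_le_pow_right₀ (by norm_num) (le_max_left _ _)) hlam.le)
  classical
  obtain ⟨hi1, hi2⟩ := Nat.find_spec hex
  set i := Nat.find hex with hi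
  have hne : i ≠ i₀ := by
    intro h
    rw [h] at hi2
    linarith [(hbd w).2]
  obtain ⟨j, hj⟩ : ∃ j, i = j + 1 := ⟨i - 1, by omega⟩
  have hj' : lam * 16 ^ j < R₀ * y := by
    by_contra! h
    exact Nat.find_min hex (m := j) (by omega) ⟨by omega, h⟩
  refine hrep (exists_qf_eq_of_units_sq_mul u (hi₀ i hi1 _ (hloc.units_sq_mul u) fun w => ⟨?_, ?_⟩))
  · rw [hj, pow_succ]
    nlinarith [(hbd w).1]
  · exact (hbd w).2.trans hi2

end FiniteExceptions

section BoundedCoordinates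

open NumberField

variable {κ : Type*} [Fintype κ]

lemma sq_polar_le {M : Matrix κ κ ℝ} (hM : ∀ x, 0 ≤ qf M x) (x y : κ → ℝ) :
    (x ⬝ᵥ (M + Mᵀ) *ᵥ y) ^ 2 ≤ 4 * qf M x * qf M y := by
  have h := discrim_le_zero (a := qf M y) (b := x ⬝ᵥ (M + Mᵀ) *ᵥ y) (c := qf M x) fun t => by
    have h1 := hM (x + t • y)
    rw [qf_add, qf_smul, Matrix.mulVec_smul, dotProduct_smul, smul_eq_mul] at h1
    linarith
  rw [discrim] at h
  linarith

/-- The sublevel sets of a nondegenerate positive semidefinite quadratic form are bounded. -/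
lemma exists_abs_le_of_qf_le [DecidableEq κ] {M : Matrix κ κ ℝ} (hM : ∀ x, 0 ≤ qf M x)
    (hdet : (M + Mᵀ).det ≠ 0) (T : ℝ) : ∃ B : ℝ, ∀ x, qf M x ≤ T → ∀ i, |x i| ≤ B := by
  set S := M + Mᵀ
  let r : κ → ℝ := fun i => 4 * qf M (S.adjugate i) * |T| / S.det ^ 2
  have hr : ∀ i, 0 ≤ r i := fun i => by
    have := hM (S.adjugate i)
    positivity
  refine ⟨1 + ∑ i, r i, fun x hx i => ?_⟩
  have h1 : S.adjugate i ⬝ᵥ S *ᵥ x = S.det * x i := by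
    have h := congrFun (congrArg (fun A : Matrix κ κ ℝ => A *ᵥ x) S.adjugate_mul) i
    simp only [Matrix.smul_mulVec, Matrix.one_mulVec, Pi.smul_apply, smul_eq_mul,
      ← Matrix.mulVec_mulVec] at h
    exact h
  have h2 := sq_polar_le hM (S.adjugate i) x
  have h3 : x i ^ 2 ≤ r i := by
    rw [h1, mul_pow] at h2
    rw [le_div_iff₀ (by positivity), mul_comm]
    refine h2.trans (mul_le_mul_of_nonneg_left (hx.trans (le_abs_self T)) ?_)
    have := hM (S.adjugate i)
    positivity
  have h4 : r i ≤ ∑ i, r i := Finset.single_le_sum (fun j _ => hr j) (Finset.mem_univ i)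
  refine abs_le.2 ⟨?_, ?_⟩
  · nlinarith [sq_nonneg (x i + 1 / 2)]
  · nlinarith [sq_nonneg (x i - 1 / 2)]

lemma qf_nonneg_of_intCast {M : Matrix κ κ ℝ} (hM : ∀ z : κ → ℤ, 0 ≤ qf M fun i => z i)
    (x : κ → ℝ) : 0 ≤ qf M x := by
  have hcont : Continuous (qf M) := by
    unfold qf
    fun_prop
  have hdense : DenseRange (Pi.map fun _ : κ => ((↑) : ℚ → ℝ)) :=
    DenseRange.piMap fun _ => Rat.denseRange_cast
  refine hdense.induction_on x (isClosed_le continuous_const hcont) fun q => ?_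
  obtain ⟨N, hN⟩ := IsLocalization.exist_integer_multiples_of_finite (nonZeroDivisors ℤ) q
  choose z hz using hN
  have h1 : (fun i => (z i : ℝ)) = ((N : ℤ) : ℝ) • Pi.map (fun _ : κ => ((↑) : ℚ → ℝ)) q := by
    funext i
    have h := congrArg ((↑) : ℚ → ℝ) (hz i)
    simpa using h
  have h2 := hM z
  rw [h1, qf_smul] at h2
  have hN0 : ((N : ℤ) : ℝ) ≠ 0 := Int.cast_ne_zero.2 (nonZeroDivisors.coe_ne_zero N)
  exact nonneg_of_mul_nonneg_right h2 (by positivity)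

variable {A : Type*} [CommRing A]

lemma det_polar_ne_zero [DecidableEq κ] [IsDomain A] {C : Matrix κ κ A}
    (hC : ∀ v, v ≠ 0 → qf C v ≠ 0) (h2 : (2 : A) ≠ 0) : (C + Cᵀ).det ≠ 0 := fun h => by
  obtain ⟨v, hv, h⟩ := Matrix.exists_mulVec_eq_zero_iff.2 h
  have h1 := polar_self C v
  rw [h, dotProduct_zero] at h1
  exact (mul_ne_zero h2 (hC v hv)) h1.symm

end BoundedCoordinates

section TotallyRealExtensions

open NumberField Module

lemma finite_integral_of_bounded_conjugates (Ω : Type*) [Field Ω] [CharZero Ω] (N : ℕ) (B : ℝ) :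
    ∃ X : Set Ω, X.Finite ∧ ∀ (L : Type*) [Field L] [NumberField L] (f : L →+* Ω) (x : L),
      finrank ℚ L ≤ N → IsIntegral ℤ x → (∀ ψ : L →+* ℂ, ‖ψ x‖ ≤ B) → f x ∈ X := by
  classical
  let Y : ℝ := ∑ k ∈ Finset.range (N + 1), max B 1 ^ k * k.choose (k / 2)
  refine ⟨_, Polynomial.bUnion_roots_finite (algebraMap ℤ Ω) N
    (Set.finite_Icc (-⌈Y⌉₊ : ℤ) ⌈Y⌉₊), fun L _ _ f x hL hx hB => ?_⟩
  have hmin := minpoly.isIntegrallyClosed_eq_field_fractions' ℚ hx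
  simp_rw [Set.mem_iUnion]
  refine ⟨minpoly ℤ x, ⟨?_, fun i => ?_⟩, ?_⟩
  · rw [← (minpoly.monic hx).natDegree_map (algebraMap ℤ ℚ), ← hmin]
    exact (minpoly.natDegree_le x).trans hL
  · rw [Set.mem_Icc, ← abs_le, ← @Int.cast_le ℝ]
    have h1 : max B 1 ^ finrank ℚ L * (finrank ℚ L).choose (finrank ℚ L / 2) ≤ Y :=
      Finset.single_le_sum (f := fun k => max B 1 ^ k * (k.choose (k / 2) : ℝ))
        (fun k _ => by positivity) (Finset.mem_range.2 (Nat.lt_succ_of_le hL))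
    refine ((Eq.trans_le ?_ (Embeddings.coeff_bdd_of_norm_le hB i)).trans h1).trans (Nat.le_ceil _)
    rw [hmin, Polynomial.coeff_map, eq_intCast, Int.norm_cast_rat, Int.norm_eq_abs, Int.cast_abs]
  · rw [Finset.mem_coe, Multiset.mem_toFinset, Polynomial.mem_roots
      ((minpoly.monic hx).map _).ne_zero, Polynomial.IsRoot, Polynomial.eval_map]
    have h := congrArg f (minpoly.aeval ℤ x)
    rw [map_zero, Polynomial.aeval_def, Polynomial.hom_eval₂] at h
    rwa [← RingHom.ext_int (f.comp (algebraMap ℤ L)) (algebraMap ℤ Ω)]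

variable {K : Type*} [Field K] {κ : Type*} [Fintype κ]

lemma qf_toReal_nonneg {C : Matrix κ κ (𝓞 K)} (hK : ∀ φ : K →+* ℂ, ∀ x : K, (φ x).im = 0)
    (hC : ∀ v, v ≠ 0 → ∀ σ : K →+* ℝ, 0 < σ (algebraMap (𝓞 K) K (qf C v))) (φ : K →+* ℂ)
    (x : κ → ℝ) :
    0 ≤ qf (C.map ((φ.toReal (hK φ)).comp (algebraMap (𝓞 K) K))) x := by
  refine qf_nonneg_of_intCast (fun z => ?_) x
  have h := map_qf ((φ.toReal (hK φ)).comp (algebraMap (𝓞 K) K)) C (fun i => (z i : 𝓞 K))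
  simp only [map_intCast] at h
  rw [← h]
  by_cases hz : (fun i => (z i : 𝓞 K)) = 0
  · rw [hz, qf_zero, map_zero]
  · exact (hC _ hz (φ.toReal (hK φ))).le

variable {L : Type*} [Field L] [Algebra K L]

lemma qf_toReal_eq {C : Matrix κ κ (𝓞 K)} (hK : ∀ φ : K →+* ℂ, ∀ x : K, (φ x).im = 0)
    (ψ : L →+* ℂ) (hψ : ∀ x, (ψ x).im = 0) {x : κ → L} {a : 𝓞 K}
    (hx : qf (C.map ((algebraMap K L).comp (algebraMap (𝓞 K) K))) x =
      algebraMap K L (algebraMap (𝓞 K) K a)) :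
    qf (C.map (((ψ.comp (algebraMap K L)).toReal (hK _)).comp (algebraMap (𝓞 K) K)))
      (fun i => ψ.toReal hψ (x i)) =
      (ψ.comp (algebraMap K L)).toReal (hK _) (algebraMap (𝓞 K) K a) := by
  have h := congrArg (ψ.toReal hψ) hx
  rw [map_qf, Matrix.map_map] at h
  exact h

/-- Integers of the base field represented over a totally real extension are totally positive. -/
lemma toReal_pos_of_qf_eq {C : Matrix κ κ (𝓞 K)} (hK : ∀ φ : K →+* ℂ, ∀ x : K, (φ x).im = 0)
    (hC : ∀ v, v ≠ 0 → ∀ σ : K →+* ℝ, 0 < σ (algebraMap (𝓞 K) K (qf C v)))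
    [Algebra.IsAlgebraic K L] (hL : ∀ ψ : L →+* ℂ, ∀ x, (ψ x).im = 0) {x : κ → L} {a : 𝓞 K}
    (hx : qf (C.map ((algebraMap K L).comp (algebraMap (𝓞 K) K))) x =
      algebraMap K L (algebraMap (𝓞 K) K a)) (ha : a ≠ 0) (φ : K →+* ℂ) :
    0 < φ.toReal (hK φ) (algebraMap (𝓞 K) K a) := by
  obtain ⟨ψ, rfl⟩ : ∃ ψ : L →+* ℂ, ψ.comp (algebraMap K L) = φ := by
    let := φ.toAlgebra
    exact ⟨(IsAlgClosed.lift (R := K) (M := ℂ) (S := L) : L →ₐ[K] ℂ), AlgHom.comp_algebraMap _⟩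
  refine lt_of_le_of_ne ?_ fun h => ha ?_
  · rw [← qf_toReal_eq hK ψ (hL ψ) hx]
    exact qf_toReal_nonneg hK hC _ _
  · exact RingOfIntegers.coe_eq_zero_iff.1 ((map_eq_zero _).1 h.symm)

lemma exists_norm_le_of_qf_eq [NumberField K] [DecidableEq κ] {C : Matrix κ κ (𝓞 K)}
    (hK : ∀ φ : K →+* ℂ, ∀ x : K, (φ x).im = 0)
    (hC : ∀ v, v ≠ 0 → ∀ σ : K →+* ℝ, 0 < σ (algebraMap (𝓞 K) K (qf C v)))
    (hdet : (C + Cᵀ).det ≠ 0) {E : Set (𝓞 K)} (hE : E.Finite) :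
    ∃ B : ℝ, ∀ (L : Type*) [Field L] [Algebra K L], (∀ ψ : L →+* ℂ, ∀ x, (ψ x).im = 0) →
      ∀ (x : κ → L), ∀ a ∈ E, qf (C.map ((algebraMap K L).comp (algebraMap (𝓞 K) K))) x =
        algebraMap K L (algebraMap (𝓞 K) K a) → ∀ (ψ : L →+* ℂ) i, ‖ψ (x i)‖ ≤ B := by
  have h1 : ∀ (φ : K →+* ℂ) (a : 𝓞 K), ∃ B : ℝ, ∀ x,
      qf (C.map ((φ.toReal (hK φ)).comp (algebraMap (𝓞 K) K))) x ≤
        φ.toReal (hK φ) (algebraMap (𝓞 K) K a) → ∀ i, |x i| ≤ B := fun φ a => by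
    refine exists_abs_le_of_qf_le (qf_toReal_nonneg hK hC φ) ?_ _
    have h2 := RingHom.map_det ((φ.toReal (hK φ)).comp (algebraMap (𝓞 K) K)) (C + Cᵀ)
    rw [RingHom.mapMatrix_apply, Matrix.map_add _ (map_add _), Matrix.transpose_map] at h2
    rw [← h2]
    refine (map_ne_zero_iff ((φ.toReal (hK φ)).comp (algebraMap (𝓞 K) K)) ?_).2 hdet
    exact (φ.toReal (hK φ)).injective.comp RingOfIntegers.coe_injective
  choose B hB using h1
  refine ⟨∑ φ, ∑ a ∈ hE.toFinset, |B φ a|, fun L _ _ hL x a ha hx ψ i => ?_⟩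
  have h2 := hB (ψ.comp (algebraMap K L)) a _ (qf_toReal_eq hK ψ (hL ψ) hx).le i
  rw [RingHom.abs_toReal] at h2
  refine (h2.trans (le_abs_self _)).trans ?_
  refine (Finset.single_le_sum (f := fun a => |B (ψ.comp (algebraMap K L)) a|)
    (fun _ _ => abs_nonneg _) (hE.mem_toFinset.2 ha)).trans ?_
  exact Finset.single_le_sum (f := fun φ => ∑ a ∈ hE.toFinset, |B φ a|)
    (fun _ _ => Finset.sum_nonneg fun _ _ => abs_nonneg _) (Finset.mem_univ _)

end TotallyRealExtensions

section RepresentationsOverExtensions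

open NumberField Module

variable {K : Type*} [Field K] [NumberField K] {κ : Type*} [Fintype κ]

lemma locallyRepresented_of_odd_finrank [DecidableEq κ] {L : Type*} [Field L] [NumberField L]
    [Algebra K L] (hodd : Odd (finrank K L)) {C : Matrix κ κ (𝓞 K)} {x : κ → L} {a : 𝓞 K}
    (hxi : ∀ i, IsIntegral ℤ (x i))
    (hx : qf (C.map ((algebraMap K L).comp (algebraMap (𝓞 K) K))) x =
      algebraMap K L (algebraMap (𝓞 K) K a)) : LocallyRepresented C a := fun v k => by
  have := v.isMaximal
  refine exists_qf_sub_mem_of_odd_finrank hodd C a (fun i => (⟨x i, hxi i⟩ : 𝓞 L)) ?_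
    v.asIdeal v.ne_bot k
  exact RingOfIntegers.coe_injective ((map_qf (algebraMap (𝓞 L) L) _ _).trans hx)

lemma qf_map_smul {A B : Type*} [CommRing A] [CommRing B] (f : A →+* B) {C : Matrix κ κ A}
    {x : κ → B} {a : A} (hx : qf (C.map f) x = f a) (u : A) :
    qf (C.map f) (f u • x) = f (u ^ 2 * a) := by
  rw [qf_smul, hx, map_mul, map_pow]

lemma qf_comp_eq_iff {A B D : Type*} [CommRing A] [CommRing B] [CommRing D] (f : A →+* B)
    {g : B →+* D} (hg : Function.Injective g) {C : Matrix κ κ A} {x : κ → B} {a : A} :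
    qf (C.map (g.comp f)) (fun i => g (x i)) = g.comp f a ↔ qf (C.map f) x = f a := by
  rw [RingHom.comp_apply, ← hg.eq_iff, map_qf g, Matrix.map_map]
  rfl

end RepresentationsOverExtensions

open NumberField MvPolynomial

/-- Let `K` be a totally real number field, `Q` a positive definite quadratic
form in `n ≥ 5` variables over `𝓞 K` and `d` a positive integer. Inside a fixed algebraic
closure of `K`, there are only finitely many totally real fields `L ⊇ K` with `[L : K] = 2d+1`
such that `Q(𝓞 L) ∩ 𝓞 K ≠ Q(𝓞 K)` while `Q(𝓞 L') ∩ 𝓞 K = Q(𝓞 K)` for every proper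
intermediate field `K ⊆ L' ⊊ L`. -/
theorem statement4
    (K : Type) [Field K] [NumberField K]
    (hK : ∀ σ : K →+* ℂ, ∀ x : K, (σ x).im = 0)
    (n : ℕ) (hn : 5 ≤ n)
    (Q : MvPolynomial (Fin n) (𝓞 K)) (hQ : Q.IsHomogeneous 2)
    (hpos : ∀ v : Fin n → 𝓞 K, v ≠ 0 →
      ∀ σ : K →+* ℝ, 0 < σ (algebraMap (𝓞 K) K (eval v Q)))
    (d : ℕ) (hd : 0 < d) :
    {L : IntermediateField K (AlgebraicClosure K) |
      (∀ σ : L →+* ℂ, ∀ x : L, (σ x).im = 0) ∧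
      Module.finrank K L = 2 * d + 1 ∧
      ({a : 𝓞 K | ∃ x : Fin n → L, (∀ i, IsIntegral ℤ (x i)) ∧
          eval₂ ((algebraMap K L).comp (algebraMap (𝓞 K) K)) x Q
            = algebraMap K L (algebraMap (𝓞 K) K a)} ≠
        {a : 𝓞 K | ∃ x : Fin n → 𝓞 K, eval x Q = a}) ∧
      (∀ L' : IntermediateField K (AlgebraicClosure K), L' < L →
        {a : 𝓞 K | ∃ x : Fin n → L', (∀ i, IsIntegral ℤ (x i)) ∧
            eval₂ ((algebraMap K L').comp (algebraMap (𝓞 K) K)) x Q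
              = algebraMap K L' (algebraMap (𝓞 K) K a)} =
          {a : 𝓞 K | ∃ x : Fin n → 𝓞 K, eval x Q = a})}.Finite := by
  obtain ⟨C, hCeval⟩ := exists_matrix_of_isHomogeneous Q hQ
  have heval : ∀ v, eval v Q = qf C v := fun v => hCeval (RingHom.id (𝓞 K)) v
  simp only [heval] at hpos ⊢
  simp only [hCeval]
  have φ₀ : K →+* ℂ := Classical.arbitrary _
  have hne : ∀ v, v ≠ 0 → qf C v ≠ 0 := fun v hv h => by
    have h1 := hpos v hv (φ₀.toReal (hK φ₀))
    rw [h, map_zero, map_zero] at h1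
    exact h1.false
  have hdet := det_polar_ne_zero hne two_ne_zero
  let k₀ : Fin n := ⟨0, by omega⟩
  obtain ⟨E, hE, hEmem⟩ := exists_finite_exceptions hK hdet (by simpa using hn) k₀ fun φ => by
    have h := hpos (Pi.single k₀ 1) (by simp) (φ.toReal (hK φ))
    simpa [qf] using h
  obtain ⟨B, hB⟩ := exists_norm_le_of_qf_eq hK hpos hdet hE
  obtain ⟨X, hX, hXmem⟩ := finite_integral_of_bounded_conjugates (AlgebraicClosure K)
    (Module.finrank ℚ K * (2 * d + 1)) B
  refine ((Set.Finite.pi' fun _ : Fin n => hX).image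
    fun f => IntermediateField.adjoin K (Set.range f)).subset ?_
  rintro L ⟨hL, hdeg, hneq, hmin⟩
  have : FiniteDimensional K L := Module.finite_of_finrank_pos (by omega)
  have : FiniteDimensional ℚ L := FiniteDimensional.trans ℚ K L
  have : NumberField L := ⟨⟩
  obtain ⟨a, ⟨x, hxi, hx⟩, ha⟩ : ∃ a : 𝓞 K, (∃ x : Fin n → L, (∀ i, IsIntegral ℤ (x i)) ∧
      qf (C.map ((algebraMap K L).comp (algebraMap (𝓞 K) K))) x =
        algebraMap K L (algebraMap (𝓞 K) K a)) ∧ ¬ ∃ x, qf C x = a := by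
    by_contra! h
    refine hneq (Set.Subset.antisymm (fun a ha => h a ha) ?_)
    rintro _ ⟨y, rfl⟩
    exact ⟨fun i => algebraMap K L (y i), fun i => (y i).isIntegral_coe.algebraMap,
      (map_qf ((algebraMap K L).comp (algebraMap (𝓞 K) K)) C y).symm⟩
  have ha0 : a ≠ 0 := by
    rintro rfl
    exact ha ⟨0, qf_zero C⟩
  obtain ⟨u, hu⟩ := hEmem a (locallyRepresented_of_odd_finrank ⟨d, hdeg⟩ hxi hx)
    (toReal_pos_of_qf_eq hK hpos hL hx ha0) ha
  obtain ⟨x', hxi', hx'⟩ : ∃ x' : Fin n → L, (∀ i, IsIntegral ℤ (x' i)) ∧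
      qf (C.map ((algebraMap K L).comp (algebraMap (𝓞 K) K))) x' =
        algebraMap K L (algebraMap (𝓞 K) K ((u : 𝓞 K) ^ 2 * a)) :=
    ⟨_, fun i => ((u : 𝓞 K).isIntegral_coe.algebraMap).mul (hxi i),
      qf_map_smul ((algebraMap K L).comp (algebraMap (𝓞 K) K)) hx u⟩
  have ha' : ¬ ∃ y, qf C y = (u : 𝓞 K) ^ 2 * a := fun h => ha (exists_qf_eq_of_units_sq_mul u h)
  refine ⟨fun i => (x' i : L), fun i => hXmem L L.val.toRingHom _ ?_ (hxi' i)
    fun ψ => hB L hL _ _ hu hx' ψ i, ?_⟩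
  · rw [← hdeg, Module.finrank_mul_finrank]
  set L' := IntermediateField.adjoin K (Set.range fun i => ((x' i : L) : AlgebraicClosure K))
  have hle : L' ≤ L := by
    rw [IntermediateField.adjoin_le_iff]
    rintro _ ⟨i, rfl⟩
    exact (x' i).2
  by_contra hL'
  have hmem := hmin L' (lt_of_le_of_ne hle hL')
  let y : Fin n → L' := fun i => ⟨x' i, IntermediateField.subset_adjoin K _ ⟨i, rfl⟩⟩
  have hy : (fun i => algebraMap L (AlgebraicClosure K) (x' i)) =
      fun i => algebraMap L' (AlgebraicClosure K) (y i) := rfl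
  refine ha' (hmem.subset ⟨y, fun i => ?_, ?_⟩)
  · have h : IsIntegral ℤ (x' i : AlgebraicClosure K) := (hxi' i).map (L.val.restrictScalars ℤ)
    exact (isIntegral_algHom_iff (L'.val.restrictScalars ℤ) L'.val.injective).1 h
  · have h := (qf_comp_eq_iff _ (algebraMap L (AlgebraicClosure K)).injective).2 hx'
    have hcomp : (algebraMap L (AlgebraicClosure K)).comp
          ((algebraMap K L).comp (algebraMap (𝓞 K) K)) =
        (algebraMap L' (AlgebraicClosure K)).comp
          ((algebraMap K L').comp (algebraMap (𝓞 K) K)) := rfl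
    rw [hy, hcomp] at h
    exact (qf_comp_eq_iff _ (algebraMap L' (AlgebraicClosure K)).injective).1 h
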